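/- Let A and B be C*-algebras. A closed two-sided ideal K of A ⊗̂ B is prime if and only if K = A ⊗̂ F + E ⊗̂ B for some prime closed ideals E of A and F of B. -/

import Mathlib

open scoped TensorProduct
open Pointwise

universe u

noncomputable section

/-- A C⋆-norm on a complex `*`-algebra.  On a matrix algebra over a C⋆-algebra such a
norm is unique, namely the canonical C⋆-norm. -/
structure IsCStarNorm {M : Type*} [NonUnitalRing M] [StarRing M] [Module ℂ M]
    (N : M → ℝ) : Prop where
  add_le : ∀ x y, N (x + y) ≤ N x + N y
  smul_eq : ∀ (c : ℂ) (x : M), N (c • x) = ‖c‖ * N x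
  eq_zero_of : ∀ x, N x = 0 → x = 0
  mul_le : ∀ x y, N (x * y) ≤ N x * N y
  star_mul_self : ∀ x, N (star x * x) = N x * N x

/-- The operator space projective tensor norm `‖·‖_∧` on the algebraic tensor product
`A ⊗ B`, relative to given families of matrix norms on `A` and `B`:
`‖u‖_∧ = inf { ‖α‖ ‖v‖ ‖w‖ ‖β‖ : u = α (v ⊗ w) β }` where `v ∈ M_p(A)`, `w ∈ M_q(B)`,
`α ∈ M_{1,pq}(ℂ)` and `β ∈ M_{pq,1}(ℂ)` (row and column vectors carrying the Euclidean
norm, which is their norm as scalar matrices). -/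
noncomputable def osProjNorm {A B : Type u}
    [AddCommGroup A] [Module ℂ A] [AddCommGroup B] [Module ℂ B]
    (NA : ∀ p : ℕ, Matrix (Fin p) (Fin p) A → ℝ)
    (NB : ∀ q : ℕ, Matrix (Fin q) (Fin q) B → ℝ) (u : A ⊗[ℂ] B) : ℝ :=
  sInf { r : ℝ | ∃ (p q : ℕ) (α : Fin p × Fin q → ℂ) (v : Matrix (Fin p) (Fin p) A)
      (w : Matrix (Fin q) (Fin q) B) (β : Fin p × Fin q → ℂ),
      u = ∑ ik : Fin p × Fin q, ∑ jl : Fin p × Fin q,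
            (α ik * β jl) • (v ik.1 jl.1 ⊗ₜ[ℂ] w ik.2 jl.2) ∧
      r = Real.sqrt (∑ ik, ‖α ik‖ ^ 2) * NA p v * NB q w *
            Real.sqrt (∑ jl, ‖β jl‖ ^ 2) }

/-- `X` is a completion of the algebraic tensor product `A ⊗ B` with respect to the
norm `ν`, via the (necessarily isometric) dense embedding `ι`, and the multiplication and
involution of `X` are the canonical ones induced from `A` and `B`.  Applied with
`ν = osProjNorm NA NB` (for the canonical matrix C⋆-norms `NA`, `NB`) this characterizes
the Banach `*`-algebra `A ⊗̂ B` (the operator space projective tensor product) up to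
isometric `*`-isomorphism; applied with `ν = bsProjNorm` it characterizes the Banach
space projective tensor product `A ⊗_γ B`. -/
structure IsTensorCompletion {A B : Type u} [NonUnitalRing A] [StarRing A] [Module ℂ A]
    [NonUnitalRing B] [StarRing B] [Module ℂ B] (ν : A ⊗[ℂ] B → ℝ)
    (X : Type u) [NonUnitalNormedRing X] [StarRing X] [NormedSpace ℂ X] [CompleteSpace X]
    (ι : A ⊗[ℂ] B →ₗ[ℂ] X) : Prop where
  norm_eq : ∀ u, ‖ι u‖ = ν u
  dense : DenseRange ι
  mul_tmul : ∀ (a c : A) (b d : B),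
    ι (a ⊗ₜ[ℂ] b) * ι (c ⊗ₜ[ℂ] d) = ι ((a * c) ⊗ₜ[ℂ] (b * d))
  star_tmul : ∀ (a : A) (b : B), star (ι (a ⊗ₜ[ℂ] b)) = ι (star a ⊗ₜ[ℂ] star b)

/-- The product ideal `S ⊗̂ T`: the closure in `X` (a completion of `A ⊗ B`) of the span of
elementary tensors `a ⊗ b` with `a ∈ S`, `b ∈ T`. -/
def tensorIdeal {A B : Type u} [NonUnitalRing A] [StarRing A] [Module ℂ A]
    [NonUnitalRing B] [StarRing B] [Module ℂ B]
    {X : Type u} [NonUnitalNormedRing X] [StarRing X] [NormedSpace ℂ X] [CompleteSpace X]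
    (ι : A ⊗[ℂ] B →ₗ[ℂ] X) (S : Set A) (T : Set B) : Set X :=
  closure (ι '' (Submodule.span ℂ (Set.image2 (fun a b => a ⊗ₜ[ℂ] b) S T)))

/-- A closed prime (two-sided) ideal of a Banach algebra: a proper closed two-sided ideal `K`
such that whenever the product of two closed two-sided ideals is contained in `K`, one of them
is contained in `K`. -/
def IsClosedPrimeIdeal {Y : Type u} [NonUnitalNormedRing Y] (K : TwoSidedIdeal Y) : Prop :=
  IsClosed (K : Set Y) ∧ (K : Set Y) ≠ Set.univ ∧
    ∀ I J : TwoSidedIdeal Y, IsClosed (I : Set Y) → IsClosed (J : Set Y) →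
      (∀ x ∈ I, ∀ y ∈ J, x * y ∈ K) → (I : Set Y) ⊆ (K : Set Y) ∨ (J : Set Y) ⊆ (K : Set Y)

/-- An irreducible continuous `*`-representation of a Banach `*`-algebra `Y` on a complex
Hilbert space. -/
structure IrreducibleRepOn (Y : Type u)
    [NonUnitalNormedRing Y] [StarRing Y] [NormedSpace ℂ Y] where
  H : Type u
  [normH : NormedAddCommGroup H]
  [ipsH : InnerProductSpace ℂ H]
  [csH : CompleteSpace H]
  π : Y →⋆ₙₐ[ℂ] (H →L[ℂ] H)
  continuous : Continuous π
  nonzero : ∃ y, π y ≠ 0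
  irreducible : ∀ S : Submodule ℂ H, IsClosed (S : Set H) →
    (∀ y : Y, ∀ v ∈ S, π y v ∈ S) → S = ⊥ ∨ S = ⊤

/-- A primitive ideal: the kernel of an irreducible `*`-representation. -/
def IsPrimitiveIdeal {Y : Type u} [NonUnitalNormedRing Y] [StarRing Y] [NormedSpace ℂ Y]
    (K : TwoSidedIdeal Y) : Prop :=
  ∃ ρ : IrreducibleRepOn Y, ∀ y, y ∈ K ↔ ρ.π y = 0

/-- A subset `K` of a ring is modular (as an ideal) if there is a relative unit `e`
with `x * e - x ∈ K` and `e * x - x ∈ K` for every `x`. -/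
def IsModularIdealSet {Y : Type u} [NonUnitalRing Y] (K : Set Y) : Prop :=
  ∃ e : Y, ∀ x : Y, x * e - x ∈ K ∧ e * x - x ∈ K

/-- A maximal modular (two-sided) ideal: a modular ideal which is proper and maximal among
proper two-sided ideals. -/
def IsMaximalModularIdeal {Y : Type u} [NonUnitalRing Y] (K : TwoSidedIdeal Y) : Prop :=
  IsModularIdealSet (K : Set Y) ∧ (K : Set Y) ≠ Set.univ ∧
    ∀ L : TwoSidedIdeal Y, (K : Set Y) ⊆ (L : Set Y) →
      (L : Set Y) = (K : Set Y) ∨ (L : Set Y) = Set.univ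

/-- The operator norm of a `p × p` matrix of bounded operators on a Hilbert space `H`,
viewed as an operator on the `ℓ²`-direct sum `H ⊕ ⋯ ⊕ H`. -/
noncomputable def opMatrixNorm {H : Type u} [NormedAddCommGroup H] [InnerProductSpace ℂ H]
    {p : ℕ} (T : Matrix (Fin p) (Fin p) (H →L[ℂ] H)) : ℝ :=
  sSup { r : ℝ | ∃ x : Fin p → H, (∑ i, ‖x i‖ ^ 2) ≤ 1 ∧
      r = Real.sqrt (∑ i, ‖∑ j, (T i j) (x j)‖ ^ 2) }

/-- An operator algebra structure on a Banach algebra `Y`: a bicontinuous algebra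
homomorphism of `Y` into the bounded operators on some Hilbert space. -/
structure OperatorAlgebraEmbedding (Y : Type u) [NonUnitalNormedRing Y] [NormedSpace ℂ Y] where
  H : Type u
  [normH : NormedAddCommGroup H]
  [ipsH : InnerProductSpace ℂ H]
  [csH : CompleteSpace H]
  ρ : Y →ₙₐ[ℂ] (H →L[ℂ] H)
  c : ℝ
  C : ℝ
  c_pos : 0 < c
  lower : ∀ y, c * ‖y‖ ≤ ‖ρ y‖
  upper : ∀ y, ‖ρ y‖ ≤ C * ‖y‖

/-- The matrix norms on `Y` induced by an operator algebra embedding, giving `Y` its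
operator space structure: the norm of `v ∈ M_p(Y)` is the operator norm of the matrix
of operators obtained by applying the embedding entrywise. -/
noncomputable def OperatorAlgebraEmbedding.matrixNorm {Y : Type u}
    [NonUnitalNormedRing Y] [NormedSpace ℂ Y] (e : OperatorAlgebraEmbedding Y)
    (p : ℕ) (v : Matrix (Fin p) (Fin p) Y) : ℝ :=
  letI := e.normH; letI := e.ipsH
  opMatrixNorm (v.map e.ρ)

/-- The Banach space projective tensor norm `‖·‖_γ` on the algebraic tensor product. -/
noncomputable def bsProjNorm {A B : Type u} [NonUnitalNormedRing A] [NormedSpace ℂ A]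
    [NonUnitalNormedRing B] [NormedSpace ℂ B] (u : A ⊗[ℂ] B) : ℝ :=
  sInf { r : ℝ | ∃ (n : ℕ) (a : Fin n → A) (b : Fin n → B),
      u = ∑ i, a i ⊗ₜ[ℂ] b i ∧ r = ∑ i, ‖a i‖ * ‖b i‖ }

/-- A C⋆-algebra `A` is subhomogeneous if there is `n : ℕ` bounding the (finite)
dimensions of all its irreducible `*`-representations. -/
def IsSubhomogeneous (A : Type u) [NonUnitalCStarAlgebra A] : Prop :=
  ∃ n : ℕ, ∀ ρ : IrreducibleRepOn A,
    letI := ρ.normH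
    letI := ρ.ipsH
    FiniteDimensional ℂ ρ.H ∧ Module.finrank ℂ ρ.H ≤ n


namespace GT

section unital
variable {M : Type*} [CStarAlgebra M]

lemma spec_abs_le {h : M} (hh : IsSelfAdjoint h) {x : ℝ} (hx : x ∈ spectrum ℝ h) : |x| ≤ ‖h‖ := by
  simpa using IsometricContinuousFunctionalCalculus.norm_spectrum_le (𝕜 := ℝ) h hx hh

/-- the element `√(1-h²)` -/
def cc (h : M) : M := cfc (fun x : ℝ => √(1 - x ^ 2)) h

lemma cc_sa (h : M) : IsSelfAdjoint (cc h) := cfc_predicate _ _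

lemma cc_sq {h : M} (hh : IsSelfAdjoint h) (h1 : ‖h‖ ≤ 1) : cc h * cc h = 1 - h * h := by
  have e1 : (1 : M) - h * h = cfc (fun x : ℝ => 1 - x * x) h := by
    rw [cfc_sub .., cfc_mul .., cfc_const_one .., cfc_id' ..]
  rw [e1, cc, ← cfc_mul ..]
  apply cfc_congr
  intro x hx
  have := spec_abs_le hh hx
  have h2 : |x| ≤ 1 := this.trans h1
  have h3 : 0 ≤ 1 - x ^ 2 := by
    have := sq_le_one_iff_abs_le_one x |>.2 h2
    linarith
  simp only
  rw [Real.mul_self_sqrt h3]; ring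

lemma cc_comm {h : M} (hh : IsSelfAdjoint h) : cc h * h = h * cc h := by
  have e1 : h = cfc (fun x : ℝ => x) h := by rw [cfc_id' ..]
  have : cc h * cfc (fun x : ℝ => x) h = cfc (fun x : ℝ => x) h * cc h := by
    rw [cc, ← cfc_mul .., ← cfc_mul ..]
    congr 1; ext x; ring
  rwa [← e1] at this

lemma cc_unitary_add {h : M} (hh : IsSelfAdjoint h) (h1 : ‖h‖ ≤ 1) :
    cc h + Complex.I • h ∈ unitary M := by
  have hc := cc_sa h
  have hs : star (cc h + Complex.I • h) = cc h - Complex.I • h := by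
    simp [hc.star_eq, hh.star_eq, sub_eq_add_neg]
  rw [Unitary.mem_iff, hs]
  have h2 := cc_sq hh h1
  have h3 := cc_comm hh
  constructor
  · simp only [sub_mul, mul_add, smul_mul_assoc, mul_smul_comm, h2, h3]
    match_scalars <;> simp
  · simp only [add_mul, mul_sub, smul_mul_assoc, mul_smul_comm, h2, h3]
    match_scalars <;> simp

lemma cc_neg {h : M} (hh : IsSelfAdjoint h) : cc (-h) = cc h := by
  unfold cc
  rw [← cfc_comp_neg (fun x : ℝ => √(1 - x ^ 2)) h]
  simp

lemma cc_unitary_sub {h : M} (hh : IsSelfAdjoint h) (h1 : ‖h‖ ≤ 1) :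
    cc h - Complex.I • h ∈ unitary M := by
  have := cc_unitary_add hh.neg (by simpa using h1)
  rw [cc_neg hh] at this
  simpa [sub_eq_add_neg] using this

lemma one_sub_cc {h : M} (hh : IsSelfAdjoint h) :
    1 - cc h = cfc (fun x : ℝ => 1 - √(1 - x ^ 2)) h := by
  rw [cc, cfc_sub .., cfc_const_one ..]

lemma real_sqrt_bd1 {x : ℝ} (hx : |x| ≤ 1) : 0 ≤ 1 - √(1 - x ^ 2) ∧ 1 - √(1 - x ^ 2) ≤ x ^ 2 := by
  have h1 : x ^ 2 ≤ 1 := (sq_le_one_iff_abs_le_one x).2 hx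
  have h2 : √(1 - x ^ 2) ≤ 1 := Real.sqrt_le_one.2 (by nlinarith [sq_nonneg x])
  have h3 : 0 ≤ √(1 - x ^ 2) := Real.sqrt_nonneg _
  have h4 : √(1 - x ^ 2) ^ 2 = 1 - x ^ 2 := Real.sq_sqrt (by linarith)
  constructor <;> nlinarith

lemma real_sqrt_bd2 {x : ℝ} (hx : |x| ≤ 1) :
    |1 - √(1 - x ^ 2) - x * x / 2| ≤ x ^ 4 := by
  obtain ⟨h0, h1⟩ := real_sqrt_bd1 hx
  have h5 : x ^ 2 ≤ 1 := (sq_le_one_iff_abs_le_one x).2 hx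
  have h4 : √(1 - x ^ 2) ^ 2 = 1 - x ^ 2 := Real.sq_sqrt (by linarith)
  set s := √(1 - x ^ 2)
  have : 1 - s - x * x / 2 = (1 - s) ^ 2 / 2 := by nlinarith
  rw [this, abs_of_nonneg (by positivity)]
  have : (1 - s) ^ 2 ≤ (x ^ 2) ^ 2 := by gcongr
  nlinarith [sq_nonneg (x ^ 2)]

lemma norm_one_sub_cc {h : M} (hh : IsSelfAdjoint h) (h1 : ‖h‖ ≤ 1) : ‖1 - cc h‖ ≤ ‖h‖ ^ 2 := by
  rw [one_sub_cc hh]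
  apply norm_cfc_le (by positivity)
  intro x hx
  have h2 := spec_abs_le hh hx
  obtain ⟨h3, h4⟩ := real_sqrt_bd1 (h2.trans h1)
  rw [Real.norm_of_nonneg h3]
  calc _ ≤ x ^ 2 := h4
    _ = |x| ^ 2 := (sq_abs x).symm
    _ ≤ _ := by gcongr

lemma norm_one_sub_cc' {h : M} (hh : IsSelfAdjoint h) (h1 : ‖h‖ ≤ 1) :
    ‖1 - cc h - (1 / 2 : ℂ) • (h * h)‖ ≤ ‖h‖ ^ 4 := by
  have e1 : (1 / 2 : ℂ) • (h * h) = cfc (fun x : ℝ => (1 / 2 : ℝ) • (x * x)) h := by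
    rw [cfc_smul .., cfc_mul .., cfc_id' ..]
    rw [← Complex.coe_smul]; congr 1; norm_num
  rw [one_sub_cc hh, e1, ← cfc_sub ..]
  apply norm_cfc_le (by positivity)
  intro x hx
  have h2 := spec_abs_le hh hx
  have h3 := real_sqrt_bd2 (h2.trans h1)
  simp only [smul_eq_mul, Real.norm_eq_abs]
  calc _ = |1 - √(1 - x ^ 2) - x * x / 2| := by congr 1; ring
    _ ≤ x ^ 4 := h3
    _ = |x| ^ 4 := by rw [← abs_pow, abs_of_nonneg (by positivity)]
    _ ≤ _ := by gcongr

/-- used with `h = t p`. -/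
lemma norm_aux_pos {x : M} (hx : IsSelfAdjoint x) (hx1 : ‖x‖ ≤ 1) {t : ℝ} (ht : 0 < t)
    (ht1 : t ≤ 1 / 4) :
    ‖1 - ((2 * t ^ 2 : ℝ) • (1 - x) - (1 - cc (t • (1 - x))))‖ ≤ 1 := by
  have e0 : t • (1 - x) = cfc (fun y : ℝ => t • (1 - y)) x := by
    rw [cfc_smul .., cfc_sub .., cfc_const_one .., cfc_id' ..]
  have e1 : cc (t • (1 - x)) = cfc (fun y : ℝ => √(1 - (t • (1 - y)) ^ 2)) x := by
    rw [cc, e0, ← cfc_comp' (fun y : ℝ => √(1 - y ^ 2)) (fun y : ℝ => t • (1 - y)) x]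
  have e2 : (2 * t ^ 2 : ℝ) • (1 - x) = cfc (fun y : ℝ => (2 * t ^ 2) • (1 - y)) x := by
    rw [cfc_smul .., cfc_sub .., cfc_const_one .., cfc_id' ..]
  have e3 : (1 : M) = cfc (fun _ : ℝ => (1 : ℝ)) x := by rw [cfc_const_one ..]
  have : 1 - ((2 * t ^ 2 : ℝ) • (1 - x) - (1 - cc (t • (1 - x)))) =
      cfc (fun y : ℝ => 1 - ((2 * t ^ 2) • (1 - y) - (1 - √(1 - (t • (1 - y)) ^ 2)))) x := by
    rw [cfc_sub .., cfc_sub .., cfc_sub (fun y => (1 : ℝ)) .., cfc_const_one .., ← e1, ← e2]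
  rw [this]
  apply norm_cfc_le (by norm_num)
  intro y hy
  have h2 := (spec_abs_le hx hy).trans hx1
  have h3 := abs_le.1 h2
  simp only [smul_eq_mul]
  have hz : |t * (1 - y)| ≤ 1 := by rw [abs_le]; constructor <;> nlinarith
  obtain ⟨h4, h5⟩ := real_sqrt_bd1 hz
  rw [Real.norm_eq_abs, abs_le]
  have h6 : (t * (1 - y)) ^ 2 ≤ 2 * t ^ 2 * (1 - y) := by
    have : 0 ≤ t ^ 2 * ((1 - y) * (1 + y)) := by
      apply mul_nonneg (by positivity) (mul_nonneg (by linarith) (by linarith))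
    nlinarith
  have h7 : 2 * t ^ 2 * (1 - y) ≤ 1 := by
    have : t ^ 2 ≤ 1 / 16 := by nlinarith
    nlinarith
  constructor <;> linarith

/-- `f` is bounded by `s` on unitaries -/
def UB (f : M →ₗ[ℂ] ℂ) (s : ℝ) : Prop := ∀ U ∈ unitary M, ‖f U‖ ≤ s

lemma UB.nonneg {f : M →ₗ[ℂ] ℂ} {s : ℝ} (h : UB f s) : 0 ≤ s :=
  (norm_nonneg _).trans (h 1 (one_mem _))

lemma UB.sa {f : M →ₗ[ℂ] ℂ} {s : ℝ} (hf : UB f s) {h : M} (hh : IsSelfAdjoint h) (h1 : ‖h‖ ≤ 1) :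
    ‖f h‖ ≤ s := by
  have a1 := hf _ (cc_unitary_add hh h1)
  have a2 := hf _ (cc_unitary_sub hh h1)
  have e : f h = (f (cc h + Complex.I • h) - f (cc h - Complex.I • h)) * (-(Complex.I) / 2) := by
    simp only [map_add, map_sub, map_smul, smul_eq_mul]
    linear_combination (f h) * Complex.I_mul_I
  rw [e, norm_mul]
  simp only [norm_div, norm_neg, Complex.norm_I, Complex.norm_ofNat]
  have := norm_sub_le (f (cc h + Complex.I • h)) (f (cc h - Complex.I • h))
  linarith

lemma UB.sa' {f : M →ₗ[ℂ] ℂ} {s : ℝ} (hf : UB f s) {h : M} (hh : IsSelfAdjoint h) :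
    ‖f h‖ ≤ s * ‖h‖ := by
  rcases eq_or_ne h 0 with rfl | h0
  · simp
  have hn : ‖h‖ ≠ 0 := by simpa using h0
  have := hf.sa (h := (‖h‖⁻¹ : ℝ) • h) ((IsSelfAdjoint.all _).smul hh) (by
    rw [norm_smul]; simp [hn])
  rw [← Complex.coe_smul, map_smul, norm_smul] at this
  simp only [Complex.ofReal_inv, norm_inv, Complex.norm_real, norm_norm] at this
  rwa [inv_mul_le_iff₀ (by positivity), mul_comm] at this

lemma UB.gen {f : M →ₗ[ℂ] ℂ} {s : ℝ} (hf : UB f s) (x : M) : ‖f x‖ ≤ 2 * s * ‖x‖ := by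
  obtain ⟨u, c, hx, hc⟩ := CStarAlgebra.exists_sum_four_unitary x
  conv_lhs => rw [hx]
  rw [map_sum]
  calc _ ≤ ∑ i : Fin 4, ‖x‖ / 2 * s := by
        refine norm_sum_le_of_le _ fun i _ => ?_
        rw [map_smul, norm_smul]
        have := hf (u i) (u i).2
        have := hc i
        gcongr
    _ = _ := by simp; ring

/-- key estimate: imaginary part of `f h` small if `f 1` close to the bound. -/
lemma UB.im_le {f : M →ₗ[ℂ] ℂ} {s η : ℝ} (hf : UB f s) (h1 : s - η ≤ (f 1).re) {h : M}
    (hh : IsSelfAdjoint h) (hh1 : ‖h‖ ≤ 1) {t : ℝ} (ht : 0 < t) (ht1 : t ≤ 1) :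
    t * |(f h).im| ≤ η + s * t ^ 2 := by
  have hts : IsSelfAdjoint (t • h) := (IsSelfAdjoint.all _).smul hh
  have htn : ‖t • h‖ ≤ t := by
    rw [norm_smul, Real.norm_of_nonneg ht.le]; nlinarith
  have a1 := hf _ (cc_unitary_add hts (htn.trans ht1))
  have a2 := hf _ (cc_unitary_sub hts (htn.trans ht1))
  have a3 := hf.sa' (h := 1 - cc (t • h)) ((IsSelfAdjoint.one M).sub (cc_sa _))
  have a4 := norm_one_sub_cc hts (htn.trans ht1)
  have a5 : ‖t • h‖ ^ 2 ≤ t ^ 2 := by gcongr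
  have a6 : s * ‖1 - cc (t • h)‖ ≤ s * t ^ 2 := mul_le_mul_of_nonneg_left (a4.trans a5) hf.nonneg
  have b1 := (Complex.re_le_norm _).trans a1
  have b2 := (Complex.re_le_norm _).trans a2
  have b3 := (Complex.re_le_norm _).trans a3
  have e : f (Complex.I • t • h) = Complex.I * (t * f h) := by
    rw [map_smul, ← Complex.coe_smul, map_smul, smul_eq_mul, smul_eq_mul]
  have e2 : (f (Complex.I • t • h)).re = - (t * (f h).im) := by
    rw [e]; simp
  rw [map_add, Complex.add_re, e2] at b1
  rw [map_sub, Complex.sub_re, e2] at b2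
  rw [map_sub, Complex.sub_re] at b3
  rcases abs_cases (f h).im with ⟨h', _⟩ | ⟨h', _⟩ <;> rw [h'] <;> nlinarith

/-- positive functionals -/
def PosF {M : Type*} [NonUnitalRing M] [StarRing M] [Module ℂ M] (f : M →ₗ[ℂ] ℂ) : Prop :=
  ∀ x, 0 ≤ (f (star x * x)).re ∧ (f (star x * x)).im = 0

lemma UB.posF {f : M →ₗ[ℂ] ℂ} {s : ℝ} (hf : UB f s) (h1 : f 1 = s) : PosF f := by
  have key : ∀ h : M, IsSelfAdjoint h → ‖h‖ ≤ 1 → (f h).im = 0 := by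
    intro h hh hn
    by_contra hne
    have hpos : 0 < |(f h).im| := abs_pos.2 hne
    have hs := hf.nonneg
    have : ∀ t : ℝ, 0 < t → t ≤ 1 → |(f h).im| ≤ s * t := by
      intro t ht ht1
      have := hf.im_le (η := 0) (by simp [h1]) hh hn ht ht1
      have h2 : t * |(f h).im| ≤ t * (s * t) := by nlinarith
      exact le_of_mul_le_mul_left h2 ht
    set y := |(f h).im|
    have h3 := this 1 (by norm_num) le_rfl
    have hs0 : 0 < s := by linarith
    have h4 := this (y / (2 * s)) (by positivity) (by rw [div_le_one (by positivity)]; linarith)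
    have : s * (y / (2 * s)) = y / 2 := by field_simp
    linarith
  have key2 : ∀ x : M, ‖x‖ ≤ 1 → 0 ≤ (f (star x * x)).re ∧ (f (star x * x)).im = 0 := by
    intro x hx
    have hsa : IsSelfAdjoint (star x * x) := .star_mul_self x
    have hn : ‖star x * x‖ ≤ 1 := by
      rw [CStarRing.norm_star_mul_self]; nlinarith [norm_nonneg x]
    refine ⟨?_, key _ hsa hn⟩
    have h2 : ‖1 - star x * x‖ ≤ 1 := by
      let _ := CStarAlgebra.spectralOrder M
      let _ := CStarAlgebra.spectralOrderedRing M
      have h0 : 0 ≤ star x * x := star_mul_self_nonneg x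
      have h3 : star x * x ≤ 1 := (CStarAlgebra.norm_le_one_iff_of_nonneg _ h0).1 hn
      rw [CStarAlgebra.norm_le_one_iff_of_nonneg _ (sub_nonneg.2 h3)]
      simp
    have h4 := hf.sa ((IsSelfAdjoint.one M).sub hsa) h2
    have h5 := (Complex.re_le_norm _).trans h4
    rw [map_sub, h1] at h5
    simp at h5
    linarith
  intro x
  rcases eq_or_ne x 0 with rfl | h0
  · simp
  have hn : ‖x‖ ≠ 0 := by simpa using h0
  have hp : 0 < ‖x‖⁻¹ := by positivity
  have := key2 ((‖x‖⁻¹ : ℝ) • x) (by rw [norm_smul]; simp [hn])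
  have e : star ((‖x‖⁻¹ : ℝ) • x) * ((‖x‖⁻¹ : ℝ) • x) =
      ((‖x‖⁻¹ * ‖x‖⁻¹ : ℝ) : ℂ) • (star x * x) := by
    simp only [star_smul, star_trivial, smul_mul_assoc, mul_smul_comm, smul_smul, Complex.coe_smul]
  rw [e, map_smul, smul_eq_mul, Complex.re_ofReal_mul, Complex.im_ofReal_mul] at this
  refine ⟨?_, ?_⟩
  · exact nonneg_of_mul_nonneg_right this.1 (by positivity)
  · rcases mul_eq_zero.1 this.2 with h | h
    · exact absurd h (by positivity)
    · exact h

end unital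
end GT

namespace GT

section unital
variable {M M' : Type*} [CStarAlgebra M] [CStarAlgebra M']

/-- half sum with the adjoint -/
def hre (a : M) : M := (1 / 2 : ℂ) • (a + star a)

lemma hre_sa (a : M) : IsSelfAdjoint (hre a) := by
  simp [hre, isSelfAdjoint_iff, add_comm]

def him (a : M) : M := (-Complex.I / 2 : ℂ) • (a - star a)

lemma him_sa (a : M) : IsSelfAdjoint (him a) := by
  simp only [him, isSelfAdjoint_iff, star_smul, star_sub, star_star]
  match_scalars <;> simp <;> ring

lemma hre_add_him (a : M) : a = hre a + Complex.I • him a := by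
  simp only [hre, him]
  match_scalars
  · linear_combination (1/2 : ℂ) * Complex.I_mul_I
  · linear_combination (-1/2 : ℂ) * Complex.I_mul_I

lemma norm_unitary_le {a : M} (ha : a ∈ unitary M) : ‖a‖ ≤ 1 := by
  rcases subsingleton_or_nontrivial M with h | h
  · simp [Subsingleton.elim a 0]
  · exact (CStarRing.norm_of_mem_unitary ha).le

lemma hre_norm (a : M) : ‖hre a‖ ≤ ‖a‖ := by
  rw [hre, norm_smul]
  have := norm_add_le a (star a)
  rw [norm_star] at this
  norm_num; linarith

lemma him_norm (a : M) : ‖him a‖ ≤ ‖a‖ := by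
  rw [him, norm_smul]
  have := norm_sub_le a (star a)
  rw [norm_star] at this
  norm_num; linarith

lemma half_est {f : M →ₗ[ℂ] ℂ} (hf : UB f 1) {a : M} (ha : ‖a‖ ≤ 1)
    (h1 : 1 - 1 / 10000 ≤ (f 1).re) (h2 : 1 - 1 / 10000 ≤ (f a).re) :
    (f (1 - hre a)).re ≤ 0.0202 ∧
      (f (1 - cc ((1 / 16 : ℝ) • (1 - hre a)))).re ≤ 0.00026 := by
  have i1 := hf.im_le h1 (him_sa a) ((him_norm a).trans ha) (t := 1 / 100) (by norm_num) (by norm_num)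
  have e1 : (f a).re = (f (hre a)).re - (f (him a)).im := by
    conv_lhs => rw [hre_add_him a]
    simp [sub_eq_add_neg]
  have i2 := le_abs_self (f (him a)).im
  have i3 := neg_abs_le (f (him a)).im
  have e2 : (f (1 - hre a)).re = (f 1).re - (f (hre a)).re := by simp
  have i4 : (f 1).re ≤ 1 := (Complex.re_le_norm _).trans (hf 1 (one_mem _))
  have i5 : (f (1 - hre a)).re ≤ 0.0202 := by rw [e2]; norm_num at *; linarith
  refine ⟨i5, ?_⟩
  have hp := norm_aux_pos (hre_sa a) ((hre_norm a).trans ha) (t := 1 / 16) (by norm_num) (by norm_num)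
  have hsa : IsSelfAdjoint (1 - ((2 * (1 / 16) ^ 2 : ℝ) • (1 - hre a) -
      (1 - cc ((1 / 16 : ℝ) • (1 - hre a))))) := by
    refine (IsSelfAdjoint.one M).sub (.sub ?_ ((IsSelfAdjoint.one M).sub (cc_sa _)))
    exact (IsSelfAdjoint.all _).smul ((IsSelfAdjoint.one M).sub (hre_sa a))
  have i6 := (Complex.re_le_norm _).trans (hf.sa hsa hp)
  rw [map_sub, map_sub, ← Complex.coe_smul, map_smul, smul_eq_mul, Complex.sub_re, Complex.sub_re,
    Complex.re_ofReal_mul] at i6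
  norm_num at *
  linarith

/-- bounded on unitary pairs -/
def BUB (w : M →ₗ[ℂ] M' →ₗ[ℂ] ℂ) (s : ℝ) : Prop :=
  ∀ U ∈ unitary M, ∀ V ∈ unitary M', ‖w U V‖ ≤ s

lemma BUB.left {w : M →ₗ[ℂ] M' →ₗ[ℂ] ℂ} {s : ℝ} (h : BUB w s) {V : M'} (hV : V ∈ unitary M') :
    UB (w.flip V) s := fun U hU => h U hU V hV

lemma BUB.right {w : M →ₗ[ℂ] M' →ₗ[ℂ] ℂ} {s : ℝ} (h : BUB w s) {U : M} (hU : U ∈ unitary M) :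
    UB (w U) s := fun V hV => h U hU V hV

lemma BUB.sa {w : M →ₗ[ℂ] M' →ₗ[ℂ] ℂ} {s : ℝ} (h : BUB w s) {x : M} {y : M'}
    (hx : IsSelfAdjoint x) (hy : IsSelfAdjoint y) : ‖w x y‖ ≤ s * ‖x‖ * ‖y‖ := by
  have : UB (w.flip y) (s * ‖y‖) := fun U hU => (h.right hU).sa' hy
  have := this.sa' hx
  simp only [LinearMap.flip_apply] at this
  linarith

lemma BUB.gen {w : M →ₗ[ℂ] M' →ₗ[ℂ] ℂ} {s : ℝ} (h : BUB w s) (x : M) (y : M') :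
    ‖w x y‖ ≤ 4 * s * ‖x‖ * ‖y‖ := by
  have : UB (w.flip y) (2 * s * ‖y‖) := fun U hU => (h.right hU).gen y
  have := this.gen x
  simp only [LinearMap.flip_apply] at this
  linarith

lemma BUB.nonneg {w : M →ₗ[ℂ] M' →ₗ[ℂ] ℂ} {s : ℝ} (h : BUB w s) : 0 ≤ s :=
  (norm_nonneg _).trans (h 1 (one_mem _) 1 (one_mem _))

/-- the parallelogram estimate -/
lemma BUB.para {w : M →ₗ[ℂ] M' →ₗ[ℂ] ℂ} {s : ℝ} (hw : BUB w s) {h : M} {k : M'}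
    (hh : IsSelfAdjoint h) (hk : IsSelfAdjoint k) (h1 : ‖h‖ ≤ 1) (k1 : ‖k‖ ≤ 1) :
    (w (cc h) (cc k)).re + |(w h k).re| ≤ s := by
  have b1 := (Complex.re_le_norm _).trans (hw _ (cc_unitary_add hh h1) _ (cc_unitary_add hk k1))
  have b2 := (Complex.re_le_norm _).trans (hw _ (cc_unitary_sub hh h1) _ (cc_unitary_sub hk k1))
  have b3 := (Complex.re_le_norm _).trans (hw _ (cc_unitary_add hh h1) _ (cc_unitary_sub hk k1))
  have b4 := (Complex.re_le_norm _).trans (hw _ (cc_unitary_sub hh h1) _ (cc_unitary_add hk k1))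
  simp only [map_add, map_sub, map_smul, LinearMap.add_apply, LinearMap.sub_apply,
    LinearMap.smul_apply, smul_eq_mul, Complex.add_re, Complex.sub_re, Complex.mul_re,
    Complex.I_re, Complex.I_im, Complex.mul_im, zero_mul, one_mul, zero_sub, zero_add,
    Complex.add_im, Complex.sub_im] at b1 b2 b3 b4
  rcases abs_cases (w h k).re with ⟨h', _⟩ | ⟨h', _⟩ <;> rw [h'] <;> linarith

lemma star_core {w : M →ₗ[ℂ] M' →ₗ[ℂ] ℂ} (hw : BUB w 1) {a : M} {b : M'}
    (ha : a ∈ unitary M) (hb : b ∈ unitary M')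
    (h11 : 1 - 1 / 10000 ≤ (w 1 1).re) (ha1 : 1 - 1 / 10000 ≤ (w a 1).re)
    (h1b : 1 - 1 / 10000 ≤ (w 1 b).re) (hab : (w a b).re ≤ - 1 + 1 / 10000) : False := by
  have ha' := norm_unitary_le ha
  have hb' := norm_unitary_le hb
  obtain ⟨p1, p2⟩ := half_est (hw.left (one_mem _)) ha' h11 ha1
  obtain ⟨q1, q2⟩ := half_est (hw.right (one_mem _)) hb' h11 h1b
  simp only [LinearMap.flip_apply] at p1 p2
  set x := hre a with hx
  set y := hre b with hy
  have hxn : ‖x‖ ≤ 1 := (hre_norm a).trans ha'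
  have hyn : ‖y‖ ≤ 1 := (hre_norm b).trans hb'
  have tn : ∀ {N : Type _} [CStarAlgebra N] (z : N), ‖z‖ ≤ 1 → ‖(1 / 16 : ℝ) • (1 - z)‖ ≤ 1 / 8 := by
    intro N _ z hz
    have : ‖(1 : N) - z‖ ≤ 2 := (norm_sub_le _ _).trans (by
      have : ‖(1 : N)‖ ≤ 1 := norm_unitary_le (one_mem _)
      linarith)
    rw [norm_smul]; norm_num; linarith
  have hc := (IsSelfAdjoint.all (1 / 16 : ℝ)).smul ((IsSelfAdjoint.one M).sub (hre_sa a))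
  have hc' := (IsSelfAdjoint.all (1 / 16 : ℝ)).smul ((IsSelfAdjoint.one M').sub (hre_sa b))
  rw [← hx] at hc
  rw [← hy] at hc'
  have tx := tn x hxn
  have ty : ‖(1 / 16 : ℝ) • (1 - y)‖ ≤ 1 / 8 := by
    have : ‖(1 : M') - y‖ ≤ 2 := (norm_sub_le _ _).trans (by
      have : ‖(1 : M')‖ ≤ 1 := norm_unitary_le (one_mem _)
      linarith)
    rw [norm_smul]; norm_num; linarith
  have par := hw.para hc hc' (by linarith) (by linarith)
  have ex := norm_one_sub_cc hc (by linarith)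
  have ey := norm_one_sub_cc hc' (by linarith)
  set c := cc ((1 / 16 : ℝ) • (1 - x)) with hcdef
  set c' := cc ((1 / 16 : ℝ) • (1 - y)) with hcdef'
  have ex' : ‖1 - c‖ ≤ (1 / 8) ^ 2 := ex.trans (by gcongr)
  have ey' : ‖1 - c'‖ ≤ (1 / 8) ^ 2 := ey.trans (by gcongr)
  have ee := hw.sa ((IsSelfAdjoint.one M).sub (cc_sa ((1 / 16 : ℝ) • (1 - x))))
    ((IsSelfAdjoint.one M').sub (cc_sa ((1 / 16 : ℝ) • (1 - y))))
  rw [← hcdef, ← hcdef'] at ee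
  have ee2 : ‖w (1 - c) (1 - c')‖ ≤ (1 / 8) ^ 2 * (1 / 8) ^ 2 :=
    ee.trans (by rw [one_mul]; gcongr)
  have ee3 := (abs_le.1 ((Complex.abs_re_le_norm _).trans ee2)).1
  have e1 : (w c c').re = (w 1 1).re - (w (1 - c) 1).re - (w 1 (1 - c')).re
      + (w (1 - c) (1 - c')).re := by
    simp only [map_sub, LinearMap.sub_apply, Complex.sub_re]; ring
  have e2 : (w x y).re = (w 1 1).re - (w (1 - x) 1).re - (w 1 (1 - y)).re
      + (w (1 - x) (1 - y)).re := by
    simp only [map_sub, LinearMap.sub_apply, Complex.sub_re]; ring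
  have e3 : (w ((1 / 16 : ℝ) • (1 - x)) ((1 / 16 : ℝ) • (1 - y))).re =
      1 / 256 * (w (1 - x) (1 - y)).re := by
    rw [← Complex.coe_smul, ← Complex.coe_smul, map_smul, map_smul, LinearMap.smul_apply,
      smul_eq_mul, smul_eq_mul, Complex.re_ofReal_mul, Complex.re_ofReal_mul]; ring
  rw [e3, abs_mul, abs_of_pos (by norm_num : (0 : ℝ) < 1 / 256)] at par
  have e4 := neg_abs_le (w (1 - x) (1 - y)).re
  have e5 : (w x y).re = 1 / 4 * ((w a b).re + (w a (star b)).re + (w (star a) b).re +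
      (w (star a) (star b)).re) := by
    rw [hx, hy, hre, hre]
    have : (1 / 2 : ℂ) = ((1 / 2 : ℝ) : ℂ) := by norm_num
    rw [this]
    simp only [map_smul, map_add, LinearMap.smul_apply, LinearMap.add_apply, smul_eq_mul,
      Complex.re_ofReal_mul, Complex.add_re]
    ring
  have sa : star a ∈ unitary M := Unitary.star_mem ha
  have sb : star b ∈ unitary M' := Unitary.star_mem hb
  have f1 := (Complex.re_le_norm _).trans (hw _ ha _ sb)
  have f2 := (Complex.re_le_norm _).trans (hw _ sa _ hb)
  have f3 := (Complex.re_le_norm _).trans (hw _ sa _ sb)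
  norm_num at *
  linarith

lemma exists_phase (z : ℂ) : ∃ c : ℂ, ‖c‖ = 1 ∧ c * z = ‖z‖ := by
  rcases eq_or_ne z 0 with rfl | h
  · exact ⟨1, by simp⟩
  · refine ⟨(starRingEnd ℂ z) / ‖z‖, ?_, ?_⟩
    · simp [h]
    · have : (‖z‖ : ℂ) ≠ 0 := by simpa using h
      field_simp
      rw [mul_comm, Complex.mul_conj, Complex.normSq_eq_norm_sq]; norm_cast

theorem star_claim {w : M →ₗ[ℂ] M' →ₗ[ℂ] ℂ} (hw : BUB w 1) {a₁ a₂ : M} {b₁ b₂ : M'}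
    (ha₁ : a₁ ∈ unitary M) (ha₂ : a₂ ∈ unitary M)
    (hb₁ : b₁ ∈ unitary M') (hb₂ : b₂ ∈ unitary M') :
    ‖w a₁ b₁ + w a₁ b₂ + w a₂ b₁ - w a₂ b₂‖ ≤ 4 - 1 / 10000 := by
  by_contra hcon
  push Not at hcon
  obtain ⟨c, hc, hcz⟩ := exists_phase (w a₁ b₁ + w a₁ b₂ + w a₂ b₁ - w a₂ b₂)
  let v : M →ₗ[ℂ] M' →ₗ[ℂ] ℂ :=
    (c • w).compl₁₂ (LinearMap.mulRight ℂ a₁) (LinearMap.mulRight ℂ b₁)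
  have hv : ∀ x y, v x y = c * w (x * a₁) (y * b₁) := fun x y => by simp [v]
  have hvb : BUB v 1 := by
    intro U hU V hV
    rw [hv, norm_mul, hc, one_mul]
    exact hw _ (mul_mem hU ha₁) _ (mul_mem hV hb₁)
  have sa : star a₁ * a₁ = 1 := Unitary.star_mul_self_of_mem ha₁
  have sb : star b₁ * b₁ = 1 := Unitary.star_mul_self_of_mem hb₁
  have ha : a₂ * star a₁ ∈ unitary M := mul_mem ha₂ (Unitary.star_mem ha₁)
  have hb : b₂ * star b₁ ∈ unitary M' := mul_mem hb₂ (Unitary.star_mem hb₁)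
  have e11 : v 1 1 = c * w a₁ b₁ := by rw [hv]; simp
  have e21 : v (a₂ * star a₁) 1 = c * w a₂ b₁ := by rw [hv]; simp [mul_assoc, sa]
  have e12 : v 1 (b₂ * star b₁) = c * w a₁ b₂ := by rw [hv]; simp [mul_assoc, sb]
  have e22 : v (a₂ * star a₁) (b₂ * star b₁) = c * w a₂ b₂ := by
    rw [hv]; simp [mul_assoc, sa, sb]
  have b11 := (Complex.re_le_norm _).trans (hvb _ (one_mem _) _ (one_mem _))
  have b21 := (Complex.re_le_norm _).trans (hvb _ ha _ (one_mem _))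
  have b12 := (Complex.re_le_norm _).trans (hvb _ (one_mem _) _ hb)
  have b22 := (Complex.abs_re_le_norm _).trans (hvb _ ha _ hb)
  have b22' := (abs_le.1 b22).1
  have tot : (v 1 1).re + (v 1 (b₂ * star b₁)).re + (v (a₂ * star a₁) 1).re
      - (v (a₂ * star a₁) (b₂ * star b₁)).re > 4 - 1 / 10000 := by
    rw [e11, e12, e21, e22, ← Complex.add_re, ← Complex.add_re, ← Complex.sub_re]
    rw [← mul_add, ← mul_add, ← mul_sub, hcz, Complex.ofReal_re]
    exact hcon
  exact star_core hvb ha hb (by linarith) (by linarith) (by linarith) (by linarith)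

end unital
end GT

namespace GT
open Filter Topology

lemma ulim_exists {I V : Type*} [AddCommGroup V] [Module ℂ V] (l : Ultrafilter I)
    (φ : I → V →ₗ[ℂ] ℂ) (h : ∀ x, ∃ C : ℝ, ∀ i, ‖φ i x‖ ≤ C) :
    ∃ ψ : V →ₗ[ℂ] ℂ, ∀ x, Tendsto (fun i => φ i x) l (𝓝 (ψ x)) := by
  have key : ∀ x, ∃ z : ℂ, Tendsto (fun i => φ i x) l (𝓝 z) := by
    intro x
    obtain ⟨C, hC⟩ := h x
    have hc : IsCompact (Metric.closedBall (0 : ℂ) C) := isCompact_closedBall _ _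
    have := hc.ultrafilter_le_nhds (l.map (fun i => φ i x)) (by
      simp only [le_principal_iff]
      exact Filter.mem_map.2 (Filter.univ_mem' (fun i => by simpa using hC i)))
    obtain ⟨z, _, hz⟩ := this
    exact ⟨z, hz⟩
  choose ψ hψ using key
  refine ⟨⟨⟨ψ, ?_⟩, ?_⟩, hψ⟩
  · intro x y
    refine tendsto_nhds_unique (hψ (x + y)) ?_
    simpa using (hψ x).add (hψ y)
  · intro c x
    refine tendsto_nhds_unique (hψ (c • x)) ?_
    simpa using (hψ x).const_mul c

lemma ulim_exists₂ {I V W : Type*} [AddCommGroup V] [Module ℂ V] [AddCommGroup W] [Module ℂ W]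
    (l : Ultrafilter I) (φ : I → V →ₗ[ℂ] W →ₗ[ℂ] ℂ) (h : ∀ x y, ∃ C : ℝ, ∀ i, ‖φ i x y‖ ≤ C) :
    ∃ ψ : V →ₗ[ℂ] W →ₗ[ℂ] ℂ, ∀ x y, Tendsto (fun i => φ i x y) l (𝓝 (ψ x y)) := by
  obtain ⟨ψ, hψ⟩ := ulim_exists l (fun i => TensorProduct.lift (φ i)) (by
    intro x
    induction x with
    | zero => exact ⟨0, by simp⟩
    | tmul x y => simpa using h x y
    | add x y hx hy =>
      obtain ⟨C, hC⟩ := hx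
      obtain ⟨D, hD⟩ := hy
      exact ⟨C + D, fun i => by rw [map_add]; exact norm_add_le_of_le (hC i) (hD i)⟩)
  refine ⟨TensorProduct.curry ψ, fun x y => ?_⟩
  simpa using hψ (x ⊗ₜ y)

lemma tendsto_norm_le {I : Type*} {l : Filter I} [l.NeBot] {f : I → ℂ} {z : ℂ} {C : ℝ}
    (h : Tendsto f l (𝓝 z)) (hC : ∀ i, ‖f i‖ ≤ C) : ‖z‖ ≤ C :=
  le_of_tendsto h.norm (Eventually.of_forall hC)

section unital
variable {M M' : Type*} [CStarAlgebra M] [CStarAlgebra M']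

/-- twisted conjugate form -/
def tw (w : M →ₗ[ℂ] M' →ₗ[ℂ] ℂ) (U : M) (V : M') : M →ₗ[ℂ] M' →ₗ[ℂ] ℂ :=
  LinearMap.mk₂ ℂ (fun X Y => star (w (U * star X * U) (V * star Y * V)))
    (by intros; simp [mul_add, add_mul]) (by intros; simp)
    (by intros; simp [mul_add, add_mul]) (by intros; simp)

lemma tw_apply (w : M →ₗ[ℂ] M' →ₗ[ℂ] ℂ) (U : M) (V : M') (X : M) (Y : M') :
    tw w U V X Y = star (w (U * star X * U) (V * star Y * V)) := rfl

lemma stepA {w : M →ₗ[ℂ] M' →ₗ[ℂ] ℂ} {S δ : ℝ} (hw : BUB w S) {U : M} {V : M'}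
    (hU : U ∈ unitary M) (hV : V ∈ unitary M') (hδ : S - δ ≤ (w U V).re)
    {H : M} {K : M'} (hH : IsSelfAdjoint H) (hK : IsSelfAdjoint K) (hH1 : ‖H‖ ≤ 1) (hK1 : ‖K‖ ≤ 1)
    {t : ℝ} (ht : 0 < t) (ht1 : t ≤ 1) :
    t ^ 2 * |(w (H * U) (K * V)).re| ≤
      δ + t ^ 2 / 2 * (w (H * H * U) V + w U (K * K * V)).re + 3 * S * t ^ 4 := by
  let v : M →ₗ[ℂ] M' →ₗ[ℂ] ℂ :=
    w.compl₁₂ (LinearMap.mulRight ℂ U) (LinearMap.mulRight ℂ V)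
  have hv : ∀ x y, v x y = w (x * U) (y * V) := fun x y => by simp [v]
  have hvb : BUB v S := fun U' hU' V' hV' => hw _ (mul_mem hU' hU) _ (mul_mem hV' hV)
  have hS := hw.nonneg
  have tH : IsSelfAdjoint (t • H) := (IsSelfAdjoint.all _).smul hH
  have tK : IsSelfAdjoint (t • K) := (IsSelfAdjoint.all _).smul hK
  have tHn : ‖t • H‖ ≤ t := by rw [norm_smul, Real.norm_of_nonneg ht.le]; nlinarith
  have tKn : ‖t • K‖ ≤ t := by rw [norm_smul, Real.norm_of_nonneg ht.le]; nlinarith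
  have par := hvb.para tH tK (tHn.trans ht1) (tKn.trans ht1)
  have n1 := (norm_one_sub_cc tH (tHn.trans ht1)).trans (pow_le_pow_left₀ (norm_nonneg _) tHn 2)
  have n2 := (norm_one_sub_cc tK (tKn.trans ht1)).trans (pow_le_pow_left₀ (norm_nonneg _) tKn 2)
  have n3 := (norm_one_sub_cc' tH (tHn.trans ht1)).trans (pow_le_pow_left₀ (norm_nonneg _) tHn 4)
  have n4 := (norm_one_sub_cc' tK (tKn.trans ht1)).trans (pow_le_pow_left₀ (norm_nonneg _) tKn 4)
  set c := cc (t • H) with hc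
  set d := cc (t • K) with hd
  have csa : IsSelfAdjoint c := cc_sa _
  have dsa : IsSelfAdjoint d := cc_sa _
  have hsq : ∀ {N : Type _} [CStarAlgebra N] (h : N), IsSelfAdjoint h →
      IsSelfAdjoint ((1 / 2 : ℂ) • (h * h)) := by
    intro N _ h hh
    rw [isSelfAdjoint_iff, star_smul, star_mul, hh.star_eq]; simp
  have R1 : IsSelfAdjoint (1 - c - (1 / 2 : ℂ) • ((t • H) * (t • H))) :=
    ((IsSelfAdjoint.one M).sub csa).sub (hsq _ tH)
  have hK2 : IsSelfAdjoint ((1 / 2 : ℂ) • ((t • K) * (t • K))) := by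
    rw [isSelfAdjoint_iff, star_smul, star_mul, tK.star_eq]; simp
  have R2 : IsSelfAdjoint (1 - d - (1 / 2 : ℂ) • ((t • K) * (t • K))) :=
    ((IsSelfAdjoint.one M').sub dsa).sub hK2
  have b1 := (hvb.left (one_mem _)).sa' R1
  have b2 := (hvb.right (one_mem _)).sa' R2
  have b3 := hvb.sa ((IsSelfAdjoint.one M).sub csa) ((IsSelfAdjoint.one M').sub dsa)
  have b1' := (Complex.re_le_norm _).trans (b1.trans (mul_le_mul_of_nonneg_left n3 hS))
  have b2' := (Complex.re_le_norm _).trans (b2.trans (mul_le_mul_of_nonneg_left n4 hS))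
  have b3' : ‖v (1 - c) (1 - d)‖ ≤ S * t ^ 4 := b3.trans (by
    calc _ ≤ S * t ^ 2 * t ^ 2 := by gcongr
      _ = _ := by ring)
  have b3'' := (abs_le.1 ((Complex.abs_re_le_norm _).trans b3')).1
  have e1 : (v c d).re = (v 1 1).re - (v (1 - c) 1).re - (v 1 (1 - d)).re
      + (v (1 - c) (1 - d)).re := by
    simp only [map_sub, LinearMap.sub_apply, Complex.sub_re]; ring
  have half : (1 / 2 : ℂ) = ((1 / 2 : ℝ) : ℂ) := by norm_num
  have e2 : (v (1 - c - (1 / 2 : ℂ) • ((t • H) * (t • H))) 1).re =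
      (v (1 - c) 1).re - t ^ 2 / 2 * (w (H * H * U) V).re := by
    have : (1 / 2 : ℂ) • ((t • H) * (t • H)) = ((t ^ 2 / 2 : ℝ) : ℂ) • (H * H) := by
      rw [smul_mul_smul_comm, ← Complex.coe_smul, smul_smul]; congr 1; push_cast; ring
    rw [this, map_sub, LinearMap.sub_apply, Complex.sub_re, map_smul, LinearMap.smul_apply,
      smul_eq_mul, Complex.re_ofReal_mul, hv (H * H) 1, one_mul]
  have e3 : (v 1 (1 - d - (1 / 2 : ℂ) • ((t • K) * (t • K)))).re =
      (v 1 (1 - d)).re - t ^ 2 / 2 * (w U (K * K * V)).re := by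
    have : (1 / 2 : ℂ) • ((t • K) * (t • K)) = ((t ^ 2 / 2 : ℝ) : ℂ) • (K * K) := by
      rw [smul_mul_smul_comm, ← Complex.coe_smul, smul_smul]; congr 1; push_cast; ring
    rw [this, map_sub, Complex.sub_re, map_smul,
      smul_eq_mul, Complex.re_ofReal_mul, hv 1 (K * K), one_mul]
  have e4 : (v (t • H) (t • K)).re = t ^ 2 * (w (H * U) (K * V)).re := by
    rw [← Complex.coe_smul, ← Complex.coe_smul, map_smul, map_smul, LinearMap.smul_apply,
      smul_eq_mul, smul_eq_mul, Complex.re_ofReal_mul, Complex.re_ofReal_mul, hv]; ring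
  rw [e4, abs_mul, abs_of_pos (by positivity : 0 < t ^ 2)] at par
  have e5 : v 1 1 = w U V := by rw [hv, one_mul, one_mul]
  rw [LinearMap.flip_apply] at b1'
  rw [e2] at b1'
  rw [e3] at b2'
  rw [e1, e5] at par
  rw [Complex.add_re]
  nlinarith

lemma hre_sq_add (Z : M) : hre Z * hre Z + him Z * him Z =
    (1 / 2 : ℂ) • (Z * star Z + star Z * Z) := by
  simp only [hre, him, smul_mul_smul_comm, mul_add, add_mul, mul_sub, sub_mul, smul_add, smul_sub]
  match_scalars <;> ring_nf <;> simp <;> norm_num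

lemma stepB {w : M →ₗ[ℂ] M' →ₗ[ℂ] ℂ} {S δ : ℝ} (hw : BUB w S) {U : M} {V : M'}
    (hU : U ∈ unitary M) (hV : V ∈ unitary M') (hδ : S - δ ≤ (w U V).re)
    {X : M} {Y : M'} (hX1 : ‖X‖ ≤ 1) (hY1 : ‖Y‖ ≤ 1)
    {t : ℝ} (ht : 0 < t) (ht1 : t ≤ 1) :
    t ^ 2 / 2 * (w X Y + tw w U V X Y).re ≤
      2 * δ + t ^ 2 / 4 * (w (X * star X * U) V + w (U * (star X * X)) V +
        (w U (Y * star Y * V) + w U (V * (star Y * Y)))).re + 6 * S * t ^ 4 := by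
  have nX : ‖X * star U‖ ≤ 1 := by
    refine (norm_mul_le _ _).trans ?_
    have : ‖star U‖ ≤ 1 := norm_unitary_le (Unitary.star_mem hU)
    exact mul_le_one₀ hX1 (norm_nonneg _) this
  have nY : ‖Y * star V‖ ≤ 1 := by
    refine (norm_mul_le _ _).trans ?_
    have : ‖star V‖ ≤ 1 := norm_unitary_le (Unitary.star_mem hV)
    exact mul_le_one₀ hY1 (norm_nonneg _) this
  have A1 := stepA hw hU hV hδ (hre_sa (X * star U)) (hre_sa (Y * star V))
    ((hre_norm _).trans nX) ((hre_norm _).trans nY) ht ht1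
  have A2 := stepA hw hU hV hδ (him_sa (X * star U)) (him_sa (Y * star V))
    ((him_norm _).trans nX) ((him_norm _).trans nY) ht ht1
  have su : star U * U = 1 := Unitary.star_mul_self_of_mem hU
  have sv : star V * V = 1 := Unitary.star_mul_self_of_mem hV
  have eX : hre (X * star U) * U = (1 / 2 : ℂ) • (X + U * star X * U) := by
    simp [hre, add_mul, mul_assoc, su]
  have eX' : him (X * star U) * U = (-Complex.I / 2 : ℂ) • (X - U * star X * U) := by
    simp [him, sub_mul, mul_assoc, su]
  have eY : hre (Y * star V) * V = (1 / 2 : ℂ) • (Y + V * star Y * V) := by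
    simp [hre, add_mul, mul_assoc, sv]
  have eY' : him (Y * star V) * V = (-Complex.I / 2 : ℂ) • (Y - V * star Y * V) := by
    simp [him, sub_mul, mul_assoc, sv]
  have sX : (hre (X * star U) * hre (X * star U) * U + him (X * star U) * him (X * star U) * U) =
      (1 / 2 : ℂ) • (X * star X * U + U * (star X * X)) := by
    rw [← add_mul, hre_sq_add]
    simp only [star_mul, star_star, smul_mul_assoc, add_mul]
    congr 2
    · simp only [mul_assoc]; rw [← mul_assoc (star U) U, su, one_mul]
    · simp only [mul_assoc]; rw [su, mul_one]
  have sY : (hre (Y * star V) * hre (Y * star V) * V + him (Y * star V) * him (Y * star V) * V) =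
      (1 / 2 : ℂ) • (Y * star Y * V + V * (star Y * Y)) := by
    rw [← add_mul, hre_sq_add]
    simp only [star_mul, star_star, smul_mul_assoc, add_mul]
    congr 2
    · simp only [mul_assoc]; rw [← mul_assoc (star V) V, sv, one_mul]
    · simp only [mul_assoc]; rw [sv, mul_one]
  have half : (1 / 2 : ℂ) = ((1 / 2 : ℝ) : ℂ) := by norm_num
  have T1 : (w (hre (X * star U) * hre (X * star U) * U) V).re +
      (w (him (X * star U) * him (X * star U) * U) V).re =
      1 / 2 * ((w (X * star X * U) V).re + (w (U * (star X * X)) V).re) := by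
    rw [← Complex.add_re, ← LinearMap.add_apply, ← map_add, sX, map_smul, half,
      LinearMap.smul_apply, smul_eq_mul, Complex.re_ofReal_mul, map_add, LinearMap.add_apply,
      Complex.add_re]
  have T2 : (w U (hre (Y * star V) * hre (Y * star V) * V)).re +
      (w U (him (Y * star V) * him (Y * star V) * V)).re =
      1 / 2 * ((w U (Y * star Y * V)).re + (w U (V * (star Y * Y))).re) := by
    rw [← Complex.add_re, ← map_add, sY, map_smul, half,
      smul_eq_mul, Complex.re_ofReal_mul, map_add, Complex.add_re]
  have T3 : w (hre (X * star U) * U) (hre (Y * star V) * V) -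
      w (him (X * star U) * U) (him (Y * star V) * V) =
      ((1 / 2 : ℝ) : ℂ) * (w X Y + w (U * star X * U) (V * star Y * V)) := by
    rw [eX, eX', eY, eY']
    simp only [map_smul, map_add, map_sub, LinearMap.smul_apply, LinearMap.add_apply,
      LinearMap.sub_apply, smul_eq_mul]
    push_cast
    ring_nf
    simp only [Complex.I_sq]
    ring
  have T4 := congrArg Complex.re T3
  rw [Complex.re_ofReal_mul, Complex.sub_re, Complex.add_re] at T4
  have T5 : (tw w U V X Y).re = (w (U * star X * U) (V * star Y * V)).re := by
    rw [tw_apply]; simp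
  have a1 := le_abs_self (w (hre (X * star U) * U) (hre (Y * star V) * V)).re
  have a2 := neg_abs_le (w (him (X * star U) * U) (him (Y * star V) * V)).re
  simp only [Complex.add_re] at *
  rw [T5]
  have ht2 : 0 < t ^ 2 := by positivity
  have a3 : t ^ 2 * ((w (hre (X * star U) * U) (hre (Y * star V) * V)).re -
    (w (him (X * star U) * U) (him (Y * star V) * V)).re) ≤
    t ^ 2 * (|(w (hre (X * star U) * U) (hre (Y * star V) * V)).re| +
    |(w (him (X * star U) * U) (him (Y * star V) * V)).re|) := by
    apply mul_le_mul_of_nonneg_left _ ht2.le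
    linarith
  rw [T4] at a3
  linear_combination a3 + A1 + A2 + t ^ 2 / 2 * T1 + t ^ 2 / 2 * T2

end unital
end GT

namespace GT
open Filter Topology

section unital
variable {M M' : Type*} [CStarAlgebra M] [CStarAlgebra M']

theorem herm {w : M →ₗ[ℂ] M' →ₗ[ℂ] ℂ} {S : ℝ} (hw : BUB w S) {U : ℕ → M} {V : ℕ → M'}
    (hU : ∀ n, U n ∈ unitary M) (hV : ∀ n, V n ∈ unitary M') (l : Ultrafilter ℕ)
    (hUV : Tendsto (fun n => w (U n) (V n)) l (𝓝 (S : ℂ))) :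
    ∃ (f₁ f₂ : M →ₗ[ℂ] ℂ) (g₁ g₂ : M' →ₗ[ℂ] ℂ) (q : M →ₗ[ℂ] M' →ₗ[ℂ] ℂ),
      (∀ X, Tendsto (fun n => w (X * U n) (V n)) l (𝓝 (f₁ X))) ∧
      (∀ X, Tendsto (fun n => w (U n * X) (V n)) l (𝓝 (f₂ X))) ∧
      (∀ Y, Tendsto (fun n => w (U n) (Y * V n)) l (𝓝 (g₁ Y))) ∧
      (∀ Y, Tendsto (fun n => w (U n) (V n * Y)) l (𝓝 (g₂ Y))) ∧
      (∀ X Y, Tendsto (fun n => tw w (U n) (V n) X Y) l (𝓝 (q X Y))) ∧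
      (∀ X Y, ‖(1 / 2 : ℂ) * (w X Y + q X Y)‖ ≤
        1 / 4 * ((f₁ (X * star X)).re + (f₂ (star X * X)).re +
          ((g₁ (Y * star Y)).re + (g₂ (star Y * Y)).re))) := by
  have hS := hw.nonneg
  have nU : ∀ n, ‖U n‖ ≤ 1 := fun n => norm_unitary_le (hU n)
  have nV : ∀ n, ‖V n‖ ≤ 1 := fun n => norm_unitary_le (hV n)
  obtain ⟨f₁, hf₁⟩ := ulim_exists l (fun n => (w.flip (V n)).comp (LinearMap.mulRight ℂ (U n)))
    (fun X => ⟨4 * S * ‖X‖, fun n => by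
      refine (hw.gen _ _).trans ?_
      have : ‖X * U n‖ ≤ ‖X‖ * 1 := (norm_mul_le _ _).trans (by gcongr; exact nU n)
      calc 4 * S * ‖X * U n‖ * ‖V n‖ ≤ 4 * S * (‖X‖ * 1) * 1 := by gcongr; exact nV n
        _ = _ := by ring⟩)
  obtain ⟨f₂, hf₂⟩ := ulim_exists l (fun n => (w.flip (V n)).comp (LinearMap.mulLeft ℂ (U n)))
    (fun X => ⟨4 * S * ‖X‖, fun n => by
      refine (hw.gen _ _).trans ?_
      have : ‖U n * X‖ ≤ 1 * ‖X‖ := (norm_mul_le _ _).trans (by gcongr; exact nU n)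
      calc 4 * S * ‖U n * X‖ * ‖V n‖ ≤ 4 * S * (1 * ‖X‖) * 1 := by gcongr; exact nV n
        _ = _ := by ring⟩)
  obtain ⟨g₁, hg₁⟩ := ulim_exists l (fun n => (w (U n)).comp (LinearMap.mulRight ℂ (V n)))
    (fun X => ⟨4 * S * ‖X‖, fun n => by
      refine (hw.gen _ _).trans ?_
      have : ‖X * V n‖ ≤ ‖X‖ * 1 := (norm_mul_le _ _).trans (by gcongr; exact nV n)
      calc 4 * S * ‖U n‖ * ‖X * V n‖ ≤ 4 * S * 1 * (‖X‖ * 1) := by gcongr; exact nU n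
        _ = _ := by ring⟩)
  obtain ⟨g₂, hg₂⟩ := ulim_exists l (fun n => (w (U n)).comp (LinearMap.mulLeft ℂ (V n)))
    (fun X => ⟨4 * S * ‖X‖, fun n => by
      refine (hw.gen _ _).trans ?_
      have : ‖V n * X‖ ≤ 1 * ‖X‖ := (norm_mul_le _ _).trans (by gcongr; exact nV n)
      calc 4 * S * ‖U n‖ * ‖V n * X‖ ≤ 4 * S * 1 * (1 * ‖X‖) := by gcongr; exact nU n
        _ = _ := by ring⟩)
  obtain ⟨q, hq⟩ := ulim_exists₂ l (fun n => tw w (U n) (V n)) (fun X Y => ⟨4 * S * ‖X‖ * ‖Y‖,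
    fun n => by
      rw [tw_apply, norm_star]
      refine (hw.gen _ _).trans ?_
      have h1 : ‖U n * star X * U n‖ ≤ 1 * ‖X‖ * 1 := by
        refine (norm_mul_le _ _).trans ?_
        gcongr
        · refine (norm_mul_le _ _).trans ?_
          rw [norm_star]; gcongr; exact nU n
        · exact nU n
      have h2 : ‖V n * star Y * V n‖ ≤ 1 * ‖Y‖ * 1 := by
        refine (norm_mul_le _ _).trans ?_
        gcongr
        · refine (norm_mul_le _ _).trans ?_
          rw [norm_star]; gcongr; exact nV n
        · exact nV n
      calc _ ≤ 4 * S * (1 * ‖X‖ * 1) * (1 * ‖Y‖ * 1) := by gcongr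
        _ = _ := by ring⟩)
  simp only [LinearMap.comp_apply, LinearMap.flip_apply, LinearMap.mulRight_apply,
    LinearMap.mulLeft_apply] at hf₁ hf₂ hg₁ hg₂
  refine ⟨f₁, f₂, g₁, g₂, q, hf₁, hf₂, hg₁, hg₂, hq, ?_⟩
  have hre : ∀ {f : ℕ → ℂ} {z : ℂ}, Tendsto f l (𝓝 z) → Tendsto (fun n => (f n).re) l (𝓝 z.re) :=
    fun h => (Complex.continuous_re.tendsto _).comp h
  -- limit inequality
  have L1 : ∀ X Y, ‖X‖ ≤ 1 → ‖Y‖ ≤ 1 → ∀ t : ℝ, 0 < t → t ≤ 1 →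
      t ^ 2 / 2 * (w X Y + q X Y).re ≤ t ^ 2 / 4 * (f₁ (X * star X) + f₂ (star X * X) +
        (g₁ (Y * star Y) + g₂ (star Y * Y))).re + 6 * S * t ^ 4 := by
    intro X Y hX hY t ht ht1
    have lim1 : Tendsto (fun n => t ^ 2 / 2 * (w X Y + tw w (U n) (V n) X Y).re) l
        (𝓝 (t ^ 2 / 2 * (w X Y + q X Y).re)) :=
      (hre ((tendsto_const_nhds).add (hq X Y))).const_mul _
    have lim2 : Tendsto (fun n => 2 * (S - (w (U n) (V n)).re) + t ^ 2 / 4 *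
        (w (X * star X * U n) (V n) + w (U n * (star X * X)) (V n) +
        (w (U n) (Y * star Y * V n) + w (U n) (V n * (star Y * Y)))).re + 6 * S * t ^ 4) l
        (𝓝 (2 * (S - (S : ℂ).re) + t ^ 2 / 4 * (f₁ (X * star X) + f₂ (star X * X) +
        (g₁ (Y * star Y) + g₂ (star Y * Y))).re + 6 * S * t ^ 4)) := by
      refine Tendsto.add_const _ (Tendsto.add ?_ ?_)
      · exact ((hre hUV).const_sub _).const_mul _
      · exact (hre (((hf₁ _).add (hf₂ _)).add ((hg₁ _).add (hg₂ _)))).const_mul _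
    have := le_of_tendsto_of_tendsto' lim1 lim2 (fun n =>
      stepB hw (hU n) (hV n) (by linarith) hX hY ht ht1)
    simpa using this
  have L2 : ∀ X Y, ‖X‖ ≤ 1 → ‖Y‖ ≤ 1 →
      1 / 2 * (w X Y + q X Y).re ≤ 1 / 4 * (f₁ (X * star X) + f₂ (star X * X) +
        (g₁ (Y * star Y) + g₂ (star Y * Y))).re := by
    intro X Y hX hY
    have h1 : ∀ t : ℝ, 0 < t → t ≤ 1 → 1 / 2 * (w X Y + q X Y).re ≤
        1 / 4 * (f₁ (X * star X) + f₂ (star X * X) +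
        (g₁ (Y * star Y) + g₂ (star Y * Y))).re + 6 * S * t := by
      intro t ht ht1
      have := L1 X Y hX hY t ht ht1
      have ht2 : 0 < t ^ 2 := by positivity
      have h3 : t ^ 2 * (1 / 2 * (w X Y + q X Y).re) ≤ t ^ 2 * (1 / 4 * (f₁ (X * star X) +
        f₂ (star X * X) + (g₁ (Y * star Y) + g₂ (star Y * Y))).re + 6 * S * t ^ 2) := by
        linarith
      have h4 := le_of_mul_le_mul_left h3 ht2
      have : t ^ 2 ≤ t := by nlinarith
      have : 6 * S * t ^ 2 ≤ 6 * S * t := by gcongr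
      linarith
    apply le_of_forall_pos_le_add
    intro ε hε
    have h2 := h1 (min 1 (ε / (6 * S + 1))) (by positivity) (min_le_left _ _)
    have h3 : 6 * S * min 1 (ε / (6 * S + 1)) ≤ ε := by
      calc _ ≤ (6 * S + 1) * (ε / (6 * S + 1)) := by
            gcongr
            · linarith
            · exact min_le_right _ _
        _ = ε := by field_simp
    linarith
  have L3 : ∀ X Y, 1 / 2 * (w X Y + q X Y).re ≤ 1 / 4 * (f₁ (X * star X) + f₂ (star X * X) +
        (g₁ (Y * star Y) + g₂ (star Y * Y))).re := by
    intro X Y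
    set r : ℝ := (1 + ‖X‖ + ‖Y‖)⁻¹ with hr
    have hr0 : 0 < r := by positivity
    have := L2 ((r : ℂ) • X) ((r : ℂ) • Y)
      (by rw [norm_smul, Complex.norm_real, Real.norm_of_nonneg hr0.le, hr, inv_mul_le_one₀ (by positivity)]
          linarith [norm_nonneg Y])
      (by rw [norm_smul, Complex.norm_real, Real.norm_of_nonneg hr0.le, hr, inv_mul_le_one₀ (by positivity)]
          linarith [norm_nonneg X])
    simp only [star_smul, smul_mul_smul_comm, map_smul, LinearMap.smul_apply, smul_eq_mul,
      Complex.star_def, Complex.conj_ofReal] at this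
    have h1 : (r : ℂ) * ((r : ℂ) * w X Y) + (r : ℂ) * ((r : ℂ) * q X Y) =
        ((r * r : ℝ) : ℂ) * (w X Y + q X Y) := by push_cast; ring
    have h2 : (r : ℂ) * r * f₁ (X * star X) + (r : ℂ) * r * f₂ (star X * X) +
        ((r : ℂ) * r * g₁ (Y * star Y) + (r : ℂ) * r * g₂ (star Y * Y)) =
        ((r * r : ℝ) : ℂ) * (f₁ (X * star X) + f₂ (star X * X) +
        (g₁ (Y * star Y) + g₂ (star Y * Y))) := by push_cast; ring
    rw [h1, h2, Complex.re_ofReal_mul, Complex.re_ofReal_mul] at this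
    have hrr : 0 < r * r := by positivity
    refine le_of_mul_le_mul_left (a := r * r) ?_ hrr
    linarith
  intro X Y
  obtain ⟨c, hc, hcz⟩ := exists_phase (w X Y + q X Y)
  have := L3 (c • X) Y
  have hcc : c * (starRingEnd ℂ) c = 1 := by
    rw [Complex.mul_conj, Complex.normSq_eq_norm_sq, hc]; simp
  have hcc' : (starRingEnd ℂ) c * c = 1 := by rw [mul_comm, hcc]
  simp only [star_smul, smul_mul_smul_comm, map_smul, LinearMap.smul_apply, smul_eq_mul,
      Complex.star_def, hcc, hcc', one_mul] at this
  rw [← mul_add, hcz, Complex.ofReal_re] at this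
  rw [norm_mul]
  simp only [Complex.add_re] at this
  norm_num at *
  linarith

end unital
end GT

namespace GT
open Filter Topology

/-- star-closed two-sided ideals (as subspaces) -/
structure IsSI {M : Type*} [NonUnitalRing M] [StarRing M] [Module ℂ M] (J : Submodule ℂ M) :
    Prop where
  mul_left : ∀ m, ∀ x ∈ J, m * x ∈ J
  mul_right : ∀ m, ∀ x ∈ J, x * m ∈ J
  star : ∀ x ∈ J, star x ∈ J

lemma PosF.smul {M : Type*} [NonUnitalRing M] [StarRing M] [Module ℂ M] {f : M →ₗ[ℂ] ℂ}
    (hf : PosF f) {r : ℝ} (hr : 0 ≤ r) : PosF ((r : ℂ) • f) := by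
  intro x
  have := hf x
  rw [LinearMap.smul_apply, smul_eq_mul, Complex.re_ofReal_mul, Complex.im_ofReal_mul]
  exact ⟨mul_nonneg hr this.1, by rw [this.2, mul_zero]⟩

lemma PosF.add {M : Type*} [NonUnitalRing M] [StarRing M] [Module ℂ M] {f g : M →ₗ[ℂ] ℂ}
    (hf : PosF f) (hg : PosF g) : PosF (f + g) := by
  intro x
  have := hf x
  have := hg x
  simp only [LinearMap.add_apply, Complex.add_re, Complex.add_im]
  constructor <;> linarith

section unital
variable {M M' : Type*} [CStarAlgebra M] [CStarAlgebra M']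

lemma exists_opt {w : M →ₗ[ℂ] M' →ₗ[ℂ] ℂ} {s : ℝ} (hw : BUB w s) :
    ∃ S : ℝ, S ≤ s ∧ BUB w S ∧ ∃ (U : ℕ → M) (V : ℕ → M'), (∀ n, U n ∈ unitary M) ∧
      (∀ n, V n ∈ unitary M') ∧ Tendsto (fun n => w (U n) (V n)) atTop (𝓝 (S : ℂ)) := by
  let T : Set ℝ := {r | ∃ U ∈ unitary M, ∃ V ∈ unitary M', r = ‖w U V‖}
  have hne : T.Nonempty := ⟨_, 1, one_mem _, 1, one_mem _, rfl⟩
  have hb : BddAbove T := ⟨s, by rintro _ ⟨U, hU, V, hV, rfl⟩; exact hw U hU V hV⟩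
  obtain ⟨a, -, ha, haT⟩ := exists_seq_tendsto_sSup hne hb
  choose U hU V hV hUV using haT
  choose c hc hcz using fun n => exists_phase (w (U n) (V n))
  refine ⟨sSup T, csSup_le hne (by rintro _ ⟨U, hU, V, hV, rfl⟩; exact hw U hU V hV),
    fun U hU V hV => le_csSup hb ⟨U, hU, V, hV, rfl⟩, fun n => c n • U n, V, ?_, hV, ?_⟩
  · intro n
    have h1 : c n * (starRingEnd ℂ) (c n) = 1 := by
      rw [Complex.mul_conj, Complex.normSq_eq_norm_sq, hc n]; simp
    have h2 : (starRingEnd ℂ) (c n) * c n = 1 := by rw [mul_comm, h1]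
    have := Unitary.mem_iff.1 (hU n)
    rw [Unitary.mem_iff]
    simp only [star_smul, smul_mul_smul_comm, Complex.star_def, h1, h2, one_smul]
    exact this
  · have : (fun n => w (c n • U n) (V n)) = fun n => ((a n : ℝ) : ℂ) := by
      ext n; rw [map_smul, LinearMap.smul_apply, smul_eq_mul, hcz, hUV]
    rw [this]
    exact (Complex.continuous_ofReal.tendsto _).comp ha

/-- doubled form -/
def dbl (u : M →ₗ[ℂ] M' →ₗ[ℂ] ℂ) : (M × M) →ₗ[ℂ] (M' × M') →ₗ[ℂ] ℂ :=
  u.compl₁₂ (LinearMap.fst ℂ M M) (LinearMap.fst ℂ M' M') +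
  u.compl₁₂ (LinearMap.fst ℂ M M) (LinearMap.snd ℂ M' M') +
  u.compl₁₂ (LinearMap.snd ℂ M M) (LinearMap.fst ℂ M' M') +
  Complex.I • u.compl₁₂ (LinearMap.snd ℂ M M) (LinearMap.snd ℂ M' M')

lemma dbl_apply (u : M →ₗ[ℂ] M' →ₗ[ℂ] ℂ) (x : M × M) (y : M' × M') :
    dbl u x y = u x.1 y.1 + u x.1 y.2 + u x.2 y.1 + Complex.I * u x.2 y.2 := by
  simp [dbl]

lemma unitary_prod {x : M × M} (hx : x ∈ unitary (M × M)) :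
    x.1 ∈ unitary M ∧ x.2 ∈ unitary M := by
  rw [Unitary.mem_iff] at hx
  rw [Unitary.mem_iff, Unitary.mem_iff]
  have h1 := congrArg Prod.fst hx.1
  have h2 := congrArg Prod.snd hx.1
  have h3 := congrArg Prod.fst hx.2
  have h4 := congrArg Prod.snd hx.2
  exact ⟨⟨h1, h3⟩, ⟨h2, h4⟩⟩

lemma dbl_BUB {u : M →ₗ[ℂ] M' →ₗ[ℂ] ℂ} (hu : BUB u 1) : BUB (dbl u) 4 := by
  intro U hU V hV
  rw [dbl_apply]
  obtain ⟨h1, h2⟩ := unitary_prod hU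
  obtain ⟨h3, h4⟩ := unitary_prod hV
  have a := hu _ h1 _ h3
  have b := hu _ h1 _ h4
  have c := hu _ h2 _ h3
  have d := hu _ h2 _ h4
  have d' : ‖Complex.I * u U.2 V.2‖ ≤ 1 := by simpa using d
  have := norm_add_le_of_le (norm_add_le_of_le (norm_add_le_of_le a b) c) d'
  linarith

theorem one_step {u : M →ₗ[ℂ] M' →ₗ[ℂ] ℂ} (hu : BUB u 1) {J : Submodule ℂ M}
    {J' : Submodule ℂ M'} (hJ : IsSI J) (hJ' : IsSI J')
    (uJ : ∀ x ∈ J, ∀ y, u x y = 0) (uJ' : ∀ x, ∀ y ∈ J', u x y = 0) :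
    ∃ (f₁ f₂ : M →ₗ[ℂ] ℂ) (g₁ g₂ : M' →ₗ[ℂ] ℂ) (r : M →ₗ[ℂ] M' →ₗ[ℂ] ℂ),
      (UB f₁ (1 / 2) ∧ PosF f₁ ∧ ∀ x ∈ J, f₁ x = 0) ∧
      (UB f₂ (1 / 2) ∧ PosF f₂ ∧ ∀ x ∈ J, f₂ x = 0) ∧
      (UB g₁ (1 / 2) ∧ PosF g₁ ∧ ∀ x ∈ J', g₁ x = 0) ∧
      (UB g₂ (1 / 2) ∧ PosF g₂ ∧ ∀ x ∈ J', g₂ x = 0) ∧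
      BUB r (1 - 1 / 80000) ∧ (∀ x ∈ J, ∀ y, r x y = 0) ∧ (∀ x, ∀ y ∈ J', r x y = 0) ∧
      ∀ a b, ‖u a b - r a b‖ ≤ (f₁ (a * star a)).re + (f₂ (star a * a)).re +
        ((g₁ (b * star b)).re + (g₂ (star b * b)).re) := by
  obtain ⟨S, hS4, hS, U, V, hU, hV, hUV⟩ := exists_opt (dbl_BUB hu)
  have hS0 := hS.nonneg
  let l : Ultrafilter ℕ := Filter.hyperfilter ℕ
  have hl : (l : Filter ℕ) ≤ atTop := by
    rw [← Nat.cofinite_eq_atTop]; exact Filter.hyperfilter_le_cofinite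
  obtain ⟨f₁, f₂, g₁, g₂, q, hf₁, hf₂, hg₁, hg₂, hq, hmain⟩ := herm hS hU hV l (hUV.mono_left hl)
  have hUV' := hUV.mono_left hl
  let Δ : M →ₗ[ℂ] M × M := LinearMap.prod LinearMap.id LinearMap.id
  let Δ' : M' →ₗ[ℂ] M' × M' := LinearMap.prod LinearMap.id LinearMap.id
  have hΔ : ∀ x ∈ unitary M, Δ x ∈ unitary (M × M) := by
    intro x hx
    rw [Unitary.mem_iff] at hx ⊢
    exact ⟨Prod.ext hx.1 hx.1, Prod.ext hx.2 hx.2⟩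
  have hΔ' : ∀ x ∈ unitary M', Δ' x ∈ unitary (M' × M') := by
    intro x hx
    rw [Unitary.mem_iff] at hx ⊢
    exact ⟨Prod.ext hx.1 hx.1, Prod.ext hx.2 hx.2⟩
  have scale : ∀ {N : Type _} [CStarAlgebra N] (f : N →ₗ[ℂ] ℂ), UB f S → f 1 = S →
      UB (((1 / 8 : ℝ) : ℂ) • f) (1 / 2) ∧ PosF (((1 / 8 : ℝ) : ℂ) • f) := by
    intro N _ f hf h1
    refine ⟨fun W hW => ?_, (hf.posF h1).smul (by norm_num)⟩
    rw [LinearMap.smul_apply, norm_smul]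
    have := hf W hW
    norm_num
    linarith
  have scale' : ∀ {N : Type _} [CStarAlgebra N] (f : N →ₗ[ℂ] ℂ), UB f S → f 1 = S →
      UB (((1 / 8 : ℝ) : ℂ) • f) (1 / 2) ∧ PosF (((1 / 8 : ℝ) : ℂ) • f) := by
    intro N _ f hf h1
    refine ⟨fun W hW => ?_, (hf.posF h1).smul (by norm_num)⟩
    rw [LinearMap.smul_apply, norm_smul]
    have := hf W hW
    norm_num
    linarith
  -- the four functionals
  have F1 := scale (f₁.comp Δ)
    (fun W hW => tendsto_norm_le (hf₁ (Δ W)) (fun n => hS _ (mul_mem (hΔ W hW) (hU n)) _ (hV n)))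
    (tendsto_nhds_unique (hf₁ (Δ 1)) (by
      have : Δ 1 = 1 := rfl
      simpa [this] using hUV'))
  have F2 := scale (f₂.comp Δ)
    (fun W hW => tendsto_norm_le (hf₂ (Δ W)) (fun n => hS _ (mul_mem (hU n) (hΔ W hW)) _ (hV n)))
    (tendsto_nhds_unique (hf₂ (Δ 1)) (by
      have : Δ 1 = 1 := rfl
      simpa [this] using hUV'))
  have G1 := scale' (g₁.comp Δ')
    (fun W hW => tendsto_norm_le (hg₁ (Δ' W)) (fun n => hS _ (hU n) _ (mul_mem (hΔ' W hW) (hV n))))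
    (tendsto_nhds_unique (hg₁ (Δ' 1)) (by
      have : Δ' 1 = 1 := rfl
      simpa [this] using hUV'))
  have G2 := scale' (g₂.comp Δ')
    (fun W hW => tendsto_norm_le (hg₂ (Δ' W)) (fun n => hS _ (hU n) _ (mul_mem (hV n) (hΔ' W hW))))
    (tendsto_nhds_unique (hg₂ (Δ' 1)) (by
      have : Δ' 1 = 1 := rfl
      simpa [this] using hUV'))
  have hz : ∀ {f : ℕ → ℂ} {z : ℂ}, Tendsto f l (𝓝 z) → (∀ n, f n = 0) → z = 0 := by
    intro f z h h0
    refine tendsto_nhds_unique h ?_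
    simp [funext h0]
  let i₁ : M →ₗ[ℂ] M × M := LinearMap.inl ℂ M M
  let i₂ : M →ₗ[ℂ] M × M := LinearMap.inr ℂ M M
  let j₁ : M' →ₗ[ℂ] M' × M' := LinearMap.inl ℂ M' M'
  let j₂ : M' →ₗ[ℂ] M' × M' := LinearMap.inr ℂ M' M'
  let Q : M →ₗ[ℂ] M' →ₗ[ℂ] ℂ := (1 / 4 : ℂ) • (q.compl₁₂ i₁ j₁ + q.compl₁₂ i₁ j₂ +
    q.compl₁₂ i₂ j₁ - Complex.I • q.compl₁₂ i₂ j₂)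
  have hQ : ∀ a b, Q a b = (1 / 4 : ℂ) * (q (a, 0) (b, 0) + q (a, 0) (0, b) + q (0, a) (b, 0)
      - Complex.I * q (0, a) (0, b)) := by
    intro a b; simp [Q, i₁, i₂, j₁, j₂]
  have hQlim : ∀ a b, Tendsto (fun n => (1 / 4 : ℂ) * star (
      u ((U n).1 * star a * (U n).1) ((V n).1 * star b * (V n).1) +
      u ((U n).1 * star a * (U n).1) ((V n).2 * star b * (V n).2) +
      u ((U n).2 * star a * (U n).2) ((V n).1 * star b * (V n).1) -
      u ((U n).2 * star a * (U n).2) ((V n).2 * star b * (V n).2))) l (𝓝 (Q a b)) := by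
    intro a b
    rw [hQ]
    have := ((((hq (a, 0) (b, 0)).add (hq (a, 0) (0, b))).add (hq (0, a) (b, 0))).sub
      ((hq (0, a) (0, b)).const_mul Complex.I)).const_mul (1 / 4 : ℂ)
    refine this.congr (fun n => ?_)
    simp only [tw_apply, dbl_apply]
    simp only [Prod.fst_mul, Prod.snd_mul, Prod.fst_star, Prod.snd_star, star_zero, mul_zero,
      zero_mul, map_zero, LinearMap.zero_apply, add_zero, zero_add]
    simp only [star_add, star_sub, star_mul', Complex.star_def, Complex.conj_I]
    ring_nf
    simp only [Complex.I_sq]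
    ring
  have hQb : BUB Q ((4 - 1 / 10000) / 4) := by
    intro a ha b hb
    refine tendsto_norm_le (hQlim a b) (fun n => ?_)
    rw [norm_mul, norm_star]
    obtain ⟨h1, h2⟩ := unitary_prod (hU n)
    obtain ⟨h3, h4⟩ := unitary_prod (hV n)
    have sa := Unitary.star_mem ha
    have sb := Unitary.star_mem hb
    have := star_claim hu (mul_mem (mul_mem h1 sa) h1) (mul_mem (mul_mem h2 sa) h2)
      (mul_mem (mul_mem h3 sb) h3) (mul_mem (mul_mem h4 sb) h4)
    norm_num at *
    linarith
  refine ⟨((1 / 8 : ℝ) : ℂ) • f₁.comp Δ, ((1 / 8 : ℝ) : ℂ) • f₂.comp Δ,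
    ((1 / 8 : ℝ) : ℂ) • g₁.comp Δ', ((1 / 8 : ℝ) : ℂ) • g₂.comp Δ', (1 / 2 : ℂ) • (u - Q),
    ⟨F1.1, F1.2, ?_⟩, ⟨F2.1, F2.2, ?_⟩, ⟨G1.1, G1.2, ?_⟩, ⟨G2.1, G2.2, ?_⟩, ?_, ?_, ?_, ?_⟩
  · intro x hx
    have : f₁ (Δ x) = 0 := hz (hf₁ (Δ x)) (fun n => by
      simp [dbl_apply, Δ, uJ _ (hJ.mul_right _ x hx)])
    simp [this]
  · intro x hx
    have : f₂ (Δ x) = 0 := hz (hf₂ (Δ x)) (fun n => by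
      simp [dbl_apply, Δ, uJ _ (hJ.mul_left _ x hx)])
    simp [this]
  · intro x hx
    have : g₁ (Δ' x) = 0 := hz (hg₁ (Δ' x)) (fun n => by
      simp [dbl_apply, Δ', uJ' _ _ (hJ'.mul_right _ x hx)])
    simp [this]
  · intro x hx
    have : g₂ (Δ' x) = 0 := hz (hg₂ (Δ' x)) (fun n => by
      simp [dbl_apply, Δ', uJ' _ _ (hJ'.mul_left _ x hx)])
    simp [this]
  · intro a ha b hb
    have h1 := hu a ha b hb
    have h2 := hQb a ha b hb
    simp only [LinearMap.smul_apply, LinearMap.sub_apply, norm_smul]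
    have := norm_sub_le (u a b) (Q a b)
    norm_num at *
    linarith
  · intro x hx y
    have h1 : ∀ m, u (m * star x * m) = 0 := fun m => by
      ext y; exact uJ _ (hJ.mul_right _ _ (hJ.mul_left _ _ (hJ.star _ hx))) _
    have : Q x y = 0 := hz (hQlim x y) (fun n => by simp [h1])
    simp [this, uJ x hx y]
  · intro x y hy
    have h1 : ∀ z m, u z (m * star y * m) = 0 := fun z m =>
      uJ' _ _ (hJ'.mul_right _ _ (hJ'.mul_left _ _ (hJ'.star _ hy)))
    have : Q x y = 0 := hz (hQlim x y) (fun n => by simp [h1])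
    simp [this, uJ' x y hy]
  · intro a b
    have e1 : u a b - ((1 / 2 : ℂ) • (u - Q)) a b =
        (1 / 4 : ℂ) * ((1 / 2 : ℂ) * (dbl u (a, 0) (b, 0) + q (a, 0) (b, 0)) +
          (1 / 2 : ℂ) * (dbl u (a, 0) (0, b) + q (a, 0) (0, b)) +
          (1 / 2 : ℂ) * (dbl u (0, a) (b, 0) + q (0, a) (b, 0)) -
          Complex.I * ((1 / 2 : ℂ) * (dbl u (0, a) (0, b) + q (0, a) (0, b)))) := by
      simp only [LinearMap.smul_apply, LinearMap.sub_apply, hQ, dbl_apply, map_zero,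
        LinearMap.zero_apply, add_zero, zero_add, smul_eq_mul]
      ring_nf
      simp only [Complex.I_sq]
      ring
    have m1 := hmain (a, 0) (b, 0)
    have m2 := hmain (a, 0) (0, b)
    have m3 := hmain (0, a) (b, 0)
    have m4 := hmain (0, a) (0, b)
    rw [e1, norm_mul]
    have m4' := m4
    rw [← one_mul ‖_‖, ← Complex.norm_I, ← norm_mul] at m4'
    have tot := norm_sub_le_of_le (norm_add_le_of_le (norm_add_le_of_le m1 m2) m3) m4'
    have d1 : ∀ (f : M × M →ₗ[ℂ] ℂ) z, ((((1 / 8 : ℝ) : ℂ) • f.comp Δ) z).re =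
        1 / 8 * ((f (z, 0)).re + (f (0, z)).re) := by
      intro f z
      rw [LinearMap.smul_apply, smul_eq_mul, Complex.re_ofReal_mul, ← Complex.add_re, ← map_add]
      have : Δ z = (z, 0) + (0, z) := by simp [Δ]
      rw [LinearMap.comp_apply, this]
    have d2 : ∀ (f : M' × M' →ₗ[ℂ] ℂ) z, ((((1 / 8 : ℝ) : ℂ) • f.comp Δ') z).re =
        1 / 8 * ((f (z, 0)).re + (f (0, z)).re) := by
      intro f z
      rw [LinearMap.smul_apply, smul_eq_mul, Complex.re_ofReal_mul, ← Complex.add_re, ← map_add]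
      have : Δ' z = (z, 0) + (0, z) := by simp [Δ']
      rw [LinearMap.comp_apply, this]
    rw [d1, d1, d2, d2]
    simp only [Prod.star_def, Prod.mk_mul_mk, star_zero, mul_zero] at tot
    norm_num at tot ⊢
    linarith

end unital
end GT

namespace GT
open Filter Topology

lemma posF_lim {I M : Type*} [NonUnitalRing M] [StarRing M] [Module ℂ M] {l : Filter I} [l.NeBot]
    {φ : I → M →ₗ[ℂ] ℂ} {ψ : M →ₗ[ℂ] ℂ} (h : ∀ x, Tendsto (fun i => φ i x) l (𝓝 (ψ x)))
    (hφ : ∀ i, PosF (φ i)) : PosF ψ := by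
  intro x
  constructor
  · exact ge_of_tendsto' ((Complex.continuous_re.tendsto _).comp (h (star x * x)))
      (fun i => (hφ i x).1)
  · refine tendsto_nhds_unique ((Complex.continuous_im.tendsto _).comp (h (star x * x))) ?_
    have : (Complex.im ∘ fun i => (φ i) (star x * x)) = fun _ => 0 := funext fun i => (hφ i x).2
    rw [this]; exact tendsto_const_nhds

lemma eq_zero_lim {I : Type*} {l : Filter I} [l.NeBot] {f : I → ℂ} {z : ℂ}
    (h : Tendsto f l (𝓝 z)) (h0 : ∀ n, f n = 0) : z = 0 := by
  refine tendsto_nhds_unique h ?_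
  simp [funext h0]

section unital
variable {M M' : Type*} [CStarAlgebra M] [CStarAlgebra M']

lemma iter (N : ℕ) : ∀ {u : M →ₗ[ℂ] M' →ₗ[ℂ] ℂ} (_ : BUB u 1) {J : Submodule ℂ M}
    {J' : Submodule ℂ M'} (_ : IsSI J) (_ : IsSI J')
    (_ : ∀ x ∈ J, ∀ y, u x y = 0) (_ : ∀ x, ∀ y ∈ J', u x y = 0),
    ∃ (f₁ f₂ : M →ₗ[ℂ] ℂ) (g₁ g₂ : M' →ₗ[ℂ] ℂ),
      (UB f₁ 40000 ∧ PosF f₁ ∧ ∀ x ∈ J, f₁ x = 0) ∧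
      (UB f₂ 40000 ∧ PosF f₂ ∧ ∀ x ∈ J, f₂ x = 0) ∧
      (UB g₁ 40000 ∧ PosF g₁ ∧ ∀ x ∈ J', g₁ x = 0) ∧
      (UB g₂ 40000 ∧ PosF g₂ ∧ ∀ x ∈ J', g₂ x = 0) ∧
      ∀ a b, ‖u a b‖ ≤ (f₁ (a * star a)).re + (f₂ (star a * a)).re +
        ((g₁ (b * star b)).re + (g₂ (star b * b)).re) +
        4 * (1 - 1 / 80000) ^ N * ‖a‖ * ‖b‖ := by
  induction N with
  | zero =>
    intro u hu J J' hJ hJ' uJ uJ'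
    have hz : ∀ {N : Type _} [CStarAlgebra N] (J : Submodule ℂ N), UB (0 : N →ₗ[ℂ] ℂ) 40000 ∧
      PosF (0 : N →ₗ[ℂ] ℂ) ∧ ∀ x ∈ J, (0 : N →ₗ[ℂ] ℂ) x = 0 := fun J =>
      ⟨fun W _ => by simp, fun x => by simp, fun x _ => by simp⟩
    have hz' : ∀ {N : Type _} [CStarAlgebra N] (J : Submodule ℂ N), UB (0 : N →ₗ[ℂ] ℂ) 40000 ∧
      PosF (0 : N →ₗ[ℂ] ℂ) ∧ ∀ x ∈ J, (0 : N →ₗ[ℂ] ℂ) x = 0 := fun J =>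
      ⟨fun W _ => by simp, fun x => by simp, fun x _ => by simp⟩
    refine ⟨0, 0, 0, 0, hz J, hz J, hz' J', hz' J', fun a b => ?_⟩
    simpa using hu.gen a b
  | succ N ih =>
    intro u hu J J' hJ hJ' uJ uJ'
    obtain ⟨f₁, f₂, g₁, g₂, r, F1, F2, G1, G2, hr, rJ, rJ', hm⟩ := one_step hu hJ hJ' uJ uJ'
    set θ : ℝ := 1 - 1 / 80000 with hθ
    have θ0 : 0 < θ := by norm_num [hθ]
    have hr' : BUB (((θ⁻¹ : ℝ) : ℂ) • r) 1 := by
      intro U hU V hV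
      rw [LinearMap.smul_apply, LinearMap.smul_apply, norm_smul, Complex.norm_real,
        Real.norm_of_nonneg (by positivity), inv_mul_le_one₀ θ0]
      exact hr U hU V hV
    obtain ⟨f₁', f₂', g₁', g₂', F1', F2', G1', G2', hm'⟩ := ih hr' hJ hJ'
      (fun x hx y => by simp [rJ x hx y]) (fun x y hy => by simp [rJ' x y hy])
    have comb : ∀ {N : Type _} [CStarAlgebra N] {J : Submodule ℂ N} {f f' : N →ₗ[ℂ] ℂ},
        (UB f (1 / 2) ∧ PosF f ∧ ∀ x ∈ J, f x = 0) →
        (UB f' 40000 ∧ PosF f' ∧ ∀ x ∈ J, f' x = 0) →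
        (UB (f + (θ : ℂ) • f') 40000 ∧ PosF (f + (θ : ℂ) • f') ∧
          ∀ x ∈ J, (f + (θ : ℂ) • f') x = 0) := by
      rintro N _ J f f' ⟨h1, h2, h3⟩ ⟨h1', h2', h3'⟩
      refine ⟨fun W hW => ?_, h2.add (h2'.smul θ0.le), fun x hx => by simp [h3 x hx, h3' x hx]⟩
      have a1 := h1 W hW
      have a2 : ‖(θ : ℂ) * f' W‖ ≤ θ * 40000 := by
        rw [norm_mul, Complex.norm_real, Real.norm_of_nonneg θ0.le]
        exact mul_le_mul_of_nonneg_left (h1' W hW) θ0.le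
      rw [LinearMap.add_apply, LinearMap.smul_apply, smul_eq_mul]
      refine (norm_add_le_of_le a1 a2).trans ?_
      norm_num [hθ]
    have comb' : ∀ {N : Type _} [CStarAlgebra N] {J : Submodule ℂ N} {f f' : N →ₗ[ℂ] ℂ},
        (UB f (1 / 2) ∧ PosF f ∧ ∀ x ∈ J, f x = 0) →
        (UB f' 40000 ∧ PosF f' ∧ ∀ x ∈ J, f' x = 0) →
        (UB (f + (θ : ℂ) • f') 40000 ∧ PosF (f + (θ : ℂ) • f') ∧
          ∀ x ∈ J, (f + (θ : ℂ) • f') x = 0) := by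
      rintro N _ J f f' ⟨h1, h2, h3⟩ ⟨h1', h2', h3'⟩
      refine ⟨fun W hW => ?_, h2.add (h2'.smul θ0.le), fun x hx => by simp [h3 x hx, h3' x hx]⟩
      have a1 := h1 W hW
      have a2 : ‖(θ : ℂ) * f' W‖ ≤ θ * 40000 := by
        rw [norm_mul, Complex.norm_real, Real.norm_of_nonneg θ0.le]
        exact mul_le_mul_of_nonneg_left (h1' W hW) θ0.le
      rw [LinearMap.add_apply, LinearMap.smul_apply, smul_eq_mul]
      refine (norm_add_le_of_le a1 a2).trans ?_
      norm_num [hθ]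
    refine ⟨_, _, _, _, comb F1 F1', comb F2 F2', comb' G1 G1', comb' G2 G2', fun a b => ?_⟩
    have m1 := hm a b
    have m2 := hm' a b
    rw [LinearMap.smul_apply, LinearMap.smul_apply, norm_smul, Complex.norm_real,
        Real.norm_of_nonneg (by positivity), inv_mul_le_iff₀ θ0] at m2
    have m3 : ‖u a b‖ ≤ ‖u a b - r a b‖ + ‖r a b‖ := by
      simpa using norm_add_le (u a b - r a b) (r a b)
    simp only [LinearMap.add_apply, LinearMap.smul_apply, smul_eq_mul, Complex.add_re,
      Complex.re_ofReal_mul]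
    rw [pow_succ]
    linarith

theorem GT_unital {u : M →ₗ[ℂ] M' →ₗ[ℂ] ℂ} (hu : BUB u 1) {J : Submodule ℂ M}
    {J' : Submodule ℂ M'} (hJ : IsSI J) (hJ' : IsSI J')
    (uJ : ∀ x ∈ J, ∀ y, u x y = 0) (uJ' : ∀ x, ∀ y ∈ J', u x y = 0) :
    ∃ (f₁ f₂ : M →ₗ[ℂ] ℂ) (g₁ g₂ : M' →ₗ[ℂ] ℂ),
      ((∀ x, ‖f₁ x‖ ≤ 80000 * ‖x‖) ∧ PosF f₁ ∧ ∀ x ∈ J, f₁ x = 0) ∧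
      ((∀ x, ‖f₂ x‖ ≤ 80000 * ‖x‖) ∧ PosF f₂ ∧ ∀ x ∈ J, f₂ x = 0) ∧
      ((∀ x, ‖g₁ x‖ ≤ 80000 * ‖x‖) ∧ PosF g₁ ∧ ∀ x ∈ J', g₁ x = 0) ∧
      ((∀ x, ‖g₂ x‖ ≤ 80000 * ‖x‖) ∧ PosF g₂ ∧ ∀ x ∈ J', g₂ x = 0) ∧
      ∀ a b, ‖u a b‖ ≤ (f₁ (a * star a)).re + (f₂ (star a * a)).re +
        ((g₁ (b * star b)).re + (g₂ (star b * b)).re) := by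
  choose f₁ f₂ g₁ g₂ F1 F2 G1 G2 hm using fun N => iter N hu hJ hJ' uJ uJ'
  let l : Ultrafilter ℕ := Filter.hyperfilter ℕ
  have hl : (l : Filter ℕ) ≤ atTop := by
    rw [← Nat.cofinite_eq_atTop]; exact Filter.hyperfilter_le_cofinite
  have bd : ∀ {N : Type _} [CStarAlgebra N] {f : N →ₗ[ℂ] ℂ}, UB f 40000 →
      ∀ x, ‖f x‖ ≤ 80000 * ‖x‖ := by
    intro N _ f hf x
    have := hf.gen x
    linarith
  have bd' : ∀ {N : Type _} [CStarAlgebra N] {f : N →ₗ[ℂ] ℂ}, UB f 40000 →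
      ∀ x, ‖f x‖ ≤ 80000 * ‖x‖ := by
    intro N _ f hf x
    have := hf.gen x
    linarith
  obtain ⟨φ₁, h1⟩ := ulim_exists l f₁ (fun x => ⟨_, fun i => bd (F1 i).1 x⟩)
  obtain ⟨φ₂, h2⟩ := ulim_exists l f₂ (fun x => ⟨_, fun i => bd (F2 i).1 x⟩)
  obtain ⟨ψ₁, k1⟩ := ulim_exists l g₁ (fun x => ⟨_, fun i => bd' (G1 i).1 x⟩)
  obtain ⟨ψ₂, k2⟩ := ulim_exists l g₂ (fun x => ⟨_, fun i => bd' (G2 i).1 x⟩)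
  refine ⟨φ₁, φ₂, ψ₁, ψ₂, ⟨fun x => tendsto_norm_le (h1 x) (fun i => bd (F1 i).1 x),
      posF_lim h1 (fun i => (F1 i).2.1), fun x hx => eq_zero_lim (h1 x) fun i => (F1 i).2.2 x hx⟩,
    ⟨fun x => tendsto_norm_le (h2 x) (fun i => bd (F2 i).1 x),
      posF_lim h2 (fun i => (F2 i).2.1), fun x hx => eq_zero_lim (h2 x) fun i => (F2 i).2.2 x hx⟩,
    ⟨fun x => tendsto_norm_le (k1 x) (fun i => bd' (G1 i).1 x),
      posF_lim k1 (fun i => (G1 i).2.1), fun x hx => eq_zero_lim (k1 x) fun i => (G1 i).2.2 x hx⟩,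
    ⟨fun x => tendsto_norm_le (k2 x) (fun i => bd' (G2 i).1 x),
      posF_lim k2 (fun i => (G2 i).2.1), fun x hx => eq_zero_lim (k2 x) fun i => (G2 i).2.2 x hx⟩,
    fun a b => ?_⟩
  have hre : ∀ {f : ℕ → ℂ} {z : ℂ}, Tendsto f l (𝓝 z) → Tendsto (fun n => (f n).re) l (𝓝 z.re) :=
    fun h => (Complex.continuous_re.tendsto _).comp h
  have t0 : Tendsto (fun N : ℕ => 4 * (1 - 1 / 80000 : ℝ) ^ N * ‖a‖ * ‖b‖) l (𝓝 0) := by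
    have := (((tendsto_pow_atTop_nhds_zero_of_lt_one (r := (1 - 1 / 80000 : ℝ)) (by norm_num)
      (by norm_num)).const_mul 4).mul_const ‖a‖).mul_const ‖b‖
    simp only [mul_zero, zero_mul] at this
    exact this.mono_left hl
  have := ge_of_tendsto' ((((hre (h1 (a * star a))).add (hre (h2 (star a * a)))).add
    ((hre (k1 (b * star b))).add (hre (k2 (star b * b))))).add t0) (fun N => hm N a b)
  simpa using this

end unital

section nonunital
variable {M M' : Type*} [NonUnitalCStarAlgebra M] [NonUnitalCStarAlgebra M']

/-- second component -/
def usnd (M : Type*) [NonUnitalCStarAlgebra M] : Unitization ℂ M →ₗ[ℂ] M where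
  toFun x := x.snd
  map_add' _ _ := rfl
  map_smul' _ _ := rfl

def uinr (M : Type*) [NonUnitalCStarAlgebra M] : M →ₗ[ℂ] Unitization ℂ M where
  toFun x := (x : Unitization ℂ M)
  map_add' x y := by simp
  map_smul' c y := by simp

lemma usnd_norm (x : Unitization ℂ M) : ‖usnd M x‖ ≤ 2 * ‖x‖ := by
  have h1 : ‖x.fst‖ ≤ ‖x‖ := by rw [Unitization.norm_eq_sup]; exact le_sup_left
  have h2 : ‖(x.snd : Unitization ℂ M)‖ = ‖x.snd‖ := Unitization.norm_inr x.snd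
  have h3 : (x.snd : Unitization ℂ M) = x - algebraMap ℂ _ x.fst := by
    rw [Unitization.algebraMap_eq_inl, eq_sub_iff_add_eq, add_comm]
    exact Unitization.inl_fst_add_inr_snd_eq x
  have h4 : ‖algebraMap ℂ (Unitization ℂ M) x.fst‖ = ‖x.fst‖ := norm_algebraMap' _ _
  have := norm_sub_le x (algebraMap ℂ _ x.fst)
  change ‖x.snd‖ ≤ _
  rw [← h2, h3]
  linarith

lemma IsSI.unit {J : Submodule ℂ M} (hJ : IsSI J) : IsSI (J.map (uinr M)) := by
  refine ⟨?_, ?_, ?_⟩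
  · rintro m _ ⟨x, hx, rfl⟩
    refine ⟨m.fst • x + m.snd * x, add_mem (J.smul_mem _ hx) (hJ.mul_left _ _ hx), ?_⟩
    ext <;> simp [uinr]
  · rintro m _ ⟨x, hx, rfl⟩
    refine ⟨m.fst • x + x * m.snd, add_mem (J.smul_mem _ hx) (hJ.mul_right _ _ hx), ?_⟩
    ext <;> simp [uinr]
  · rintro _ ⟨x, hx, rfl⟩
    exact ⟨Star.star x, hJ.star _ hx, by simp [uinr]⟩

theorem GT_nonunital {u : M →ₗ[ℂ] M' →ₗ[ℂ] ℂ} (hu : ∀ x y, ‖u x y‖ ≤ ‖x‖ * ‖y‖)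
    {J : Submodule ℂ M} {J' : Submodule ℂ M'} (hJ : IsSI J) (hJ' : IsSI J')
    (uJ : ∀ x ∈ J, ∀ y, u x y = 0) (uJ' : ∀ x, ∀ y ∈ J', u x y = 0) :
    ∃ (f₁ f₂ : M →ₗ[ℂ] ℂ) (g₁ g₂ : M' →ₗ[ℂ] ℂ),
      ((∀ x, ‖f₁ x‖ ≤ 80000 * ‖x‖) ∧ PosF f₁ ∧ ∀ x ∈ J, f₁ x = 0) ∧
      ((∀ x, ‖f₂ x‖ ≤ 80000 * ‖x‖) ∧ PosF f₂ ∧ ∀ x ∈ J, f₂ x = 0) ∧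
      ((∀ x, ‖g₁ x‖ ≤ 80000 * ‖x‖) ∧ PosF g₁ ∧ ∀ x ∈ J', g₁ x = 0) ∧
      ((∀ x, ‖g₂ x‖ ≤ 80000 * ‖x‖) ∧ PosF g₂ ∧ ∀ x ∈ J', g₂ x = 0) ∧
      ∀ a b, ‖u a b‖ ≤ 4 * ((f₁ (a * star a)).re + (f₂ (star a * a)).re +
        ((g₁ (b * star b)).re + (g₂ (star b * b)).re)) := by
  let v : Unitization ℂ M →ₗ[ℂ] Unitization ℂ M' →ₗ[ℂ] ℂ :=
    ((1 / 4 : ℝ) : ℂ) • u.compl₁₂ (usnd M) (usnd M')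
  have hv : ∀ x y, v x y = ((1 / 4 : ℝ) : ℂ) * u (usnd M x) (usnd M' y) := fun x y => by simp [v]
  have hvb : BUB v 1 := by
    intro U hU V hV
    rw [hv, norm_mul]
    have h1 := hu (usnd M U) (usnd M' V)
    have h2 : ‖usnd M U‖ ≤ 2 := by linarith [usnd_norm U, norm_unitary_le hU]
    have h3 : ‖usnd M' V‖ ≤ 2 := by linarith [usnd_norm V, norm_unitary_le hV]
    have h4 : ‖usnd M U‖ * ‖usnd M' V‖ ≤ 2 * 2 := by gcongr
    norm_num
    linarith
  obtain ⟨f₁, f₂, g₁, g₂, F1, F2, G1, G2, hm⟩ := GT_unital hvb hJ.unit hJ'.unit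
    (by rintro _ ⟨x, hx, rfl⟩ y; rw [hv]; simp [uJ _ (show usnd M (uinr M x) ∈ J from hx)])
    (by rintro x _ ⟨y, hy, rfl⟩; rw [hv]; simp [uJ' _ _ (show usnd M' (uinr M' y) ∈ J' from hy)])
  have tr : ∀ {N : Type _} [NonUnitalCStarAlgebra N] {J : Submodule ℂ N}
      {f : Unitization ℂ N →ₗ[ℂ] ℂ},
      ((∀ x, ‖f x‖ ≤ 80000 * ‖x‖) ∧ PosF f ∧ ∀ x ∈ J.map (uinr N), f x = 0) →
      ((∀ x, ‖f.comp (uinr N) x‖ ≤ 80000 * ‖x‖) ∧ PosF (f.comp (uinr N)) ∧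
        ∀ x ∈ J, f.comp (uinr N) x = 0) := by
    rintro N _ J f ⟨h1, h2, h3⟩
    refine ⟨fun x => ?_, fun x => ?_, fun x hx => h3 _ ⟨x, hx, rfl⟩⟩
    · have := h1 (uinr N x)
      rwa [show ‖uinr N x‖ = ‖x‖ from Unitization.norm_inr x] at this
    · have := h2 (uinr N x)
      simpa [uinr] using this
  have tr' : ∀ {N : Type _} [NonUnitalCStarAlgebra N] {J : Submodule ℂ N}
      {f : Unitization ℂ N →ₗ[ℂ] ℂ},
      ((∀ x, ‖f x‖ ≤ 80000 * ‖x‖) ∧ PosF f ∧ ∀ x ∈ J.map (uinr N), f x = 0) →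
      ((∀ x, ‖f.comp (uinr N) x‖ ≤ 80000 * ‖x‖) ∧ PosF (f.comp (uinr N)) ∧
        ∀ x ∈ J, f.comp (uinr N) x = 0) := by
    rintro N _ J f ⟨h1, h2, h3⟩
    refine ⟨fun x => ?_, fun x => ?_, fun x hx => h3 _ ⟨x, hx, rfl⟩⟩
    · have := h1 (uinr N x)
      rwa [show ‖uinr N x‖ = ‖x‖ from Unitization.norm_inr x] at this
    · have := h2 (uinr N x)
      simpa [uinr] using this
  refine ⟨_, _, _, _, tr F1, tr F2, tr' G1, tr' G2, fun a b => ?_⟩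
  have := hm (uinr M a) (uinr M' b)
  rw [hv, norm_mul, show usnd M (uinr M a) = a from rfl, show usnd M' (uinr M' b) = b from rfl]
    at this
  have e1 : ∀ a : M, uinr M a * star (uinr M a) = uinr M (a * star a) := by simp [uinr]
  have e2 : ∀ a : M, star (uinr M a) * (uinr M a) = uinr M (star a * a) := by simp [uinr]
  have e3 : ∀ a : M', uinr M' a * star (uinr M' a) = uinr M' (a * star a) := by simp [uinr]
  have e4 : ∀ a : M', star (uinr M' a) * (uinr M' a) = uinr M' (star a * a) := by simp [uinr]
  rw [e1, e2, e3, e4] at this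
  simp only [LinearMap.comp_apply]
  norm_num at this
  linarith

end nonunital
end GT

namespace GT
open Filter Topology

section cnorm
variable {M : Type*} [NonUnitalCStarAlgebra M] {N : M → ℝ}

lemma cn_zero (hN : IsCStarNorm N) : N 0 = 0 := by
  have := hN.smul_eq 0 0
  simpa using this

lemma cn_nonneg (hN : IsCStarNorm N) (x : M) : 0 ≤ N x := by
  have h1 := hN.add_le x ((-1 : ℂ) • x)
  have h2 := hN.smul_eq (-1) x
  have h3 : x + (-1 : ℂ) • x = 0 := by simp
  rw [h3, cn_zero hN, h2] at h1
  simp at h1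
  linarith

lemma cn_sa_le (hN : IsCStarNorm N) {h : M} (hh : IsSelfAdjoint h) (h1 : ‖h‖ ≤ 1) : N h ≤ 1 := by
  have hs : ∀ t ∈ quasispectrum ℝ h, t ^ 2 ≤ 1 := by
    intro t ht
    have := NonUnitalIsometricContinuousFunctionalCalculus.norm_quasispectrum_le (A := M) h ht hh
    rw [Real.norm_eq_abs] at this
    exact (sq_le_one_iff_abs_le_one t).2 (this.trans h1)
  set g : ℝ → ℝ := fun t => 1 - √(1 - t ^ 2) with hg
  have gc : Continuous g := by fun_prop
  have g0 : g 0 = 0 := by simp [hg]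
  set y := cfcₙ g h with hy
  have ysa : star y = y := (cfcₙ_predicate g h : IsSelfAdjoint y)
  have hid : cfcₙ (fun t : ℝ => t) h = h := cfcₙ_id' ℝ h
  have e1 : y * y + h * h = y + y := by
    have a1 : y * y = cfcₙ (fun t => g t * g t) h := by
      rw [hy, ← cfcₙ_mul g g h]
    have a2 : h * h = cfcₙ (fun t : ℝ => t * t) h := by
      conv_lhs => rw [← hid]
      rw [← cfcₙ_mul (fun t : ℝ => t) (fun t : ℝ => t) h]
    rw [a1, a2, hy, ← cfcₙ_add .., ← cfcₙ_add ..]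
    apply cfcₙ_congr
    intro t ht
    have := Real.sq_sqrt (show 0 ≤ 1 - t ^ 2 by linarith [hs t ht])
    simp only [hg]
    nlinarith
  have e2 : y * h = h * y := by
    have : h * y = cfcₙ (fun t : ℝ => t * g t) h := by
      conv_lhs => lhs; rw [← hid]
      rw [hy, ← cfcₙ_mul (fun t : ℝ => t) g h]
    rw [this]
    have : y * h = cfcₙ (fun t : ℝ => g t * t) h := by
      conv_lhs => rhs; rw [← hid]
      rw [hy, ← cfcₙ_mul g (fun t : ℝ => t) h]
    rw [this]; simp_rw [mul_comm]
  have key : ∀ c : ℂ, c * star c = 1 → star c = - c → ∀ x : M, N (h * x + c • (x - y * x)) = N x := by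
    intro c hc hc' x
    have nn := cn_nonneg hN
    have h1 := hN.star_mul_self (h * x + c • (x - y * x))
    have h2 := hN.star_mul_self x
    have e3 : star (h * x + c • (x - y * x)) * (h * x + c • (x - y * x)) = star x * x := by
      have e5 : star x * y * (y * x) = (star x * y * x + star x * y * x) - star x * h * (h * x) := by
        have : star x * (y * y + h * h) * x = star x * (y + y) * x := by rw [e1]
        simp only [mul_add, add_mul] at this
        simp only [← mul_assoc] at this ⊢
        rw [← this]; abel
      have e6 : star x * y * (h * x) = star x * h * (y * x) := by
        have : star x * (y * h) * x = star x * (h * y) * x := by rw [e2]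
        simpa only [← mul_assoc] using this
      simp only [star_add, star_mul, star_smul, star_sub, ysa, hh.star_eq, hc']
      simp only [add_mul, mul_add, smul_mul_assoc, mul_smul_comm, smul_sub, sub_mul, mul_sub]
      have hcc : c * c = -1 := by
        rw [hc'] at hc; linear_combination -hc
      have e7 : star x * (y * x) = star x * y * x := by rw [mul_assoc]
      have e8 : star x * (h * x) = star x * h * x := by rw [mul_assoc]
      have e9 : star x * h * (y * x) = star x * y * (h * x) := e6.symm
      simp only [e5, e9, e7, e8]
      match_scalars <;> simp <;> first | ring1 | linear_combination (-1) * hcc | linear_combination hcc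
    rw [e3, h2] at h1
    nlinarith [nn x, nn (h * x + c • (x - y * x)),
      mul_self_inj (nn x) (nn (h * x + c • (x - y * x))) |>.1 h1]
  have k1 := key Complex.I (by simp) (by simp) h
  have k2 := key (-Complex.I) (by simp) (by simp) h
  have k3 := hN.add_le (h * h + Complex.I • (h - y * h)) (h * h + (-Complex.I) • (h - y * h))
  have k4 : (h * h + Complex.I • (h - y * h)) + (h * h + (-Complex.I) • (h - y * h)) =
    (2 : ℂ) • (star h * h) := by
    rw [hh.star_eq]; module
  rw [k4, hN.smul_eq, hN.star_mul_self, k1, k2] at k3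
  have := cn_nonneg hN h
  norm_num at k3
  by_contra hc
  push Not at hc
  nlinarith

lemma cn_le (hN : IsCStarNorm N) (x : M) : N x ≤ ‖x‖ := by
  by_cases hx : x = 0
  · simp [hx, cn_zero hN]
  have hx' : 0 < ‖x‖ := norm_pos_iff.2 hx
  have h1 := cn_sa_le hN (h := ((((‖x‖ * ‖x‖)⁻¹ : ℝ) : ℂ)) • (star x * x))
    (by
      refine IsSelfAdjoint.smul ?_ (IsSelfAdjoint.star_mul_self x)
      rw [IsSelfAdjoint]; simp)
    (by
      rw [norm_smul, CStarRing.norm_star_mul_self, Complex.norm_real,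
        Real.norm_of_nonneg (by positivity)]
      exact (inv_mul_cancel₀ (by positivity)).le)
  rw [hN.smul_eq, hN.star_mul_self, Complex.norm_real,
        Real.norm_of_nonneg (by positivity), inv_mul_le_one₀ (by positivity)] at h1
  exact abs_le_of_sq_le_sq' (by nlinarith) hx'.le |>.2

lemma cn_ge (hN : IsCStarNorm N) (x : M) : ‖x‖ ≤ N x := by
  by_contra hc
  push Not at hc
  have nn := cn_nonneg hN
  have hx' : 0 < ‖x‖ := (nn x).trans_lt hc
  set h : M := star x * x with hh
  have hsa : IsSelfAdjoint h := IsSelfAdjoint.star_mul_self x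
  have hlt : N h < ‖h‖ := by
    rw [hh, hN.star_mul_self, CStarRing.norm_star_mul_self]
    exact mul_self_lt_mul_self (nn x) hc
  obtain ⟨r, hr1, hr2⟩ := exists_between hlt
  have r0 : 0 < r := (nn h).trans_lt hr1
  let _ := CStarAlgebra.spectralOrder M
  let _ := CStarAlgebra.spectralOrderedRing M
  have hpos : ∀ t ∈ quasispectrum ℝ h, 0 ≤ t :=
    fun t ht => quasispectrum_nonneg_of_nonneg h (star_mul_self_nonneg x) t ht
  have hid : cfcₙ (fun t : ℝ => t) h = h := cfcₙ_id' ℝ h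
  set f : ℝ → ℝ := fun t => max 0 (t - r) with hf
  have fc : Continuous f := by fun_prop
  have f0 : f 0 = 0 := by simp [hf, r0.le]
  set g : ℝ → ℝ := fun t => t / (max t r) ^ 2 with hg
  have gc : Continuous g := by
    refine Continuous.div (by fun_prop) (by fun_prop) (fun t => ?_)
    have : 0 < max t r := lt_max_of_lt_right r0
    positivity
  have g0 : g 0 = 0 := by simp [hg]
  set z := cfcₙ f h with hz
  set k := cfcₙ g h with hk
  have kn : ‖k‖ ≤ 1 / r := by
    refine norm_cfcₙ_le fun t ht => ?_
    have h1 : 0 < max t r := lt_max_of_lt_right r0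
    have h2 := hpos t ht
    rw [Real.norm_of_nonneg (by positivity), div_le_div_iff₀ (by positivity) r0]
    have := le_max_left t r
    have := le_max_right t r
    nlinarith
  have ez : z = z * h * k := by
    have a1 : z * h = cfcₙ (fun t => f t * t) h := by
      conv_lhs => rhs; rw [← hid]
      rw [hz, ← cfcₙ_mul f (fun t : ℝ => t) h fc.continuousOn f0 continuous_id.continuousOn rfl]
    have ftc : Continuous fun t => f t * t := by fun_prop
    rw [a1, hk, ← cfcₙ_mul (fun t => f t * t) g h ftc.continuousOn (by simp) gc.continuousOn g0, hz]
    apply cfcₙ_congr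
    intro t ht
    simp only [hf, hg]
    rcases le_total t r with h | h
    · simp [h]
    · rw [max_eq_left h, max_eq_right (by linarith)]
      have : 0 < t := by linarith
      field_simp
  have z0 : z ≠ 0 := by
    intro hz0
    have : ‖h‖ ≤ r := by
      conv_lhs => rw [← hid]
      refine norm_cfcₙ_le fun t ht => ?_
      rw [Real.norm_of_nonneg (hpos t ht)]
      have := norm_apply_le_norm_cfcₙ f h ht fc.continuousOn f0 hsa
      rw [← hz, hz0, norm_zero, Real.norm_eq_abs, hf] at this
      have := abs_nonpos_iff.1 this
      have := le_max_right 0 (t - r)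
      linarith
    linarith
  have z1 : 0 < N z := lt_of_le_of_ne (nn z) (fun h => z0 (hN.eq_zero_of z h.symm))
  have b1 : N z ≤ N z * N h * N k := by
    conv_lhs => rw [ez]
    exact (hN.mul_le _ _).trans (mul_le_mul_of_nonneg_right (hN.mul_le _ _) (nn k))
  have b2 : N k ≤ 1 / r := (cn_le hN k).trans kn
  have b3 : N h * N k < 1 := by
    calc N h * N k ≤ N h * (1 / r) := mul_le_mul_of_nonneg_left b2 (nn h)
      _ < 1 := by rw [mul_one_div, div_lt_one r0]; exact hr1
  nlinarith

lemma cn_eq (hN : IsCStarNorm N) (x : M) : N x = ‖x‖ := le_antisymm (cn_le hN x) (cn_ge hN x)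

end cnorm

lemma cn_matrix {A : Type*} [NonUnitalCStarAlgebra A] [PartialOrder A]
    [StarOrderedRing A] {p : ℕ} {N : Matrix (Fin p) (Fin p) A → ℝ}
    (hN : IsCStarNorm N) (x : Matrix (Fin p) (Fin p) A) : N x = ‖CStarMatrix.ofMatrix x‖ := by
  have : IsCStarNorm (M := CStarMatrix (Fin p) (Fin p) A) N := 
    ⟨hN.add_le, hN.smul_eq, hN.eq_zero_of, hN.mul_le, hN.star_mul_self⟩
  exact cn_eq (M := CStarMatrix (Fin p) (Fin p) A) this x

end GT

namespace GT
open Filter Topology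

/-- bounded positive functional vanishing on `J`. -/
def Good {M : Type*} [NonUnitalCStarAlgebra M] (f : M →ₗ[ℂ] ℂ) (J : Submodule ℂ M) : Prop :=
  (∀ x, ‖f x‖ ≤ 80000 * ‖x‖) ∧ PosF f ∧ ∀ x ∈ J, f x = 0

section mat
variable {A : Type*} [NonUnitalCStarAlgebra A] [PartialOrder A] [StarOrderedRing A] {N : ℕ}

/-- the entry map -/
def ent (y x : Fin N) : CStarMatrix (Fin N) (Fin N) A →ₗ[ℂ] A where
  toFun X := X y x
  map_add' _ _ := rfl
  map_smul' _ _ := rfl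

/-- matrix with a single entry -/
def sgl (y x : Fin N) (a : A) : CStarMatrix (Fin N) (Fin N) A :=
  CStarMatrix.ofMatrix (Matrix.single y x a)

lemma sgl_apply (y x y' x' : Fin N) (a : A) : sgl y x a y' x' = if y = y' ∧ x = x' then a else 0 :=
  rfl

lemma sgl_mul (y x z : Fin N) (a b : A) : sgl y x a * sgl x z b = sgl y z (a * b) :=
  Matrix.single_mul_single_same (c := a) y x z b

lemma sgl_star (y x : Fin N) (a : A) : star (sgl y x a) = sgl x y (star a) :=
  Matrix.conjTranspose_single y x a

/-- constant diagonal matrices -/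
def dg (N : ℕ) (A : Type*) [NonUnitalCStarAlgebra A] [PartialOrder A] [StarOrderedRing A] :
    A →⋆ₙₐ[ℂ] CStarMatrix (Fin N) (Fin N) A where
  toFun a := CStarMatrix.ofMatrix (Matrix.diagonal fun _ => a)
  map_smul' c a := by
    ext i j
    by_cases h : i = j <;> simp [h, Matrix.diagonal]
  map_zero' := by simp
  map_add' a b := by
    ext i j
    by_cases h : i = j <;> simp [h, Matrix.diagonal]
  map_mul' a b := by
    exact (Matrix.diagonal_mul_diagonal (fun _ : Fin N => a) (fun _ => b)).symm
  map_star' a := (Matrix.diagonal_conjTranspose (fun _ : Fin N => a)).symm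

lemma dg_eq_sum (a : A) : dg N A a = ∑ y, sgl y y a :=
  (Matrix.sum_single_eq_diagonal (fun _ : Fin N => a)).symm

/-- `dg` as a linear map -/
def dgl (N : ℕ) (A : Type*) [NonUnitalCStarAlgebra A] [PartialOrder A] [StarOrderedRing A] :
    A →ₗ[ℂ] CStarMatrix (Fin N) (Fin N) A where
  toFun a := dg N A a
  map_add' a b := map_add _ a b
  map_smul' c a := map_smul (dg N A) c a

/-- matrices over an ideal -/
def matI (N : ℕ) (J : Submodule ℂ A) : Submodule ℂ (CStarMatrix (Fin N) (Fin N) A) where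
  carrier := {X | ∀ y x, X y x ∈ J}
  zero_mem' := fun y x => J.zero_mem
  add_mem' := fun h h' y x => J.add_mem (h y x) (h' y x)
  smul_mem' := fun c _ h y x => J.smul_mem c (h y x)

lemma matI_si {J : Submodule ℂ A} (hJ : IsSI J) : IsSI (matI N J) := by
  refine ⟨fun m X hX y x => ?_, fun m X hX y x => ?_, fun X hX y x => ?_⟩
  · rw [CStarMatrix.mul_apply]
    exact J.sum_mem fun i _ => hJ.mul_left _ _ (hX _ _)
  · rw [CStarMatrix.mul_apply]
    exact J.sum_mem fun i _ => hJ.mul_right _ _ (hX _ _)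
  · exact hJ.star _ (hX x y)

lemma good_dg {J : Submodule ℂ A} {f : CStarMatrix (Fin N) (Fin N) A →ₗ[ℂ] ℂ}
    (hf : Good f (matI N J)) : Good (f.comp (dgl N A)) J := by
  refine ⟨fun x => (hf.1 _).trans ?_, fun x => ?_, fun x hx => hf.2.2 _ ?_⟩
  · have : ‖dg N A x‖ ≤ ‖x‖ := NonUnitalStarAlgHom.norm_apply_le (dg N A) x
    change 80000 * ‖dg N A x‖ ≤ _
    linarith
  · have := hf.2.1 (dg N A x)
    rw [← map_star, ← map_mul] at this
    exact this
  · intro y x'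
    change Matrix.diagonal (fun _ => x) y x' ∈ J
    by_cases h : y = x' <;> simp [h, hx]

lemma fib_le {φ : Fin N → ℝ} (hφ : ∀ y, 0 ≤ φ y) (y : Fin N → Fin N) {m : ℕ}
    (hm : ∀ z, (Finset.univ.filter fun t => y t = z).card ≤ m) :
    ∑ t, φ (y t) ≤ m * ∑ z, φ z := by
  rw [← Finset.sum_fiberwise (s := Finset.univ) (g := y), Finset.mul_sum]
  refine Finset.sum_le_sum fun z _ => ?_
  rw [Finset.sum_congr rfl (g := fun _ => φ z)
    (fun t ht => by rw [(Finset.mem_filter.1 ht).2]), Finset.sum_const, nsmul_eq_mul]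
  exact mul_le_mul_of_nonneg_right (by exact_mod_cast hm z) (hφ z)

lemma sum_sgl {J : Submodule ℂ A} {f : CStarMatrix (Fin N) (Fin N) A →ₗ[ℂ] ℂ}
    (hf : Good f (matI N J)) (y : Fin N → Fin N) {m : ℕ}
    (hm : ∀ z, (Finset.univ.filter fun t => y t = z).card ≤ m) (a : A) :
    ∑ t, (f (sgl (y t) (y t) (star a * a))).re ≤ m * (f.comp (dgl N A) (star a * a)).re := by
  have h0 : ∀ z, 0 ≤ (f (sgl z z (star a * a))).re := by
    intro z
    have := (hf.2.1 (sgl z z a)).1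
    rwa [sgl_star, sgl_mul] at this
  refine (fib_le h0 y hm).trans (le_of_eq ?_)
  rw [LinearMap.comp_apply]
  change _ = m * (f (dg N A _)).re
  rw [dg_eq_sum, map_sum, Complex.re_sum]

end mat

section
variable {A B : Type*} [NonUnitalCStarAlgebra A] [PartialOrder A] [StarOrderedRing A]
  [NonUnitalCStarAlgebra B] [PartialOrder B] [StarOrderedRing B] {N : ℕ}

lemma osgt_fin (s : Fin N → ℝ) (hs : ∀ i, 0 ≤ s i)
    {u : A →ₗ[ℂ] B →ₗ[ℂ] ℂ}
    (hu : ∀ (X : CStarMatrix (Fin N) (Fin N) A) (Y : CStarMatrix (Fin N) (Fin N) B),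
      ‖∑ y, ∑ x, ((s y * s x : ℝ) : ℂ) * u (X y x) (Y y x)‖ ≤ ‖X‖ * ‖Y‖)
    {J : Submodule ℂ A} {J' : Submodule ℂ B} (hJ : IsSI J) (hJ' : IsSI J')
    (uJ : ∀ x ∈ J, ∀ y, u x y = 0) (uJ' : ∀ x, ∀ y ∈ J', u x y = 0) :
    ∃ (f₁ f₂ : A →ₗ[ℂ] ℂ) (g₁ g₂ : B →ₗ[ℂ] ℂ), Good f₁ J ∧ Good f₂ J ∧ Good g₁ J' ∧ Good g₂ J' ∧
      ∀ (y x : Fin N → Fin N) (m₁ m₂ : ℕ)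
        (_ : ∀ z, (Finset.univ.filter fun t => y t = z).card ≤ m₁)
        (_ : ∀ z, (Finset.univ.filter fun t => x t = z).card ≤ m₂) (a : A) (b : B),
        (∑ t, s (y t) * s (x t)) * ‖u a b‖ ≤ 4 * ((m₁ * (f₁ (a * star a)).re +
          m₂ * (f₂ (star a * a)).re) +
          (m₁ * (g₁ (b * star b)).re + m₂ * (g₂ (star b * b)).re)) := by
  let v : CStarMatrix (Fin N) (Fin N) A →ₗ[ℂ] CStarMatrix (Fin N) (Fin N) B →ₗ[ℂ] ℂ :=
    ∑ y, ∑ x, ((s y * s x : ℝ) : ℂ) • u.compl₁₂ (ent y x) (ent y x)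
  have hv : ∀ X Y, v X Y = ∑ y, ∑ x, ((s y * s x : ℝ) : ℂ) * u (X y x) (Y y x) := by
    intro X Y
    simp only [v, LinearMap.sum_apply, LinearMap.smul_apply, smul_eq_mul]
    rfl
  obtain ⟨f₁, f₂, g₁, g₂, F1, F2, G1, G2, h⟩ := GT_nonunital (u := v)
    (fun X Y => by rw [hv]; exact hu X Y) (matI_si hJ) (matI_si hJ')
    (fun X hX Y => by
      rw [hv]; exact Finset.sum_eq_zero fun y _ => Finset.sum_eq_zero fun x _ => by
        rw [uJ _ (hX y x), mul_zero])
    (fun X Y hY => by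
      rw [hv]; exact Finset.sum_eq_zero fun y _ => Finset.sum_eq_zero fun x _ => by
        rw [uJ' _ _ (hY y x), mul_zero])
  refine ⟨f₁.comp (dgl N A), f₂.comp (dgl N A), g₁.comp (dgl N B), g₂.comp (dgl N B),
    good_dg F1, good_dg F2, good_dg G1, good_dg G2, ?_⟩
  intro y x m₁ m₂ h₁ h₂ a b
  have key : ∀ t, s (y t) * s (x t) * ‖u a b‖ ≤ 4 * (((f₁ (sgl (y t) (y t) (a * star a))).re +
          (f₂ (sgl (x t) (x t) (star a * a))).re) +
          ((g₁ (sgl (y t) (y t) (b * star b))).re + (g₂ (sgl (x t) (x t) (star b * b))).re)) := by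
    intro t
    have := h (sgl (y t) (x t) a) (sgl (y t) (x t) b)
    rw [hv, Finset.sum_eq_single (y t), Finset.sum_eq_single (x t)] at this
    · simp only [sgl_apply, and_self, if_true, norm_mul, Complex.norm_real, sgl_star, sgl_mul]
        at this
      rw [Real.norm_of_nonneg (hs _), Real.norm_of_nonneg (hs _)] at this
      exact this
    · intro z _ hz; simp [sgl_apply, hz.symm]
    · simp
    · intro z _ hz; simp [sgl_apply, hz.symm]
    · simp
  have k1 := sum_sgl F1 y h₁ (star a)
  have k2 := sum_sgl F2 x h₂ a
  have k3 := sum_sgl G1 y h₁ (star b)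
  have k4 := sum_sgl G2 x h₂ b
  rw [star_star] at k1 k3
  rw [Finset.sum_mul]
  refine (Finset.sum_le_sum fun t _ => key t).trans ?_
  rw [← Finset.mul_sum, Finset.sum_add_distrib, Finset.sum_add_distrib, Finset.sum_add_distrib]
  linarith

end
end GT

namespace GT
open Filter Topology

/-- harmonic numbers -/
def HH (N : ℕ) : ℝ := ∑ i ∈ Finset.range N, 1 / ((i : ℝ) + 1)

lemma HH_pos {N : ℕ} (hN : 0 < N) : 0 < HH N :=
  Finset.sum_pos (fun i _ => by positivity) ⟨0, Finset.mem_range.2 hN⟩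

lemma HH_shift (N m : ℕ) : HH N - m ≤ ∑ t ∈ Finset.range N, 1 / ((t : ℝ) + m + 1) := by
  induction m with
  | zero => simp [HH]
  | succ m ih =>
    have h1 := Finset.sum_range_succ (fun t : ℕ => 1 / ((t : ℝ) + m + 1)) N
    have h2 := Finset.sum_range_succ' (fun t : ℕ => 1 / ((t : ℝ) + m + 1)) N
    have h3 : ∀ t : ℕ, 1 / (((t + 1 : ℕ) : ℝ) + m + 1) = 1 / ((t : ℝ) + (m + 1 : ℕ) + 1) := by
      intro t; push_cast; ring_nf
    simp only [h3] at h2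
    have h4 : 0 ≤ 1 / ((N : ℝ) + m + 1) := by positivity
    have h5 : 1 / (((0 : ℕ) : ℝ) + m + 1) ≤ 1 := by
      rw [div_le_one (by positivity)]; push_cast; linarith [(Nat.cast_nonneg m : (0 : ℝ) ≤ m)]
    push_cast at *
    linarith

/-- the weights -/
def sw (N : ℕ) (i : Fin N) : ℝ := √(1 / (((i : ℕ) : ℝ) + 1) / HH N)

lemma sw_sum (N : ℕ) : ∑ i, sw N i ^ 2 ≤ 1 := by
  rcases Nat.eq_zero_or_pos N with rfl | hN
  · simp
  have h := HH_pos hN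
  have : ∀ i : Fin N, sw N i ^ 2 = 1 / (((i : ℕ) : ℝ) + 1) / HH N := fun i => by
    rw [sw, Real.sq_sqrt (by positivity)]
  simp only [this]
  rw [Fin.sum_univ_eq_sum_range (fun i : ℕ => 1 / ((i : ℝ) + 1) / HH N) N, ← Finset.sum_div]
  exact (div_self h.ne').le

/-- division map -/
def dv (N m : ℕ) (t : Fin N) : Fin N := ⟨t / (m + 1), (Nat.div_le_self _ _).trans_lt t.2⟩

lemma dv_fib (N m : ℕ) (z : Fin N) : (Finset.univ.filter fun t => dv N m t = z).card ≤ m + 1 := by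
  rw [← Finset.card_range (m + 1)]
  refine Finset.card_le_card_of_injOn (fun t => (t : ℕ) % (m + 1)) (fun t _ => ?_) ?_
  · simpa using Nat.mod_lt _ (Nat.succ_pos m)
  · intro t ht t' ht' h
    simp only [Finset.coe_filter, Finset.mem_univ, true_and, Set.mem_ofPred_eq] at ht ht'
    have h1 : (t : ℕ) / (m + 1) = t' / (m + 1) := congrArg Fin.val (ht.trans ht'.symm)
    apply Fin.ext
    rw [← Nat.div_add_mod (t : ℕ) (m + 1), ← Nat.div_add_mod (t' : ℕ) (m + 1), h1]
    simp only at h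
    rw [h]

lemma sw_ge {N : ℕ} (hN : 0 < N) (m : ℕ) :
    √((m : ℝ) + 1) * (1 - m / HH N) ≤ ∑ t, sw N (dv N m t) * sw N t := by
  have hH := HH_pos hN
  have key : ∀ t : Fin N, √((m : ℝ) + 1) / HH N * (1 / (((t : ℕ) : ℝ) + m + 1)) ≤
      sw N (dv N m t) * sw N t := by
    intro t
    rw [sw, sw, ← Real.sqrt_mul (by positivity)]
    apply Real.le_sqrt_of_sq_le
    rw [mul_pow, div_pow, Real.sq_sqrt (by positivity)]
    have h1 : (((dv N m t : Fin N) : ℕ) : ℝ) * (m + 1) ≤ ((t : ℕ) : ℝ) := by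
      exact_mod_cast Nat.div_mul_le_self t (m + 1)
    set y : ℝ := (((dv N m t : Fin N) : ℕ) : ℝ)
    have hy : 0 ≤ y := Nat.cast_nonneg _
    set x : ℝ := ((t : ℕ) : ℝ)
    have hx : 0 ≤ x := Nat.cast_nonneg _
    have hm : (0 : ℝ) ≤ m := Nat.cast_nonneg _
    have e1 : ((m : ℝ) + 1) / HH N ^ 2 * (1 / (x + m + 1)) ^ 2 =
      (1 / HH N ^ 2) * ((m + 1) / (x + m + 1) ^ 2) := by field_simp
    have e2 : 1 / (y + 1) / HH N * (1 / (x + 1) / HH N) =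
      (1 / HH N ^ 2) * (1 / ((y + 1) * (x + 1))) := by field_simp
    rw [e1, e2]
    refine mul_le_mul_of_nonneg_left ?_ (by positivity)
    rw [div_le_div_iff₀ (by positivity) (by positivity)]
    have a1 : (m + 1) * (y + 1) ≤ x + m + 1 := by linarith
    have a2 : x + 1 ≤ x + m + 1 := by linarith
    calc ((m : ℝ) + 1) * ((y + 1) * (x + 1)) = ((m + 1) * (y + 1)) * (x + 1) := by ring
      _ ≤ (x + m + 1) * (x + m + 1) := by gcongr
      _ = _ := by ring
  refine le_trans ?_ (Finset.sum_le_sum fun t _ => key t)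
  rw [← Finset.mul_sum, Fin.sum_univ_eq_sum_range (fun t : ℕ => 1 / ((t : ℝ) + m + 1)) N]
  have := HH_shift N m
  rw [div_mul_eq_mul_div, mul_div_assoc]
  refine mul_le_mul_of_nonneg_left ?_ (by positivity)
  rw [one_sub_div hH.ne']
  gcongr

section
variable {A B : Type*} [NonUnitalCStarAlgebra A] [PartialOrder A] [StarOrderedRing A]
  [NonUnitalCStarAlgebra B] [PartialOrder B] [StarOrderedRing B]

lemma posF_re {M : Type*} [NonUnitalCStarAlgebra M] {J : Submodule ℂ M} {f : M →ₗ[ℂ] ℂ}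
    (h : Good f J) (x : M) : 0 ≤ (f (star x * x)).re := (h.2.1 x).1

lemma posF_re' {M : Type*} [NonUnitalCStarAlgebra M] {J : Submodule ℂ M} {f : M →ₗ[ℂ] ℂ}
    (h : Good f J) (x : M) : 0 ≤ (f (x * star x)).re := by
  have := posF_re h (star x); rwa [star_star] at this

lemma scl {M : Type*} [NonUnitalCStarAlgebra M] (f : M →ₗ[ℂ] ℂ) (c : ℝ) (x : M) :
    (f (star ((c : ℂ) • x) * ((c : ℂ) • x))).re = c ^ 2 * (f (star x * x)).re := by
  rw [star_smul, smul_mul_smul_comm, map_smul]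
  simp [pow_two]

lemma scl' {M : Type*} [NonUnitalCStarAlgebra M] (f : M →ₗ[ℂ] ℂ) (c : ℝ) (x : M) :
    (f (((c : ℂ) • x) * star ((c : ℂ) • x))).re = c ^ 2 * (f (x * star x)).re := by
  rw [star_smul, smul_mul_smul_comm, map_smul]
  simp [pow_two]

theorem osgt {u : A →ₗ[ℂ] B →ₗ[ℂ] ℂ}
    (hu : ∀ (N : ℕ) (s : Fin N → ℝ), (∀ i, 0 ≤ s i) → ∑ i, s i ^ 2 ≤ 1 →
      ∀ (X : CStarMatrix (Fin N) (Fin N) A) (Y : CStarMatrix (Fin N) (Fin N) B),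
      ‖∑ y, ∑ x, ((s y * s x : ℝ) : ℂ) * u (X y x) (Y y x)‖ ≤ ‖X‖ * ‖Y‖)
    {J : Submodule ℂ A} {J' : Submodule ℂ B} (hJ : IsSI J) (hJ' : IsSI J')
    (uJ : ∀ x ∈ J, ∀ y, u x y = 0) (uJ' : ∀ x, ∀ y ∈ J', u x y = 0) :
    ∃ (f₁ f₂ : A →ₗ[ℂ] ℂ) (g₁ g₂ : B →ₗ[ℂ] ℂ), Good f₁ J ∧ Good f₂ J ∧ Good g₁ J' ∧ Good g₂ J' ∧
      ∀ (r : ℝ) (_ : 0 < r) (a : A) (b : B),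
        ‖u a b‖ ≤ 8 * (((f₁ (a * star a)).re + r * (f₂ (star a * a)).re) +
          (r⁻¹ * (g₁ (b * star b)).re + (g₂ (star b * b)).re)) := by
  choose f₁ f₂ g₁ g₂ F1 F2 G1 G2 h using fun N : ℕ => osgt_fin (sw N) (fun i => Real.sqrt_nonneg _)
    (hu N (sw N) (fun i => Real.sqrt_nonneg _) (sw_sum N)) hJ hJ' uJ uJ'
  let l : Ultrafilter ℕ := Filter.hyperfilter ℕ
  have hl : (l : Filter ℕ) ≤ atTop := by
    rw [← Nat.cofinite_eq_atTop]; exact Filter.hyperfilter_le_cofinite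
  obtain ⟨φ₁, h1⟩ := ulim_exists l f₁ (fun x => ⟨_, fun i => (F1 i).1 x⟩)
  obtain ⟨φ₂, h2⟩ := ulim_exists l f₂ (fun x => ⟨_, fun i => (F2 i).1 x⟩)
  obtain ⟨ψ₁, k1⟩ := ulim_exists l g₁ (fun x => ⟨_, fun i => (G1 i).1 x⟩)
  obtain ⟨ψ₂, k2⟩ := ulim_exists l g₂ (fun x => ⟨_, fun i => (G2 i).1 x⟩)
  have P1 : Good φ₁ J := ⟨fun x => tendsto_norm_le (h1 x) (fun i => (F1 i).1 x),
      posF_lim h1 (fun i => (F1 i).2.1), fun x hx => eq_zero_lim (h1 x) fun i => (F1 i).2.2 x hx⟩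
  have P2 : Good φ₂ J := ⟨fun x => tendsto_norm_le (h2 x) (fun i => (F2 i).1 x),
      posF_lim h2 (fun i => (F2 i).2.1), fun x hx => eq_zero_lim (h2 x) fun i => (F2 i).2.2 x hx⟩
  have Q1 : Good ψ₁ J' := ⟨fun x => tendsto_norm_le (k1 x) (fun i => (G1 i).1 x),
      posF_lim k1 (fun i => (G1 i).2.1), fun x hx => eq_zero_lim (k1 x) fun i => (G1 i).2.2 x hx⟩
  have Q2 : Good ψ₂ J' := ⟨fun x => tendsto_norm_le (k2 x) (fun i => (G2 i).1 x),
      posF_lim k2 (fun i => (G2 i).2.1), fun x hx => eq_zero_lim (k2 x) fun i => (G2 i).2.2 x hx⟩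
  have hre : ∀ {f : ℕ → ℂ} {z : ℂ}, Tendsto f l (𝓝 z) → Tendsto (fun n => (f n).re) l (𝓝 z.re) :=
    fun h => (Complex.continuous_re.tendsto _).comp h
  have hH : Tendsto HH atTop atTop := by
    have := Real.tendsto_sum_range_one_div_nat_succ_atTop
    exact this
  have lim : ∀ (m₁ m₂ : ℕ) (a : A) (b : B) (m : ℕ),
      (∀ N, 0 < N → √((m : ℝ) + 1) * (1 - m / HH N) * ‖u a b‖ ≤
        4 * ((m₁ * (f₁ N (a * star a)).re + m₂ * (f₂ N (star a * a)).re) +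
          (m₁ * (g₁ N (b * star b)).re + m₂ * (g₂ N (star b * b)).re))) →
      √((m : ℝ) + 1) * ‖u a b‖ ≤ 4 * ((m₁ * (φ₁ (a * star a)).re + m₂ * (φ₂ (star a * a)).re) +
          (m₁ * (ψ₁ (b * star b)).re + m₂ * (ψ₂ (star b * b)).re)) := by
    intro m₁ m₂ a b m hyp
    have t0 : Tendsto (fun N => √((m : ℝ) + 1) * (1 - m / HH N) * ‖u a b‖) l
        (𝓝 (√((m : ℝ) + 1) * (1 - 0) * ‖u a b‖)) := by
      have := (tendsto_const_nhds (x := (m : ℝ))).div_atTop hH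
      exact ((this.const_sub 1).const_mul _ |>.mul_const _).mono_left hl
    have t1 := ((((hre (h1 (a * star a))).const_mul (m₁ : ℝ)).add
      ((hre (h2 (star a * a))).const_mul (m₂ : ℝ))).add
      (((hre (k1 (b * star b))).const_mul (m₁ : ℝ)).add
        ((hre (k2 (star b * b))).const_mul (m₂ : ℝ)))).const_mul 4
    have := le_of_tendsto_of_tendsto t0 t1 (hl (eventually_gt_atTop 0 |>.mono fun N hN => hyp N hN))
    simpa using this
  have id_fib : ∀ (N : ℕ) (z : Fin N), (Finset.univ.filter fun t => id t = z).card ≤ 1 := by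
    intro N z; exact Finset.card_le_one.2 fun x hx y hy => by
      simp only [id, Finset.mem_filter, Finset.mem_univ, true_and] at hx hy; rw [hx, hy]
  have D1 : ∀ (m : ℕ) a b, √((m : ℝ) + 1) * ‖u a b‖ ≤ 4 * (((m + 1 : ℝ) * (φ₁ (a * star a)).re +
      (φ₂ (star a * a)).re) + ((m + 1 : ℝ) * (ψ₁ (b * star b)).re + (ψ₂ (star b * b)).re)) := by
    intro m a b
    have := lim (m + 1) 1 a b m (fun N hN => by
      refine le_trans ?_ (h N (dv N m) id (m + 1) 1 (dv_fib N m) (id_fib N) a b)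
      exact mul_le_mul_of_nonneg_right (sw_ge hN m) (norm_nonneg _))
    push_cast at this
    simpa using this
  have D2 : ∀ (m : ℕ) a b, √((m : ℝ) + 1) * ‖u a b‖ ≤ 4 * (((φ₁ (a * star a)).re +
      (m + 1 : ℝ) * (φ₂ (star a * a)).re) +
      ((ψ₁ (b * star b)).re + (m + 1 : ℝ) * (ψ₂ (star b * b)).re)) := by
    intro m a b
    have := lim 1 (m + 1) a b m (fun N hN => by
      refine le_trans ?_ (h N id (dv N m) 1 (m + 1) (id_fib N) (dv_fib N m) a b)
      refine mul_le_mul_of_nonneg_right ((sw_ge hN m).trans (le_of_eq ?_)) (norm_nonneg _)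
      exact Finset.sum_congr rfl fun t _ => mul_comm _ _)
    push_cast at this
    simpa using this
  have usc : ∀ (c : ℝ), 0 < c → ∀ a b, u ((c : ℂ) • a) (((c⁻¹ : ℝ) : ℂ) • b) = u a b := by
    intro c hc a b
    rw [map_smul, map_smul, LinearMap.smul_apply, smul_smul, ← Complex.ofReal_mul,
      inv_mul_cancel₀ hc.ne']
    simp
  refine ⟨φ₁, φ₂, ψ₁, ψ₂, P1, P2, Q1, Q2, fun r hr a b => ?_⟩
  have p1 := posF_re' P1 a
  have p2 := posF_re P2 a
  have q1 := posF_re' Q1 b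
  have q2 := posF_re Q2 b
  set x1 := (φ₁ (a * star a)).re
  set x2 := (φ₂ (star a * a)).re
  set y1 := (ψ₁ (b * star b)).re
  set y2 := (ψ₂ (star b * b)).re
  have E1 : ∀ m : ℕ, ‖u a b‖ ≤ 4 * ((x1 + x2 / (m + 1)) + ((m + 1) * y1 + y2)) := by
    intro m
    set M : ℝ := (m : ℝ) + 1 with hM
    have hM0 : 0 < M := by positivity
    have hs : 0 < √M := Real.sqrt_pos.2 hM0
    have hss : √M * √M = M := Real.mul_self_sqrt hM0.le
    set c := √((√M)⁻¹) with hc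
    have c0 : 0 < c := Real.sqrt_pos.2 (inv_pos.2 hs)
    have c2 : c ^ 2 = (√M)⁻¹ := Real.sq_sqrt (inv_pos.2 hs).le
    have := D1 m ((c : ℂ) • a) (((c⁻¹ : ℝ) : ℂ) • b)
    rw [usc c c0, scl, scl, scl', scl', inv_pow, c2, inv_inv, ← hM] at this
    rw [← mul_le_mul_iff_right₀ hs]
    refine this.trans (le_of_eq ?_)
    have : M * (√M)⁻¹ = √M := by nth_rewrite 1 [← hss]; field_simp
    have : √M / M = (√M)⁻¹ := by nth_rewrite 2 [← hss]; field_simp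
    rw [show √M * (4 * (x1 + x2 / M + (M * y1 + y2))) = 4 * (√M * x1 + (√M / M) * x2 + (M * (√M * y1)
      + √M * y2)) by ring, this]
    rw [← mul_assoc M (√M)⁻¹, ‹M * (√M)⁻¹ = √M›]
  have E2 : ∀ m : ℕ, ‖u a b‖ ≤ 4 * ((x1 + (m + 1) * x2) + (y1 / (m + 1) + y2)) := by
    intro m
    set M : ℝ := (m : ℝ) + 1 with hM
    have hM0 : 0 < M := by positivity
    have hs : 0 < √M := Real.sqrt_pos.2 hM0
    have hss : √M * √M = M := Real.mul_self_sqrt hM0.le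
    set c := √(√M) with hc
    have c0 : 0 < c := Real.sqrt_pos.2 hs
    have c2 : c ^ 2 = √M := Real.sq_sqrt hs.le
    have := D2 m ((c : ℂ) • a) (((c⁻¹ : ℝ) : ℂ) • b)
    rw [usc c c0, scl, scl, scl', scl', inv_pow, c2, ← hM] at this
    rw [← mul_le_mul_iff_right₀ hs]
    refine this.trans (le_of_eq ?_)
    have : M * (√M)⁻¹ = √M := by nth_rewrite 1 [← hss]; field_simp
    have : √M / M = (√M)⁻¹ := by nth_rewrite 2 [← hss]; field_simp
    rw [show √M * (4 * (x1 + M * x2 + (y1 / M + y2))) = 4 * (√M * x1 + M * (√M * x2) + ((√M / M) * y1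
      + √M * y2)) by ring, this]
    rw [← mul_assoc M (√M)⁻¹, ‹M * (√M)⁻¹ = √M›]
  have fl : ∀ r : ℝ, 1 ≤ r → ∃ m : ℕ, (m : ℝ) + 1 ≤ r ∧ r ≤ 2 * ((m : ℝ) + 1) := by
    intro r hr
    refine ⟨⌊r⌋₊ - 1, ?_⟩
    have h1 : 1 ≤ ⌊r⌋₊ := Nat.one_le_floor_iff r |>.2 hr
    rw [Nat.cast_sub h1, Nat.cast_one, sub_add_cancel]
    have h2 : (1 : ℝ) ≤ ⌊r⌋₊ := by exact_mod_cast h1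
    exact ⟨Nat.floor_le (by linarith), by linarith [Nat.lt_floor_add_one r]⟩
  rcases le_total 1 r with hr1 | hr1
  · obtain ⟨m, hm1, hm2⟩ := fl r hr1
    refine (E2 m).trans ?_
    have a1 : ((m : ℝ) + 1) * x2 ≤ r * x2 := by gcongr
    have a2 : y1 / ((m : ℝ) + 1) ≤ 2 * (r⁻¹ * y1) := by
      rw [div_le_iff₀ (by positivity)]
      have : 1 ≤ 2 * (r⁻¹) * ((m : ℝ) + 1) := by
        rw [mul_right_comm, ← div_eq_mul_inv, le_div_iff₀ hr]; linarith
      nlinarith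
    have : 0 ≤ r * x2 := by positivity
    linarith
  · obtain ⟨m, hm1, hm2⟩ := fl r⁻¹ ((one_le_inv₀ hr).2 hr1)
    refine (E1 m).trans ?_
    have a1 : ((m : ℝ) + 1) * y1 ≤ r⁻¹ * y1 := by gcongr
    have a2 : x2 / ((m : ℝ) + 1) ≤ 2 * (r * x2) := by
      rw [div_le_iff₀ (by positivity)]
      have : 1 ≤ 2 * r * ((m : ℝ) + 1) := by
        rw [inv_le_iff_one_le_mul₀ hr] at hm2; linarith
      nlinarith
    have : 0 ≤ r⁻¹ * y1 := by positivity
    linarith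

end
end GT

namespace GT
open Filter Topology

section P10
open Matrix
open scoped ComplexOrder

/-- unitary diagonalisation -/
lemma udiag {I : Type*} [Fintype I] [DecidableEq I] {G : Matrix I I ℂ} (hG : G.IsHermitian) :
    ∃ U : Matrix I I ℂ, Uᴴ * U = 1 ∧ U * Uᴴ = 1 ∧
      Uᴴ * G * U = diagonal (fun i => ((hG.eigenvalues i : ℝ) : ℂ)) := by
  refine ⟨hG.eigenvectorUnitary.1, ?_, ?_, ?_⟩
  · exact Unitary.star_mul_self_of_mem hG.eigenvectorUnitary.2
  · exact Unitary.mul_star_self_of_mem hG.eigenvectorUnitary.2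
  · have h := hG.spectral_theorem
    rw [Unitary.conjStarAlgAut_apply] at h
    set U : Matrix I I ℂ := hG.eigenvectorUnitary.1 with hU
    have h1 : Uᴴ * U = 1 := Unitary.star_mul_self_of_mem hG.eigenvectorUnitary.2
    have h3 : G = U * diagonal (fun i => ((hG.eigenvalues i : ℝ) : ℂ)) * Uᴴ := h
    calc Uᴴ * G * U = Uᴴ * (U * diagonal (fun i => ((hG.eigenvalues i : ℝ) : ℂ)) * Uᴴ) * U := by
          rw [← h3]
      _ = (Uᴴ * U) * diagonal (fun i => ((hG.eigenvalues i : ℝ) : ℂ)) * (Uᴴ * U) := by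
          simp only [mul_assoc]
      _ = _ := by rw [h1, one_mul, mul_one]

lemma simdiag {I : Type*} [Fintype I] [DecidableEq I] {G₁ G₂ : Matrix I I ℂ}
    (h₁ : G₁.PosDef) (h₂ : G₂.PosDef) :
    ∃ (L L' : Matrix I I ℂ) (d : I → ℝ), L * L' = 1 ∧ L' * L = 1 ∧ (∀ i, 0 < d i) ∧
      Lᴴ * G₁ * L = 1 ∧ Lᴴ * G₂ * L = diagonal (fun i => ((d i : ℝ) : ℂ)) := by
  obtain ⟨U, hU1, hU2, hU3⟩ := udiag h₁.isHermitian
  set e := h₁.isHermitian.eigenvalues with he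
  have ep : ∀ i, 0 < e i := fun i => h₁.eigenvalues_pos i
  set D : Matrix I I ℂ := diagonal (fun i => (((√(e i))⁻¹ : ℝ) : ℂ)) with hD
  set D' : Matrix I I ℂ := diagonal (fun i => ((√(e i) : ℝ) : ℂ)) with hD'
  have DD : D * D' = 1 := by
    rw [hD, hD', diagonal_mul_diagonal, ← diagonal_one]
    congr 1; ext i
    rw [← Complex.ofReal_mul, inv_mul_cancel₀ (Real.sqrt_pos.2 (ep i)).ne']; simp
  have DD' : D' * D = 1 := by
    rw [hD, hD', diagonal_mul_diagonal, ← diagonal_one]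
    congr 1; ext i
    rw [← Complex.ofReal_mul, mul_inv_cancel₀ (Real.sqrt_pos.2 (ep i)).ne']; simp
  have Dh : Dᴴ = D := by
    rw [hD, diagonal_conjTranspose]; congr 1; ext i; simp
  set L0 := U * D with hL0
  have a1 : L0ᴴ * G₁ * L0 = 1 := by
    rw [hL0, conjTranspose_mul, Dh]
    calc D * Uᴴ * G₁ * (U * D) = D * (Uᴴ * G₁ * U) * D := by simp only [mul_assoc]
      _ = 1 := by
        rw [hU3, hD, diagonal_mul_diagonal, diagonal_mul_diagonal, ← diagonal_one]
        congr 1; ext i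
        rw [← Complex.ofReal_mul, ← Complex.ofReal_mul]
        have : (√(e i))⁻¹ * e i * (√(e i))⁻¹ = 1 := by
          have h1 := Real.mul_self_sqrt (ep i).le
          have h2 := (Real.sqrt_pos.2 (ep i)).ne'
          field_simp; nlinarith
        rw [this]; simp
  have a2 : L0 * (D' * Uᴴ) = 1 := by
    rw [hL0, mul_assoc, ← mul_assoc D, DD, one_mul, hU2]
  have a3 : (D' * Uᴴ) * L0 = 1 := by
    rw [hL0, mul_assoc, ← mul_assoc Uᴴ, hU1, one_mul, DD']
  have b1 : (L0ᴴ * G₂ * L0).PosDef := by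
    refine h₂.conjTranspose_mul_mul_same ?_
    intro x y hxy
    have := congrArg ((D' * Uᴴ) *ᵥ ·) hxy
    simpa [mulVec_mulVec, a3] using this
  obtain ⟨W, hW1, hW2, hW3⟩ := udiag b1.isHermitian
  refine ⟨L0 * W, Wᴴ * (D' * Uᴴ), b1.isHermitian.eigenvalues, ?_, ?_, fun i => b1.eigenvalues_pos i,
    ?_, ?_⟩
  · rw [mul_assoc, ← mul_assoc W, hW2, one_mul, a2]
  · rw [mul_assoc, ← mul_assoc _ L0, a3, one_mul, hW1]
  · rw [conjTranspose_mul]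
    calc Wᴴ * L0ᴴ * G₁ * (L0 * W) = Wᴴ * (L0ᴴ * G₁ * L0) * W := by simp only [mul_assoc]
      _ = 1 := by rw [a1, mul_one, hW1]
  · rw [← hW3, conjTranspose_mul]; simp only [mul_assoc]

variable {V : Type*} [AddCommGroup V] [Module ℂ V]

structure PSD (S : V →ₗ[ℂ] V →ₗ⋆[ℂ] ℂ) : Prop where
  nonneg : ∀ x, 0 ≤ (S x x).re
  im : ∀ x, (S x x).im = 0

namespace PSD
variable {S : V →ₗ[ℂ] V →ₗ⋆[ℂ] ℂ}

lemma herm (h : PSD S) (x y : V) : (starRingEnd ℂ) (S x y) = S y x := by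
  have h1 := h.im (x + y)
  have h2 := h.im (x + Complex.I • y)
  have hx := h.im x
  have hy := h.im y
  simp only [map_add, map_smul, LinearMap.add_apply, LinearMap.smul_apply, map_smulₛₗ,
    Complex.conj_I, smul_eq_mul, Complex.add_im, Complex.mul_im, Complex.mul_re, Complex.neg_im,
    Complex.neg_re, Complex.I_re, Complex.I_im, Complex.add_re] at h1 h2
  apply Complex.ext
  · rw [Complex.conj_re]; linarith
  · rw [Complex.conj_im]; linarith

lemma cs (h : PSD S) (x y : V) : ‖S x y‖ ^ 2 ≤ (S x x).re * (S y y).re := by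
  let c : PreInnerProductSpace.Core ℂ V :=
    { inner := fun a b => S b a
      conj_inner_symm := fun a b => h.herm a b
      re_inner_nonneg := fun a => h.nonneg a
      add_left := fun a b c => by simp
      smul_left := fun a b r => by simp }
  have := InnerProductSpace.Core.inner_mul_inner_self_le (𝕜 := ℂ) (c := c) x y
  have h2 : ‖S y x‖ * ‖S x y‖ ≤ (S x x).re * (S y y).re := this
  have h3 : ‖S y x‖ = ‖S x y‖ := by rw [← h.herm x y, RCLike.norm_conj]
  rw [h3] at h2
  rw [pow_two]; exact h2

lemma null (h : PSD S) {x : V} (hx : (S x x).re = 0) (y : V) : S x y = 0 := by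
  have := h.cs x y
  rw [hx, zero_mul] at this
  exact norm_eq_zero.1 (by nlinarith [norm_nonneg (S x y)])

lemma diag (h : PSD S) (x : V) : S x x = (((S x x).re : ℝ) : ℂ) := by
  apply Complex.ext <;> simp [h.im]

end PSD

lemma frame {K I : Type*} [Fintype K] [Fintype I] [DecidableEq I]
    (S : V →ₗ[ℂ] V →ₗ⋆[ℂ] ℂ) (Q : Matrix K I ℂ) (d : I → ℂ)
    (hQ : Qᴴ * Q = diagonal d) (a : I → V) :
    ∑ k, S (∑ i, Q k i • a i) (∑ i, Q k i • a i) = ∑ i, d i * S (a i) (a i) := by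
  have hQ' : ∀ i j, ∑ k, (starRingEnd ℂ) (Q k i) * Q k j = if i = j then d i else 0 := by
    intro i j
    have := congrFun (congrFun hQ i) j
    rw [mul_apply, diagonal_apply] at this
    simpa using this
  simp only [map_sum, LinearMap.sum_apply, map_smul, LinearMap.smul_apply, map_smulₛₗ, smul_eq_mul]
  rw [Finset.sum_comm]
  refine Finset.sum_congr rfl fun i _ => ?_
  simp only [Finset.mul_sum]
  rw [Finset.sum_comm]
  calc ∑ j, ∑ k, (starRingEnd ℂ) (Q k i) * (Q k j * S (a j) (a i))
      = ∑ j, (∑ k, (starRingEnd ℂ) (Q k i) * Q k j) * S (a j) (a i) := by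
        refine Finset.sum_congr rfl fun j _ => ?_
        rw [Finset.sum_mul]; simp only [mul_assoc]
    _ = _ := by simp [hQ']

lemma bessel {K I : Type*} [Fintype K] [Fintype I] [DecidableEq I]
    {S : V →ₗ[ℂ] V →ₗ⋆[ℂ] ℂ} (hS : PSD S) (Q : Matrix K I ℂ) (d : I → ℝ)
    (hd : ∀ i, 0 < d i)
    (hQ : Qᴴ * Q = diagonal (fun i => (d i : ℂ))) (b : K → V) :
    ∑ i, (d i)⁻¹ * (S (∑ k, Q k i • b k) (∑ k, Q k i • b k)).re ≤ ∑ k, (S (b k) (b k)).re := by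
  set b' : I → V := fun i => ∑ k, Q k i • b k with hb'
  set P : Matrix K I ℂ := Matrix.of fun k i => ((d i)⁻¹ : ℂ) * (starRingEnd ℂ) (Q k i) with hP
  have hQ' : ∀ i j, ∑ k, (starRingEnd ℂ) (Q k i) * Q k j = if i = j then (d i : ℂ) else 0 := by
    intro i j
    have := congrFun (congrFun hQ i) j
    rw [mul_apply, diagonal_apply] at this
    simpa using this
  have hPP : Pᴴ * P = diagonal (fun i => ((d i)⁻¹ : ℂ)) := by
    ext i j
    rw [mul_apply, diagonal_apply]
    have := hQ' j i
    calc _ = ∑ k, ((d i)⁻¹ : ℂ) * ((d j)⁻¹ : ℂ) * ((starRingEnd ℂ) (Q k j) * Q k i) := by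
          refine Finset.sum_congr rfl fun k _ => ?_
          simp [hP]; ring
      _ = ((d i)⁻¹ : ℂ) * ((d j)⁻¹ : ℂ) * if j = i then (d j : ℂ) else 0 := by
          rw [← Finset.mul_sum, this]
      _ = _ := by
          by_cases hij : i = j
          · subst hij
            have : (d i : ℂ) ≠ 0 := by exact_mod_cast (hd i).ne'
            simp; field_simp
          · simp [hij, Ne.symm hij]
  have F := frame S P _ hPP b'
  have C1 : ∑ k, S (b k) (∑ i, P k i • b' i) = ∑ i, ((d i)⁻¹ : ℂ) * S (b' i) (b' i) := by
    have e : ∀ k, S (b k) (∑ i, P k i • b' i) = ∑ i, ((d i)⁻¹ : ℂ) * (Q k i * S (b k) (b' i)) := by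
      intro k
      simp [map_sum, map_smulₛₗ, hP, mul_assoc]
    simp only [e]
    rw [Finset.sum_comm]
    refine Finset.sum_congr rfl fun i _ => ?_
    rw [← Finset.mul_sum]
    have : ∑ k, Q k i * S (b k) (b' i) = S (∑ k, Q k i • b k) (b' i) := by
      simp [map_sum, LinearMap.sum_apply]
    rw [this]
  have C2 : ∑ k, S (∑ i, P k i • b' i) (b k) = ∑ i, ((d i)⁻¹ : ℂ) * S (b' i) (b' i) := by
    have := congrArg (starRingEnd ℂ) C1
    simpa [map_sum, hS.herm] using this
  have T : ∑ k, S (b k - ∑ i, P k i • b' i) (b k - ∑ i, P k i • b' i)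
      = ∑ k, S (b k) (b k) - ∑ i, ((d i)⁻¹ : ℂ) * S (b' i) (b' i) := by
    have e : ∀ k, S (b k - ∑ i, P k i • b' i) (b k - ∑ i, P k i • b' i)
        = S (b k) (b k) - S (b k) (∑ i, P k i • b' i) - S (∑ i, P k i • b' i) (b k)
          + S (∑ i, P k i • b' i) (∑ i, P k i • b' i) := by
      intro k; simp only [map_sub, LinearMap.sub_apply]; ring
    simp only [e]
    rw [Finset.sum_add_distrib, Finset.sum_sub_distrib, Finset.sum_sub_distrib, C1, C2, F]; ring
  have N : 0 ≤ (∑ k, S (b k - ∑ i, P k i • b' i) (b k - ∑ i, P k i • b' i)).re := by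
    rw [Complex.re_sum]; exact Finset.sum_nonneg fun k _ => hS.nonneg _
  rw [T, Complex.sub_re, Complex.re_sum, Complex.re_sum] at N
  have : ∀ i, (((d i)⁻¹ : ℂ) * S (b' i) (b' i)).re = (d i)⁻¹ * (S (b' i) (b' i)).re := by
    intro i; rw [← Complex.ofReal_inv, Complex.re_ofReal_mul]
  simp only [this] at N
  linarith

end P10
end GT

namespace GT
open Filter Topology

section P11
open Matrix
open scoped ComplexOrder

variable {V W : Type*} [AddCommGroup V] [Module ℂ V] [AddCommGroup W] [Module ℂ W]

lemma tmul_unique {I : Type*} [Fintype I] {y : I → V} (hy : LinearIndependent ℂ y)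
    {x x' : I → W} (h : ∑ i, y i ⊗ₜ[ℂ] x i = ∑ i, y i ⊗ₜ[ℂ] x' i) : x = x' := by
  classical
  funext j
  obtain ⟨f, hf⟩ := LinearMap.exists_extend
    (hy.repr : Submodule.span ℂ (Set.range y) →ₗ[ℂ] (I →₀ ℂ))
  have hfy : ∀ i, f (y i) = Finsupp.single i 1 := by
    intro i
    have h1 : f (y i) = hy.repr ⟨y i, Submodule.subset_span ⟨i, rfl⟩⟩ := by
      have := LinearMap.congr_fun hf ⟨y i, Submodule.subset_span ⟨i, rfl⟩⟩
      simpa using this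
    rw [h1]; exact hy.repr_eq_single i _ rfl
  have h2 := congrArg (TensorProduct.lift
    ((LinearMap.lsmul ℂ W) ∘ₗ (Finsupp.lapply j ∘ₗ f))) h
  simpa [map_sum, hfy, Finsupp.single_apply] using h2

lemma stepS_core {K K' I : Type*} [Fintype K] [Fintype K'] [Fintype I] [DecidableEq I]
    {S₁ S₂ : V →ₗ[ℂ] V →ₗ⋆[ℂ] ℂ} {R₁ R₂ : W →ₗ[ℂ] W →ₗ⋆[ℂ] ℂ}
    (hR₁ : PSD R₁) (hR₂ : PSD R₂)
    (u : V →ₗ[ℂ] W →ₗ[ℂ] ℂ)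
    (hu : ∀ r : ℝ, 0 < r → ∀ a b, ‖u a b‖ ≤ 8 * (((S₁ a a).re + r * (S₂ a a).re)
      + (r⁻¹ * (R₂ b b).re + (R₁ b b).re)))
    {y : I → V} (hy : LinearIndependent ℂ y) (P : Matrix K I ℂ) (P' : Matrix K' I ℂ)
    (hP : (Pᴴ * P).PosDef) (hP' : (P'ᴴ * P').PosDef) (b : K → W) (d : K' → W)
    (t : V ⊗[ℂ] W) (ht : t = ∑ k, (∑ i, P k i • y i) ⊗ₜ[ℂ] b k)
    (ht' : t = ∑ k, (∑ i, P' k i • y i) ⊗ₜ[ℂ] d k) :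
    ‖TensorProduct.lift u t‖ ≤ 8 *
      (∑ k, (S₁ (∑ i, P k i • y i) (∑ i, P k i • y i)).re + ∑ k, (R₁ (b k) (b k)).re
      + (∑ k, (S₂ (∑ i, P' k i • y i) (∑ i, P' k i • y i)).re + ∑ k, (R₂ (d k) (d k)).re)) := by
  obtain ⟨L, L', e, hLL, hLL', ep, h1, h2⟩ := simdiag hP hP'
  have hQ : (P * L)ᴴ * (P * L) = diagonal (fun _ => (((1:ℝ) : ℝ) : ℂ)) := by
    rw [conjTranspose_mul]
    have : (diagonal (fun _ => (((1:ℝ) : ℝ) : ℂ)) : Matrix I I ℂ) = 1 := by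
      simp
    rw [this, ← h1]; simp only [Matrix.mul_assoc]
  have hQ' : (P' * L)ᴴ * (P' * L) = diagonal (fun i => ((e i : ℝ) : ℂ)) := by
    rw [conjTranspose_mul, ← h2]; simp only [Matrix.mul_assoc]
  set a' : I → V := fun i => ∑ j, L' i j • y j with ha'
  have comb : ∀ {J : Type _} (M : Matrix J I ℂ) (k : J),
      ∑ i, (M * L) k i • a' i = ∑ i, M k i • y i := by
    intro J M k
    have : ∑ i, (M * L) k i • a' i = ∑ j, ((M * L) * L') k j • y j := by
      simp only [ha', Finset.smul_sum, smul_smul, Matrix.mul_apply (M := M * L), Finset.sum_smul]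
      rw [Finset.sum_comm]
    rw [this, Matrix.mul_assoc, hLL, Matrix.mul_one]
  have comb' : ∀ (M : Matrix K' I ℂ) (k : K'),
      ∑ i, (M * L) k i • a' i = ∑ i, M k i • y i := by
    intro M k
    have : ∑ i, (M * L) k i • a' i = ∑ j, ((M * L) * L') k j • y j := by
      simp only [ha', Finset.smul_sum, smul_smul, Matrix.mul_apply (M := M * L), Finset.sum_smul]
      rw [Finset.sum_comm]
    rw [this, Matrix.mul_assoc, hLL, Matrix.mul_one]
  have T1 : t = ∑ i, y i ⊗ₜ[ℂ] (∑ k, P k i • b k) := by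
    rw [ht]
    simp only [TensorProduct.sum_tmul, TensorProduct.tmul_sum, TensorProduct.smul_tmul]
    rw [Finset.sum_comm]
  have T2 : t = ∑ i, y i ⊗ₜ[ℂ] (∑ k, P' k i • d k) := by
    rw [ht']
    simp only [TensorProduct.sum_tmul, TensorProduct.tmul_sum, TensorProduct.smul_tmul]
    rw [Finset.sum_comm]
  have X := tmul_unique hy (T1.symm.trans T2)
  set b' : I → W := fun i => ∑ k, (P * L) k i • b k with hb'
  have X1 : ∀ i, b' i = ∑ k, (P' * L) k i • d k := by
    intro i
    have e1 : b' i = ∑ j, L j i • ∑ k, P k j • b k := by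
      simp only [hb', Matrix.mul_apply, Finset.sum_smul, Finset.smul_sum, smul_smul]
      rw [Finset.sum_comm]; simp only [mul_comm]
    have e2 : ∑ k, (P' * L) k i • d k = ∑ j, L j i • ∑ k, P' k j • d k := by
      simp only [Matrix.mul_apply, Finset.sum_smul, Finset.smul_sum, smul_smul]
      rw [Finset.sum_comm]; simp only [mul_comm]
    rw [e1, e2]
    exact Finset.sum_congr rfl fun j _ => by rw [congrFun X j]
  have T3 : t = ∑ i, a' i ⊗ₜ[ℂ] b' i := by
    rw [ht]
    simp only [← comb P, hb']
    simp only [TensorProduct.sum_tmul, TensorProduct.tmul_sum, TensorProduct.smul_tmul]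
    rw [Finset.sum_comm]
  have F1 := frame S₁ _ _ hQ a'
  have F2 := frame S₂ _ _ hQ' a'
  simp only [comb P] at F1
  simp only [comb' P'] at F2
  have B1 := bessel hR₁ _ (fun _ => 1) (fun _ => one_pos) hQ b
  have B2 := bessel hR₂ _ e ep hQ' d
  have F1' := congrArg Complex.re F1
  have F2' := congrArg Complex.re F2
  simp only [Complex.re_sum, Complex.re_ofReal_mul] at F1' F2'
  rw [T3, map_sum]
  refine (norm_sum_le _ _).trans ?_
  calc ∑ i, ‖TensorProduct.lift u (a' i ⊗ₜ[ℂ] b' i)‖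
      ≤ ∑ i, 8 * (((S₁ (a' i) (a' i)).re + e i * (S₂ (a' i) (a' i)).re)
      + ((e i)⁻¹ * (R₂ (b' i) (b' i)).re + (R₁ (b' i) (b' i)).re)) := by
        refine Finset.sum_le_sum fun i _ => ?_
        rw [TensorProduct.lift.tmul]; exact hu _ (ep i) _ _
    _ = 8 * ((∑ i, (S₁ (a' i) (a' i)).re + ∑ i, e i * (S₂ (a' i) (a' i)).re)
      + (∑ i, (e i)⁻¹ * (R₂ (b' i) (b' i)).re + ∑ i, (R₁ (b' i) (b' i)).re)) := by
        rw [← Finset.mul_sum, Finset.sum_add_distrib, Finset.sum_add_distrib,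
          Finset.sum_add_distrib]
    _ ≤ _ := by
        rw [F1', F2']
        have c1 : ∑ i, (R₁ (b' i) (b' i)).re ≤ ∑ k, (R₁ (b k) (b k)).re := by
          simpa [hb'] using B1
        have c2 : ∑ i, (e i)⁻¹ * (R₂ (b' i) (b' i)).re ≤ ∑ k, (R₂ (d k) (d k)).re := by
          simpa only [X1] using B2
        simp only [one_mul]
        linarith

lemma stepS {K K' : Type*} [Fintype K] [Fintype K']
    {S₁ S₂ : V →ₗ[ℂ] V →ₗ⋆[ℂ] ℂ} {R₁ R₂ : W →ₗ[ℂ] W →ₗ⋆[ℂ] ℂ}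
    (hR₁ : PSD R₁) (hR₂ : PSD R₂)
    (u : V →ₗ[ℂ] W →ₗ[ℂ] ℂ)
    (hu : ∀ r : ℝ, 0 < r → ∀ a b, ‖u a b‖ ≤ 8 * (((S₁ a a).re + r * (S₂ a a).re)
      + (r⁻¹ * (R₂ b b).re + (R₁ b b).re)))
    (a : K → V) (b : K → W) (c : K' → V) (d : K' → W)
    (t : V ⊗[ℂ] W) (ht : t = ∑ k, a k ⊗ₜ[ℂ] b k) (ht' : t = ∑ k, c k ⊗ₜ[ℂ] d k) :
    ‖TensorProduct.lift u t‖ ≤ 8 *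
      (∑ k, (S₁ (a k) (a k)).re + ∑ k, (R₁ (b k) (b k)).re
      + (∑ k, (S₂ (c k) (c k)).re + ∑ k, (R₂ (d k) (d k)).re)) := by
  classical
  set Z : Submodule ℂ V := Submodule.span ℂ (Set.range a ∪ Set.range c) with hZ
  have fd : FiniteDimensional ℂ Z := FiniteDimensional.span_of_finite ℂ
    ((Set.finite_range a).union (Set.finite_range c))
  let bs := Module.finBasis ℂ Z
  set I := Fin (Module.finrank ℂ Z)
  set y : I → V := fun i => (bs i : V) with hy
  have yl : LinearIndependent ℂ y := bs.linearIndependent.map' Z.subtype (by simp)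
  have ha : ∀ k, a k ∈ Z := fun k => Submodule.subset_span (Or.inl ⟨k, rfl⟩)
  have hc : ∀ k, c k ∈ Z := fun k => Submodule.subset_span (Or.inr ⟨k, rfl⟩)
  have rep : ∀ z : Z, ∑ i, bs.repr z i • y i = z := by
    intro z
    have := congrArg Z.subtype (bs.sum_repr z)
    rw [map_sum] at this
    exact this
  have main : ∀ δ : ℝ, 0 < δ → ‖TensorProduct.lift u t‖ ≤ 8 *
      (∑ k, (S₁ (a k) (a k)).re + ∑ k, (R₁ (b k) (b k)).re
      + (∑ k, (S₂ (c k) (c k)).re + ∑ k, (R₂ (d k) (d k)).re)) +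
        δ ^ 2 * (8 * (∑ i, (S₁ (y i) (y i)).re + ∑ i, (S₂ (y i) (y i)).re)) := by
    intro δ hδ
    have key : ∀ {J : Type _} [Fintype J] (P0 : Matrix J I ℂ),
        ((Matrix.fromRows P0 ((δ : ℂ) • (1 : Matrix I I ℂ)))ᴴ *
          Matrix.fromRows P0 ((δ : ℂ) • (1 : Matrix I I ℂ))).PosDef := by
      intro J _ P0
      refine Matrix.PosDef.conjTranspose_mul_self _ ?_
      intro v w hvw
      funext i
      have := congrFun hvw (Sum.inr i)
      simp only [fromRows_mulVec, Sum.elim_inr, smul_mulVec, one_mulVec, Pi.smul_apply,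
        smul_eq_mul] at this
      exact mul_left_cancel₀ (by exact_mod_cast hδ.ne') this
    have key' : ∀ {J : Type _} [Fintype J] (P0 : Matrix J I ℂ),
        ((Matrix.fromRows P0 ((δ : ℂ) • (1 : Matrix I I ℂ)))ᴴ *
          Matrix.fromRows P0 ((δ : ℂ) • (1 : Matrix I I ℂ))).PosDef := by
      intro J _ P0
      refine Matrix.PosDef.conjTranspose_mul_self _ ?_
      intro v w hvw
      funext i
      have := congrFun hvw (Sum.inr i)
      simp only [fromRows_mulVec, Sum.elim_inr, smul_mulVec, one_mulVec, Pi.smul_apply,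
        smul_eq_mul] at this
      exact mul_left_cancel₀ (by exact_mod_cast hδ.ne') this
    set P : Matrix K I ℂ := Matrix.of fun k i => bs.repr ⟨a k, ha k⟩ i with hP
    set P' : Matrix K' I ℂ := Matrix.of fun k i => bs.repr ⟨c k, hc k⟩ i with hP'
    have pa : ∀ k, ∑ i, P k i • y i = a k := fun k => rep ⟨a k, ha k⟩
    have pc : ∀ k, ∑ i, P' k i • y i = c k := fun k => rep ⟨c k, hc k⟩
    have pone : ∀ j, ∑ i, ((δ : ℂ) • (1 : Matrix I I ℂ)) j i • y i = (δ : ℂ) • y j := by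
      intro j
      rw [Finset.sum_eq_single j]
      · rw [Matrix.smul_apply, Matrix.one_apply_eq, smul_eq_mul, mul_one]
      · intro i _ hij
        rw [Matrix.smul_apply, Matrix.one_apply_ne hij.symm, smul_zero, zero_smul]
      · intro h; exact absurd (Finset.mem_univ j) h
    have := stepS_core (S₁ := S₁) (S₂ := S₂) hR₁ hR₂ u hu yl
      (Matrix.fromRows P ((δ : ℂ) • (1 : Matrix I I ℂ)))
      (Matrix.fromRows P' ((δ : ℂ) • (1 : Matrix I I ℂ))) (key P) (key' P')
      (Sum.elim b 0) (Sum.elim d 0) t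
      (by rw [Fintype.sum_sum_type]; simp [pa, ht])
      (by rw [Fintype.sum_sum_type]; simp [pc, ← ht'])
    simp only [Fintype.sum_sum_type, Matrix.fromRows_apply_inl, Matrix.fromRows_apply_inr, pa, pc,
      pone, Sum.elim_inl, Sum.elim_inr, Pi.zero_apply, map_zero, Complex.zero_re,
      Finset.sum_const_zero, add_zero] at this
    have q1 : ∀ (S : V →ₗ[ℂ] V →ₗ⋆[ℂ] ℂ) i, (S ((δ : ℂ) • y i) ((δ : ℂ) • y i)).re
        = δ ^ 2 * (S (y i) (y i)).re := by
      intro S i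
      rw [map_smulₛₗ, map_smulₛₗ, LinearMap.smul_apply, RingHom.id_apply, Complex.conj_ofReal, smul_eq_mul, smul_eq_mul,
        Complex.re_ofReal_mul, Complex.re_ofReal_mul]; ring
    simp only [q1, ← Finset.mul_sum] at this
    refine this.trans (le_of_eq (by ring))
  have lim : Tendsto (fun δ : ℝ => 8 *
      (∑ k, (S₁ (a k) (a k)).re + ∑ k, (R₁ (b k) (b k)).re
      + (∑ k, (S₂ (c k) (c k)).re + ∑ k, (R₂ (d k) (d k)).re)) +
        δ ^ 2 * (8 * (∑ i, (S₁ (y i) (y i)).re + ∑ i, (S₂ (y i) (y i)).re))) (𝓝[>] 0)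
        (𝓝 (8 *
      (∑ k, (S₁ (a k) (a k)).re + ∑ k, (R₁ (b k) (b k)).re
      + (∑ k, (S₂ (c k) (c k)).re + ∑ k, (R₂ (d k) (d k)).re)) +
        (0:ℝ) ^ 2 * (8 * (∑ i, (S₁ (y i) (y i)).re + ∑ i, (S₂ (y i) (y i)).re)))) := by
    refine Tendsto.mono_left (Continuous.tendsto (by fun_prop) 0) nhdsWithin_le_nhds
  have := ge_of_tendsto lim (eventually_nhdsWithin_of_forall fun δ hδ => main δ hδ)
  simpa using this

end P11
end GT

namespace GT
open Filter Topology

section P12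
open Matrix
open scoped ComplexOrder

variable {V W : Type*} [AddCommGroup V] [Module ℂ V] [AddCommGroup W] [Module ℂ W]

lemma gramdiag {I : Type*} [Fintype I] [DecidableEq I] {S : V →ₗ[ℂ] V →ₗ⋆[ℂ] ℂ} (hS : PSD S)
    (y : I → V) : ∃ (U : Matrix I I ℂ) (μ : I → ℝ), Uᴴ * U = 1 ∧ U * Uᴴ = 1 ∧ (∀ i, 0 ≤ μ i) ∧
      ∀ i j, S (∑ k, U k i • y k) (∑ k, U k j • y k) = if i = j then (μ i : ℂ) else 0 := by
  set G : Matrix I I ℂ := Matrix.of fun l k => S (y k) (y l) with hG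
  have hH : G.IsHermitian := by
    ext i j
    simp [hG, hS.herm]
  obtain ⟨U, h1, h2, h3⟩ := udiag hH
  have key : ∀ i j, S (∑ k, U k i • y k) (∑ k, U k j • y k)
      = if i = j then (hH.eigenvalues i : ℂ) else 0 := by
    intro i j
    have := congrFun (congrFun h3 j) i
    rw [Matrix.diagonal_apply] at this
    have e : (if i = j then (hH.eigenvalues i : ℂ) else 0)
        = if j = i then (hH.eigenvalues j : ℂ) else 0 := by
      by_cases h : i = j
      · subst h; simp
      · simp [h, Ne.symm h]
    rw [e, ← this]
    simp only [map_sum, LinearMap.sum_apply, map_smul, LinearMap.smul_apply, map_smulₛₗ,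
      smul_eq_mul, Matrix.mul_apply, Finset.sum_mul, Finset.mul_sum, hG, conjTranspose_apply,
      Matrix.of_apply]
    rw [Finset.sum_comm]
    refine Finset.sum_congr rfl fun k _ => Finset.sum_congr rfl fun l _ => ?_
    rw [Complex.star_def]; ring
  refine ⟨U, _, h1, h2, ?_, key⟩
  intro i
  have := hS.nonneg (∑ k, U k i • y k)
  rw [key, if_pos rfl] at this
  simpa using this

lemma rotate {I : Type*} [Fintype I] [DecidableEq I] {U : Matrix I I ℂ} (hU : U * Uᴴ = 1)
    (y : I → V) (w : I → W) :
    ∑ i, (∑ k, U k i • y k) ⊗ₜ[ℂ] (∑ k, (starRingEnd ℂ) (U k i) • w k) = ∑ k, y k ⊗ₜ[ℂ] w k := by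
  have h : ∀ k l, ∑ i, U k i * (starRingEnd ℂ) (U l i) = if k = l then 1 else 0 := by
    intro k l
    have := congrFun (congrFun hU k) l
    rw [Matrix.mul_apply, Matrix.one_apply] at this
    simpa using this
  have e : ∀ i, (∑ k, U k i • y k) ⊗ₜ[ℂ] (∑ k, (starRingEnd ℂ) (U k i) • w k)
      = ∑ k, ∑ l, (U k i * (starRingEnd ℂ) (U l i)) • (y k ⊗ₜ[ℂ] w l) := by
    intro i
    simp only [TensorProduct.sum_tmul, TensorProduct.tmul_sum, TensorProduct.smul_tmul_smul]
    rw [Finset.sum_comm]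
  simp only [e]
  rw [Finset.sum_comm]
  refine Finset.sum_congr rfl fun k _ => ?_
  rw [Finset.sum_comm]
  simp [← Finset.sum_smul, h]

lemma bessel_vec {I : Type*} [Fintype I] [DecidableEq I] {S : V →ₗ[ℂ] V →ₗ⋆[ℂ] ℂ} (hS : PSD S)
    (e : I → V) (s : I → ℝ) (he : ∀ i j, S (e i) (e j) = if i = j then (s i : ℂ) else 0) (a : V) :
    ∑ i, (s i)⁻¹ * ‖S a (e i)‖ ^ 2 ≤ (S a a).re := by
  set c : I → ℂ := fun i => ((s i)⁻¹ : ℂ) * S a (e i) with hc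
  have n2 : ∀ z : ℂ, (starRingEnd ℂ) z * z = ((‖z‖ ^ 2 : ℝ) : ℂ) := by
    intro z; rw [mul_comm, Complex.mul_conj, Complex.normSq_eq_norm_sq]
  have C1 : S a (∑ i, c i • e i) = ∑ i, (((s i)⁻¹ * ‖S a (e i)‖ ^ 2 : ℝ) : ℂ) := by
    rw [map_sum]
    refine Finset.sum_congr rfl fun i _ => ?_
    rw [map_smulₛₗ, smul_eq_mul, hc]
    simp only [map_mul, map_inv₀, Complex.conj_ofReal]
    rw [mul_assoc, n2]; push_cast; rfl
  have C2 : S (∑ i, c i • e i) a = ∑ i, (((s i)⁻¹ * ‖S a (e i)‖ ^ 2 : ℝ) : ℂ) := by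
    rw [← hS.herm, C1, map_sum]
    simp only [Complex.conj_ofReal]
  have C3 : S (∑ i, c i • e i) (∑ i, c i • e i) = ∑ i, (((s i)⁻¹ * ‖S a (e i)‖ ^ 2 : ℝ) : ℂ) := by
    rw [map_sum S, LinearMap.sum_apply]
    refine Finset.sum_congr rfl fun i _ => ?_
    rw [map_sum, Finset.sum_eq_single i]
    · rw [map_smulₛₗ, map_smulₛₗ, LinearMap.smul_apply, he, if_pos rfl, hc]
      simp only [smul_eq_mul, map_mul, map_inv₀, Complex.conj_ofReal, RingHom.id_apply]
      by_cases h0 : s i = 0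
      · simp [h0]
      · have h0' : (s i : ℂ) ≠ 0 := by exact_mod_cast h0
        have := n2 (S a (e i))
        push_cast at this ⊢
        field_simp
        linear_combination this
    · intro j _ hj
      rw [map_smulₛₗ, map_smulₛₗ, LinearMap.smul_apply, he, if_neg hj.symm]; simp
    · intro h; exact absurd (Finset.mem_univ i) h
  have N := hS.nonneg (a - ∑ i, c i • e i)
  rw [map_sub S, LinearMap.sub_apply, map_sub, map_sub, C1, C2, C3, ← Complex.ofReal_sum] at N
  simp only [Complex.sub_re, Complex.ofReal_re] at N
  linarith

/-- the bilinear form `∑ ρᵢ S(a,eᵢ) R(b,wᵢ)` -/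
def TT {I : Type*} [Fintype I] (S : V →ₗ[ℂ] V →ₗ⋆[ℂ] ℂ) (R : W →ₗ[ℂ] W →ₗ⋆[ℂ] ℂ)
    (e : I → V) (w : I → W) (ρ : I → ℝ) : V →ₗ[ℂ] W →ₗ[ℂ] ℂ :=
  ∑ i, (ρ i : ℂ) • (LinearMap.mul ℂ ℂ).compl₁₂ (S.flip (e i)) (R.flip (w i))

lemma TT_apply {I : Type*} [Fintype I] (S : V →ₗ[ℂ] V →ₗ⋆[ℂ] ℂ) (R : W →ₗ[ℂ] W →ₗ⋆[ℂ] ℂ)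
    (e : I → V) (w : I → W) (ρ : I → ℝ) (a : V) (b : W) :
    TT S R e w ρ a b = ∑ i, (ρ i : ℂ) * (S a (e i) * R b (w i)) := by
  simp [TT, LinearMap.sum_apply]

lemma exists_rep (t : V ⊗[ℂ] W) : ∃ (n : ℕ) (y : Fin n → V) (w : Fin n → W),
    t = ∑ k, y k ⊗ₜ[ℂ] w k := by
  induction t using TensorProduct.induction_on with
  | zero => exact ⟨0, 0, 0, by simp⟩
  | tmul x y => exact ⟨1, fun _ => x, fun _ => y, by simp⟩
  | add s t hs ht =>
    obtain ⟨n, a, b, rfl⟩ := hs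
    obtain ⟨m, c, d, rfl⟩ := ht
    exact ⟨n + m, Fin.append a c, Fin.append b d, by simp [Fin.sum_univ_add]⟩

lemma sesq_real (S : V →ₗ[ℂ] V →ₗ⋆[ℂ] ℂ) (r : ℝ) (x : V) :
    (S ((r : ℂ) • x) ((r : ℂ) • x)).re = r ^ 2 * (S x x).re := by
  rw [map_smulₛₗ, map_smulₛₗ, LinearMap.smul_apply, RingHom.id_apply, Complex.conj_ofReal,
    smul_eq_mul, smul_eq_mul, Complex.re_ofReal_mul, Complex.re_ofReal_mul]; ring

lemma smul_tmul_inv {r : ℝ} (hr : r ≠ 0) (x : V) (y : W) :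
    ((r : ℂ) • x) ⊗ₜ[ℂ] (((r⁻¹ : ℝ) : ℂ) • y) = x ⊗ₜ[ℂ] y := by
  rw [TensorProduct.smul_tmul_smul, ← Complex.ofReal_mul, mul_inv_cancel₀ hr]; simp

lemma lemD {S : V →ₗ[ℂ] V →ₗ⋆[ℂ] ℂ} {R : W →ₗ[ℂ] W →ₗ⋆[ℂ] ℂ} (hS : PSD S) (hR : PSD R)
    (t : V ⊗[ℂ] W) {ε : ℝ} (hε : 0 < ε) :
    ∃ (I : Type) (_ : Fintype I) (e : I → V) (w : I → W) (ρ : I → ℝ),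
      (∀ a b, ‖TT S R e w ρ a b‖ ^ 2 ≤ (S a a).re * (R b b).re) ∧
      ∃ (K : Type) (_ : Fintype K) (a : K → V) (b : K → W), t = ∑ k, a k ⊗ₜ[ℂ] b k ∧
        ∑ k, (S (a k) (a k)).re ≤ (TensorProduct.lift (TT S R e w ρ) t).re + ε ∧
        ∑ k, (R (b k) (b k)).re ≤ (TensorProduct.lift (TT S R e w ρ) t).re + ε := by
  classical
  obtain ⟨n, y₀, w₀, ht⟩ := exists_rep t
  obtain ⟨U, μ, hU1, hU2, μ0, hU3⟩ := gramdiag hS y₀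
  rw [← rotate hU2] at ht
  set y : Fin n → V := fun i => ∑ k, U k i • y₀ k with hy
  set w : Fin n → W := fun i => ∑ k, (starRingEnd ℂ) (U k i) • w₀ k with hw
  set J := {i : Fin n // μ i ≠ 0} with hJ
  set J' := {i : Fin n // ¬ (μ i ≠ 0)} with hJ'
  have yS : ∀ i j, S (y i) (y j) = if i = j then (μ i : ℂ) else 0 := hU3
  have sp : ∀ i : J, 0 < √(μ i) := fun i => Real.sqrt_pos.2 (lt_of_le_of_ne (μ0 _) (Ne.symm i.2))
  set e₁ : J → V := fun i => (((√(μ i))⁻¹ : ℝ) : ℂ) • y i with he₁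
  set b₁ : J → W := fun i => ((√(μ i) : ℝ) : ℂ) • w i with hb₁
  have e₁S : ∀ i j, S (e₁ i) (e₁ j) = if i = j then 1 else 0 := by
    intro i j
    simp only [he₁]
    rw [map_smulₛₗ, map_smulₛₗ, LinearMap.smul_apply, RingHom.id_apply, Complex.conj_ofReal,
      smul_eq_mul, smul_eq_mul, yS]
    by_cases hij : i = j
    · subst hij
      simp only [if_true]
      rw [← Complex.ofReal_mul, ← Complex.ofReal_mul]
      have h1 := Real.mul_self_sqrt (μ0 i)
      have : (√(μ i))⁻¹ * ((√(μ i))⁻¹ * μ i) = 1 := by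
        have := (sp i).ne'
        field_simp; nlinarith
      rw [this]; simp
    · have : (i : Fin n) ≠ j := fun h => hij (Subtype.ext h)
      simp [hij, this]
  obtain ⟨Q, τ, hQ1, hQ2, τ0, hQ3⟩ := gramdiag hR b₁
  set e : J → V := fun i => ∑ k, (starRingEnd ℂ) (Q k i) • e₁ k with he
  set b : J → W := fun i => ∑ k, Q k i • b₁ k with hb
  have bR : ∀ i j, R (b i) (b j) = if i = j then (τ i : ℂ) else 0 := hQ3
  have eS : ∀ i j, S (e i) (e j) = if i = j then ((1:ℝ) : ℂ) else 0 := by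
    intro i j
    have := congrFun (congrFun hQ1 i) j
    rw [Matrix.mul_apply, Matrix.one_apply] at this
    simp only [he, map_sum, LinearMap.sum_apply, map_smulₛₗ, LinearMap.smul_apply, e₁S,
      RingHom.id_apply, smul_eq_mul, Complex.conj_conj]
    simp only [Complex.ofReal_one, ← this]
    refine Finset.sum_congr rfl fun k _ => ?_
    rw [Finset.sum_eq_single k]
    · rw [if_pos rfl, mul_one, conjTranspose_apply, Complex.star_def, mul_comm]
    · intro l _ hl; rw [if_neg hl, mul_zero]
    · intro h; exact absurd (Finset.mem_univ k) h
  set σ : J → ℝ := fun i => √(τ i) with hσ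
  have σ0 : ∀ i, 0 ≤ σ i := fun i => Real.sqrt_nonneg _
  have σ2 : ∀ i, σ i ^ 2 = τ i := fun i => Real.sq_sqrt (τ0 i)
  have tsum : t = ∑ i : J, e i ⊗ₜ[ℂ] b i + ∑ i : J', y i ⊗ₜ[ℂ] w i := by
    have h1 : ∑ i : J, e i ⊗ₜ[ℂ] b i = ∑ i : J, e₁ i ⊗ₜ[ℂ] b₁ i := by
      have hQQ : (Qᴴᵀ) * (Qᴴᵀ)ᴴ = 1 := by
        have : Qᴴᵀ * (Qᴴᵀ)ᴴ = (Q * Qᴴ)ᵀ := by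
          ext i j
          simp [Matrix.mul_apply, mul_comm]
        rw [this, hQ2, Matrix.transpose_one]
      rw [← rotate hQQ e₁ b₁]
      simp [he, hb]
    have h2 : ∀ i : J, e₁ i ⊗ₜ[ℂ] b₁ i = y i ⊗ₜ[ℂ] w i := by
      intro i
      have := smul_tmul_inv (inv_ne_zero (sp i).ne') (y i) (w i)
      rw [inv_inv] at this
      exact this
    rw [h1, ht]
    simp only [h2]
    exact (Fintype.sum_subtype_add_sum_subtype (fun i => μ i ≠ 0) (fun i => y i ⊗ₜ[ℂ] w i)).symm
  have ynull : ∀ (i : J') z, S (y i) z = 0 := by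
    intro i z
    refine hS.null ?_ z
    rw [yS, if_pos rfl, not_not.1 i.2]; simp
  have hTt : TensorProduct.lift (TT S R e b fun i => (σ i)⁻¹) t = ((∑ i, σ i : ℝ) : ℂ) := by
    rw [tsum, map_add, map_sum, map_sum]
    simp only [TensorProduct.lift.tmul, TT_apply, ynull, zero_mul, mul_zero,
      Finset.sum_const_zero, add_zero]
    rw [Complex.ofReal_sum]
    refine Finset.sum_congr rfl fun i _ => ?_
    rw [Finset.sum_eq_single i]
    · rw [eS, bR, if_pos rfl, if_pos rfl, ← Complex.ofReal_mul, ← Complex.ofReal_mul, one_mul,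
        ← σ2]
      congr 1
      by_cases h0 : σ i = 0
      · simp [h0]
      · field_simp
    · intro j _ hj
      rw [eS, if_neg hj.symm]; simp
    · intro h; exact absurd (Finset.mem_univ i) h
  refine ⟨J, inferInstance, e, b, fun i => (σ i)⁻¹, ?_, ?_⟩
  · intro x z
    rw [TT_apply]
    have B1 := bessel_vec hS e (fun _ => 1) eS x
    have B2 := bessel_vec hR b τ bR z
    simp only [inv_one, one_mul] at B1
    have cs := Finset.sum_mul_sq_le_sq_mul_sq Finset.univ (fun i => ‖S x (e i)‖)
      (fun i => (σ i)⁻¹ * ‖R z (b i)‖)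
    have n : ‖∑ i, (((σ i)⁻¹ : ℝ) : ℂ) * (S x (e i) * R z (b i))‖
        ≤ ∑ i, ‖S x (e i)‖ * ((σ i)⁻¹ * ‖R z (b i)‖) := by
      refine (norm_sum_le _ _).trans (Finset.sum_le_sum fun i _ => le_of_eq ?_)
      rw [norm_mul, norm_mul, Complex.norm_real, Real.norm_of_nonneg (inv_nonneg.2 (σ0 i))]; ring
    have q : ∑ i, ((σ i)⁻¹ * ‖R z (b i)‖) ^ 2 = ∑ i, (τ i)⁻¹ * ‖R z (b i)‖ ^ 2 := by
      refine Finset.sum_congr rfl fun i _ => ?_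
      rw [mul_pow, inv_pow, σ2]
    rw [q] at cs
    calc _ ≤ (∑ i, ‖S x (e i)‖ * ((σ i)⁻¹ * ‖R z (b i)‖)) ^ 2 := by gcongr
      _ ≤ _ := cs
      _ ≤ _ := by
        refine mul_le_mul B1 B2 (Finset.sum_nonneg fun i _ => ?_) (hS.nonneg x)
        exact mul_nonneg (inv_nonneg.2 (τ0 i)) (sq_nonneg _)
  · set C := ∑ i : J', (R (w i) (w i)).re with hC
    have C0 : 0 ≤ C := Finset.sum_nonneg fun i _ => hR.nonneg _
    set δ := √(ε / (Fintype.card J + 1)) with hδ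
    have δ0 : 0 < δ := Real.sqrt_pos.2 (by positivity)
    have δ2 : δ ^ 2 = ε / (Fintype.card J + 1) := Real.sq_sqrt (by positivity)
    set r := √((C + 1) / ε) with hr
    have r0 : 0 < r := Real.sqrt_pos.2 (by positivity)
    have r2 : r ^ 2 = (C + 1) / ε := Real.sq_sqrt (by positivity)
    set s : J → ℝ := fun i => if σ i = 0 then δ else √(σ i) with hs
    have s0 : ∀ i, 0 < s i := by
      intro i; simp only [hs]; split_ifs with h
      · exact δ0
      · exact Real.sqrt_pos.2 (lt_of_le_of_ne (σ0 i) (Ne.symm h))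
    refine ⟨J ⊕ J', inferInstance, Sum.elim (fun i => (s i : ℂ) • e i) (fun i => (r : ℂ) • y i),
      Sum.elim (fun i => (((s i)⁻¹ : ℝ) : ℂ) • b i) (fun i => ((r⁻¹ : ℝ) : ℂ) • w i), ?_, ?_, ?_⟩
    · rw [Fintype.sum_sum_type]
      simp only [Sum.elim_inl, Sum.elim_inr, smul_tmul_inv (s0 _).ne', smul_tmul_inv r0.ne']
      exact tsum
    · rw [Fintype.sum_sum_type, hTt, Complex.ofReal_re]
      simp only [Sum.elim_inl, Sum.elim_inr, sesq_real, ynull, Complex.zero_re, mul_zero,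
        Finset.sum_const_zero, add_zero, eS, if_true, Complex.ofReal_re, mul_one]
      have : ∀ i, s i ^ 2 ≤ σ i + δ ^ 2 := by
        intro i; simp only [hs]; split_ifs with h
        · rw [h]; simp
        · rw [Real.sq_sqrt (σ0 i)]; nlinarith
      refine (Finset.sum_le_sum fun i _ => this i).trans ?_
      rw [Finset.sum_add_distrib]
      gcongr
      rw [Finset.sum_const, nsmul_eq_mul, δ2, Finset.card_univ]
      rw [mul_div_assoc', div_le_iff₀ (by positivity)]
      nlinarith
    · rw [Fintype.sum_sum_type, hTt, Complex.ofReal_re]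
      simp only [Sum.elim_inl, Sum.elim_inr, sesq_real, bR, if_true, Complex.ofReal_re]
      rw [← Finset.mul_sum]
      refine add_le_add (le_of_eq (Finset.sum_congr rfl fun i _ => ?_)) ?_
      · simp only [hs]; split_ifs with h
        · rw [← σ2, h]; simp
        · rw [inv_pow, Real.sq_sqrt (σ0 i), ← σ2]; field_simp
      · rw [inv_pow, r2, ← hC, inv_div, div_mul_eq_mul_div, div_le_iff₀ (by positivity)]
        nlinarith

end P12
end GT

namespace GT
open Filter Topology

section P13
variable {A : Type*} [NonUnitalCStarAlgebra A] [PartialOrder A] [StarOrderedRing A]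

lemma row_norm {n : ℕ} (v : CStarMatrix (Fin n) (Fin n) A) (α : Fin n → ℂ) :
    ‖∑ j, (∑ i, α i • v i j) * star (∑ i, α i • v i j)‖ ≤ (∑ i, ‖α i‖ ^ 2) * ‖v‖ ^ 2 := by
  set x : Fin n → A := fun j => ∑ i, α i • v i j with hx
  set s := ∑ j, x j * star (x j) with hs
  have hsa : star s = s := by simp [hs]
  by_cases h0 : s = 0
  · rw [h0, norm_zero]; positivity
  have key : ∀ a : A, ‖a * s * star a‖ ≤ (∑ i, ‖α i‖ ^ 2) * ‖v‖ ^ 2 * ‖a‖ ^ 2 := by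
    intro a
    let ξ : WithCStarModule A (Fin n → A) := (WithCStarModule.equiv A (Fin n → A)).symm fun i => α i • a
    have h1 := (CStarMatrix.toCLM v).le_opNorm ξ
    rw [← CStarMatrix.norm_def] at h1
    have e1 : ∀ j, (CStarMatrix.toCLM v ξ) j = a * x j := by
      intro j
      rw [CStarMatrix.toCLM_apply_eq_sum]
      simp [ξ, hx, Finset.mul_sum, smul_mul_assoc, mul_smul_comm]
    have n1 := WithCStarModule.pi_norm_sq (A := A) (CStarMatrix.toCLM v ξ)
    have n2 := WithCStarModule.pi_norm_sq (A := A) ξ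
    have e3 : ∑ i, inner A (CStarMatrix.toCLM v ξ i) (CStarMatrix.toCLM v ξ i) = a * s * star a := by
      simp only [e1, WithCStarModule.inner_def, hs, Finset.mul_sum, Finset.sum_mul]
      refine Finset.sum_congr rfl fun j _ => ?_
      simp [mul_assoc]
    have e4 : ∑ i, inner A (ξ i) (ξ i) = ((∑ i, ‖α i‖ ^ 2 : ℝ) : ℂ) • (a * star a) := by
      simp only [WithCStarModule.inner_def]
      rw [Complex.ofReal_sum, Finset.sum_smul]
      refine Finset.sum_congr rfl fun j _ => ?_
      have : ξ j = α j • a := rfl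
      rw [this, star_smul, smul_mul_smul_comm]
      congr 1
      rw [Complex.star_def, Complex.mul_conj, Complex.normSq_eq_norm_sq]
    rw [e3] at n1
    rw [e4, norm_smul, CStarRing.norm_self_mul_star, Complex.norm_real,
      Real.norm_of_nonneg (by positivity)] at n2
    rw [← n1]
    calc _ ≤ (‖v‖ * ‖ξ‖) ^ 2 := by gcongr
      _ = _ := by rw [mul_pow, n2]; ring
  have h := key s
  have h3 : ‖s * s * star s‖ = ‖s‖ * ‖s‖ ^ 2 := by
    have sq : ‖s * s‖ = ‖s‖ * ‖s‖ := by
      conv_lhs => rw [← hsa]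
      rw [hsa]; nth_rewrite 1 [← hsa]; exact CStarRing.norm_star_mul_self
    have h4 : ‖(s * s) * (s * s)‖ = ‖s * s‖ * ‖s * s‖ := by
      have : star (s * s) = s * s := by rw [star_mul, hsa]
      nth_rewrite 1 [← this]; exact CStarRing.norm_star_mul_self
    have sp : 0 < ‖s‖ := norm_pos_iff.2 h0
    rw [hsa]
    apply le_antisymm
    · calc _ ≤ ‖s * s‖ * ‖s‖ := norm_mul_le _ _
        _ = _ := by rw [sq]; ring
    · have : ‖s * s * (s * s)‖ ≤ ‖s * s * s‖ * ‖s‖ := by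
        rw [← mul_assoc]; exact norm_mul_le _ _
      rw [h4, sq] at this
      rw [← mul_le_mul_iff_left₀ sp]
      linarith
  rw [h3] at h
  have sp : 0 < ‖s‖ ^ 2 := pow_pos (norm_pos_iff.2 h0) 2
  exact le_of_mul_le_mul_right h sp

lemma col_norm {n : ℕ} (w : CStarMatrix (Fin n) (Fin n) A) (β : Fin n → ℂ) :
    ‖∑ k, star (∑ l, β l • w k l) * (∑ l, β l • w k l)‖ ≤ (∑ i, ‖β i‖ ^ 2) * ‖w‖ ^ 2 := by
  have := row_norm (star w) (fun i => star (β i))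
  rw [norm_star] at this
  simp only [norm_star] at this
  refine le_trans (le_of_eq ?_) this
  congr 1
  refine Finset.sum_congr rfl fun k _ => ?_
  have : star (∑ l, β l • w k l) = ∑ i, star (β i) • star w i k := by
    rw [star_sum]
    refine Finset.sum_congr rfl fun i _ => ?_
    rw [star_smul]; rfl
  rw [← this, star_star]

lemma row_pos {f : A →ₗ[ℂ] ℂ} {C : ℝ} (hf : ∀ x, ‖f x‖ ≤ C * ‖x‖) (hC : 0 ≤ C) {n m : ℕ}
    (v : CStarMatrix (Fin n) (Fin n) A) (α : Fin n → Fin m → ℂ) :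
    ∑ j, ∑ k, (f ((∑ i, α i k • v i j) * star (∑ i, α i k • v i j))).re ≤
      C * ((∑ i, ∑ k, ‖α i k‖ ^ 2) * ‖v‖ ^ 2) := by
  rw [Finset.sum_comm]
  have : ∀ k, ∑ j, (f ((∑ i, α i k • v i j) * star (∑ i, α i k • v i j))).re ≤
      C * ((∑ i, ‖α i k‖ ^ 2) * ‖v‖ ^ 2) := by
    intro k
    rw [← Complex.re_sum, ← map_sum]
    refine (Complex.re_le_norm _).trans ((hf _).trans ?_)
    have := row_norm v (fun i => α i k)
    gcongr
  refine (Finset.sum_le_sum fun k _ => this k).trans (le_of_eq ?_)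
  rw [← Finset.mul_sum, ← Finset.sum_mul, Finset.sum_comm]

lemma col_pos {f : A →ₗ[ℂ] ℂ} {C : ℝ} (hf : ∀ x, ‖f x‖ ≤ C * ‖x‖) (hC : 0 ≤ C) {n m : ℕ}
    (v : CStarMatrix (Fin n) (Fin n) A) (β : Fin m → Fin n → ℂ) :
    ∑ j, ∑ k, (f (star (∑ l, β j l • v k l) * (∑ l, β j l • v k l))).re ≤
      C * ((∑ j, ∑ l, ‖β j l‖ ^ 2) * ‖v‖ ^ 2) := by
  have : ∀ j, ∑ k, (f (star (∑ l, β j l • v k l) * (∑ l, β j l • v k l))).re ≤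
      C * ((∑ l, ‖β j l‖ ^ 2) * ‖v‖ ^ 2) := by
    intro j
    rw [← Complex.re_sum, ← map_sum]
    refine (Complex.re_le_norm _).trans ((hf _).trans ?_)
    have := col_norm v (fun i => β j i)
    gcongr
  refine (Finset.sum_le_sum fun k _ => this k).trans (le_of_eq ?_)
  rw [← Finset.mul_sum, ← Finset.sum_mul]

lemma cs_aux {I : Type*} [Fintype I] (T x y : I → ℝ) (X Y : ℝ)
    (hx : ∀ i, 0 ≤ x i) (hy : ∀ i, 0 ≤ y i)
    (h : ∀ i, T i ^ 2 ≤ x i * y i) (hX : ∑ i, x i ≤ X) (hY : ∑ i, y i ≤ Y) :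
    (∑ i, T i) ^ 2 ≤ X * Y := by
  have := Finset.sum_sq_le_sum_mul_sum_of_sq_le_mul Finset.univ (fun i _ => hx i) (fun i _ => hy i)
    (fun i _ => h i)
  refine this.trans ?_
  exact mul_le_mul hX hY (Finset.sum_nonneg fun i _ => hy i)
    ((Finset.sum_nonneg fun i _ => hx i).trans hX)

end P13

section P13b
variable {A B : Type u} [NonUnitalCStarAlgebra A] [PartialOrder A] [StarOrderedRing A]
 [NonUnitalCStarAlgebra B] [PartialOrder B] [StarOrderedRing B]

lemma sqrt_bound {x C a v w b : ℝ} (hC : 0 ≤ C) (ha : 0 ≤ a) (hv : 0 ≤ v) (hw : 0 ≤ w) (hb : 0 ≤ b)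
    (h : x ^ 2 ≤ (C * (a * v ^ 2)) * (C * (b * w ^ 2))) : x ≤ C * (√a * v * w * √b) := by
  refine abs_le_of_sq_le_sq' ?_ (by positivity) |>.2
  refine h.trans (le_of_eq ?_)
  have h1 := Real.sq_sqrt ha
  have h2 := Real.sq_sqrt hb
  calc _ = C ^ 2 * (a * v ^ 2 * w ^ 2 * b) := by ring
    _ = C ^ 2 * (√a ^ 2 * v ^ 2 * w ^ 2 * √b ^ 2) := by rw [h1, h2]
    _ = _ := by ring

lemma sum4 {M : Type*} [AddCommMonoid M] {p q : ℕ} (F : Fin p → Fin q → Fin p → Fin q → M) :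
    ∑ i, ∑ k, ∑ j, ∑ l, F i k j l = ∑ j, ∑ k, ∑ l, ∑ i, F i k j l := by
  calc _ = ∑ i, ∑ j, ∑ k, ∑ l, F i k j l := Finset.sum_congr rfl fun i _ => Finset.sum_comm
    _ = ∑ j, ∑ i, ∑ k, ∑ l, F i k j l := Finset.sum_comm
    _ = _ := by
      refine Finset.sum_congr rfl fun j _ => ?_
      rw [Finset.sum_comm]
      refine Finset.sum_congr rfl fun k _ => ?_
      rw [Finset.sum_comm]

lemma rc_bound {f : A →ₗ[ℂ] ℂ} {g : B →ₗ[ℂ] ℂ} {C : ℝ} (hC : 0 ≤ C)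
    (hf : ∀ x, ‖f x‖ ≤ C * ‖x‖) (hg : ∀ x, ‖g x‖ ≤ C * ‖x‖) (pf : PosF f) (pg : PosF g)
    (T : A →ₗ[ℂ] B →ₗ[ℂ] ℂ)
    (hT : ∀ a b, ‖T a b‖ ^ 2 ≤ (f (a * star a)).re * (g (star b * b)).re)
    {p q : ℕ} (α : Fin p × Fin q → ℂ) (v : CStarMatrix (Fin p) (Fin p) A)
    (w : CStarMatrix (Fin q) (Fin q) B) (β : Fin p × Fin q → ℂ) :
    ‖∑ ik : Fin p × Fin q, ∑ jl : Fin p × Fin q,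
            (α ik * β jl) * T (v ik.1 jl.1) (w ik.2 jl.2)‖ ≤
      C * (√(∑ ik, ‖α ik‖ ^ 2) * ‖v‖ * ‖w‖ * √(∑ jl, ‖β jl‖ ^ 2)) := by
  set x : Fin p → Fin q → A := fun j k => ∑ i, α (i, k) • v i j with hx
  set y : Fin p → Fin q → B := fun j k => ∑ l, β (j, l) • w k l with hy
  have e : ∑ ik : Fin p × Fin q, ∑ jl : Fin p × Fin q,
            (α ik * β jl) * T (v ik.1 jl.1) (w ik.2 jl.2) = ∑ jk : Fin p × Fin q,
            T (x jk.1 jk.2) (y jk.1 jk.2) := by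
    simp only [Fintype.sum_prod_type]
    rw [sum4 (fun i k j l => (α (i, k) * β (j, l)) * T (v i j) (w k l))]
    refine Finset.sum_congr rfl fun j _ => Finset.sum_congr rfl fun k _ => ?_
    simp only [hx, hy, map_sum, map_smul, LinearMap.sum_apply, LinearMap.smul_apply, smul_eq_mul]
    refine Finset.sum_congr rfl fun l _ => ?_
    rw [Finset.mul_sum]
    refine Finset.sum_congr rfl fun i _ => ?_
    ring
  rw [e]
  refine (norm_sum_le _ _).trans (sqrt_bound hC (by positivity) (norm_nonneg _) (norm_nonneg _)
    (by positivity) ?_)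
  refine cs_aux _ (fun jk => (f (x jk.1 jk.2 * star (x jk.1 jk.2))).re)
    (fun jk => (g (star (y jk.1 jk.2) * (y jk.1 jk.2))).re) _ _
    (fun jk => by have := (pf (star (x jk.1 jk.2))).1; rwa [star_star] at this) (fun jk => (pg _).1) (fun jk => hT _ _) ?_ ?_
  · have := row_pos hf hC v (fun i k => α (i, k))
    simpa only [Fintype.sum_prod_type] using this
  · have := col_pos hg hC w (fun i k => β (i, k))
    simpa only [Fintype.sum_prod_type] using this

end P13b

section P13c
variable {A B : Type u} [NonUnitalCStarAlgebra A] [PartialOrder A] [StarOrderedRing A]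
 [NonUnitalCStarAlgebra B] [PartialOrder B] [StarOrderedRing B]

lemma cr_bound {f : A →ₗ[ℂ] ℂ} {g : B →ₗ[ℂ] ℂ} {C : ℝ} (hC : 0 ≤ C)
    (hf : ∀ x, ‖f x‖ ≤ C * ‖x‖) (hg : ∀ x, ‖g x‖ ≤ C * ‖x‖) (pf : PosF f) (pg : PosF g)
    (T : A →ₗ[ℂ] B →ₗ[ℂ] ℂ)
    (hT : ∀ a b, ‖T a b‖ ^ 2 ≤ (f (star a * a)).re * (g (b * star b)).re)
    {p q : ℕ} (α : Fin p × Fin q → ℂ) (v : CStarMatrix (Fin p) (Fin p) A)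
    (w : CStarMatrix (Fin q) (Fin q) B) (β : Fin p × Fin q → ℂ) :
    ‖∑ ik : Fin p × Fin q, ∑ jl : Fin p × Fin q,
            (α ik * β jl) * T (v ik.1 jl.1) (w ik.2 jl.2)‖ ≤
      C * (√(∑ ik, ‖α ik‖ ^ 2) * ‖v‖ * ‖w‖ * √(∑ jl, ‖β jl‖ ^ 2)) := by
  have := rc_bound hC hg hf pg pf T.flip (fun b a => by
    rw [LinearMap.flip_apply, mul_comm]; exact hT a b) (fun x => α x.swap) w v (fun x => β x.swap)
  have sw : ∀ {M : Type} [AddCommMonoid M] (F : Fin p × Fin q → M),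
      ∑ x : Fin q × Fin p, F x.swap = ∑ x, F x := fun F =>
    Fintype.sum_equiv (Equiv.prodComm _ _) _ _ (fun _ => rfl)
  have h1 := sw (fun ik => ∑ jl : Fin p × Fin q, (α ik * β jl) * T (v ik.1 jl.1) (w ik.2 jl.2))
  have h2 : ∀ ik : Fin p × Fin q, ∑ jl : Fin q × Fin p,
      (α ik * β jl.swap) * T (v ik.1 jl.swap.1) (w ik.2 jl.swap.2) =
      ∑ jl : Fin p × Fin q, (α ik * β jl) * T (v ik.1 jl.1) (w ik.2 jl.2) := fun ik =>
    sw (fun jl => (α ik * β jl) * T (v ik.1 jl.1) (w ik.2 jl.2))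
  rw [sw (fun x => ‖α x‖ ^ 2), sw (fun x => ‖β x‖ ^ 2)] at this
  rw [← h1]
  simp only [← h2]
  refine le_trans (le_of_eq ?_) (this.trans (le_of_eq ?_))
  · rfl
  · ring

set_option linter.unusedSectionVars false in
lemma os_rep_exists (t : A ⊗[ℂ] B) : ∃ (p q : ℕ) (α : Fin p × Fin q → ℂ)
    (v : Matrix (Fin p) (Fin p) A)
      (w : Matrix (Fin q) (Fin q) B) (β : Fin p × Fin q → ℂ),
      t = ∑ ik : Fin p × Fin q, ∑ jl : Fin p × Fin q,
            (α ik * β jl) • (v ik.1 jl.1 ⊗ₜ[ℂ] w ik.2 jl.2) := by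
  obtain ⟨n, a, b, rfl⟩ := exists_rep t
  refine ⟨n, n, fun x => if x.1 = x.2 then 1 else 0, Matrix.diagonal a, Matrix.diagonal b,
    fun x => if x.1 = x.2 then 1 else 0, ?_⟩
  simp only [Fintype.sum_prod_type]
  refine Finset.sum_congr rfl fun i _ => ?_
  rw [Finset.sum_eq_single i (fun k _ hk => ?_) (by simp)]
  · rw [Finset.sum_eq_single i (fun k _ hk => ?_) (by simp)]
    · rw [Finset.sum_eq_single i (fun k _ hk => ?_) (by simp)]
      · simp
      · simp [hk.symm]
    · refine Finset.sum_eq_zero fun l _ => ?_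
      simp [Matrix.diagonal_apply_ne _ hk.symm]
  · simp [hk.symm]

lemma cn_nonneg2 {M : Type*} [NonUnitalRing M] [StarRing M] [Module ℂ M] {N : M → ℝ}
    (hN : IsCStarNorm N) (x : M) : 0 ≤ N x := by
  have h1 := hN.add_le x (-x)
  have h2 := hN.smul_eq (-1) x
  have h3 := hN.smul_eq 0 (0 : M)
  simp at h1 h2 h3
  rw [h2, h3] at h1
  linarith

section os
variable {NA : ∀ p : ℕ, Matrix (Fin p) (Fin p) A → ℝ} {NB : ∀ q : ℕ, Matrix (Fin q) (Fin q) B → ℝ}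


lemma os_le (hNA : ∀ p, IsCStarNorm (NA p)) (hNB : ∀ q, IsCStarNorm (NB q))
        (T : A →ₗ[ℂ] B →ₗ[ℂ] ℂ) {C : ℝ} (hC : 0 ≤ C)
    (h : ∀ (p q : ℕ) (α : Fin p × Fin q → ℂ) (v : CStarMatrix (Fin p) (Fin p) A)
    (w : CStarMatrix (Fin q) (Fin q) B) (β : Fin p × Fin q → ℂ),
    ‖∑ ik : Fin p × Fin q, ∑ jl : Fin p × Fin q,
            (α ik * β jl) * T (v ik.1 jl.1) (w ik.2 jl.2)‖ ≤
      C * (√(∑ ik, ‖α ik‖ ^ 2) * ‖v‖ * ‖w‖ * √(∑ jl, ‖β jl‖ ^ 2))) (t : A ⊗[ℂ] B) :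
    ‖TensorProduct.lift T t‖ ≤ C * osProjNorm NA NB t := by
  have key : ∀ (p q : ℕ) (α : Fin p × Fin q → ℂ) (v : Matrix (Fin p) (Fin p) A)
      (w : Matrix (Fin q) (Fin q) B) (β : Fin p × Fin q → ℂ),
      t = ∑ ik : Fin p × Fin q, ∑ jl : Fin p × Fin q,
            (α ik * β jl) • (v ik.1 jl.1 ⊗ₜ[ℂ] w ik.2 jl.2) →
      ‖TensorProduct.lift T t‖ ≤ C * (Real.sqrt (∑ ik, ‖α ik‖ ^ 2) * NA p v * NB q w *
            Real.sqrt (∑ jl, ‖β jl‖ ^ 2)) := by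
    intro p q α v w β ht
    rw [ht, cn_matrix (hNA p), cn_matrix (hNB q)]
    refine le_trans (le_of_eq ?_) (h p q α (CStarMatrix.ofMatrix v) (CStarMatrix.ofMatrix w) β)
    simp only [map_sum, map_smul, TensorProduct.lift.tmul, smul_eq_mul]
    rfl
  obtain ⟨p, q, α, v, w, β, ht⟩ := os_rep_exists t
  rcases hC.eq_or_lt with h0 | h0
  · have := key p q α v w β ht
    rw [← h0] at this ⊢
    simpa using this
  rw [← div_le_iff₀' h0]
  refine le_csInf ⟨_, p, q, α, v, w, β, ht, rfl⟩ ?_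
  rintro r ⟨p, q, α, v, w, β, ht, rfl⟩
  rw [div_le_iff₀' h0]
  exact key p q α v w β ht

lemma le_os (hNA : ∀ p, IsCStarNorm (NA p)) (hNB : ∀ q, IsCStarNorm (NB q))
    (t : A ⊗[ℂ] B) {p q : ℕ} (α : Fin p × Fin q → ℂ) (v : CStarMatrix (Fin p) (Fin p) A)
      (w : CStarMatrix (Fin q) (Fin q) B) (β : Fin p × Fin q → ℂ)
      (ht : t = ∑ ik : Fin p × Fin q, ∑ jl : Fin p × Fin q,
            (α ik * β jl) • (v ik.1 jl.1 ⊗ₜ[ℂ] w ik.2 jl.2)) :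
      osProjNorm NA NB t ≤ Real.sqrt (∑ ik, ‖α ik‖ ^ 2) * ‖v‖ * ‖w‖ *
            Real.sqrt (∑ jl, ‖β jl‖ ^ 2) := by
  refine csInf_le ⟨0, ?_⟩ ⟨p, q, α, CStarMatrix.ofMatrix.symm v, CStarMatrix.ofMatrix.symm w, β, ht, ?_⟩
  · rintro r ⟨p, q, α, v, w, β, ht, rfl⟩
    have := cn_nonneg2 (hNA p) v
    have := cn_nonneg2 (hNB q) w
    positivity
  · rw [cn_matrix (hNA p), cn_matrix (hNB q)]; rfl

lemma os_tmul_le (hNA : ∀ p, IsCStarNorm (NA p)) (hNB : ∀ q, IsCStarNorm (NB q))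
    (a : A) (b : B) : osProjNorm NA NB (a ⊗ₜ[ℂ] b) ≤ ‖a‖ * ‖b‖ := by
  have key := le_os hNA hNB (a ⊗ₜ[ℂ] b) (p := 1) (q := 1) (fun _ => 1)
    (CStarMatrix.ofMatrix (Matrix.of fun _ _ => a)) (CStarMatrix.ofMatrix (Matrix.of fun _ _ => b))
    (fun _ => 1) (by simp)
  have h1 : ∀ {C : Type u} [NonUnitalCStarAlgebra C] [PartialOrder C] [StarOrderedRing C] (c : C),
      ‖(CStarMatrix.ofMatrix (Matrix.of fun (_ : Fin 1) (_ : Fin 1) => c))‖ ≤ ‖c‖ := by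
    intro C _ _ _ c
    have hN : IsCStarNorm (fun M : Matrix (Fin 1) (Fin 1) C => ‖M 0 0‖) := by
      refine ⟨fun x y => norm_add_le _ _, fun c x => ?_, fun x hx => ?_, fun x y => ?_, fun x => ?_⟩
      · simp [norm_smul]
      · ext i j
        rw [Subsingleton.elim i 0, Subsingleton.elim j 0]
        exact norm_eq_zero.1 hx
      · simp only [Matrix.mul_apply, Finset.univ_unique, Finset.sum_singleton]
        exact norm_mul_le _ _
      · simp only [Matrix.mul_apply, Finset.univ_unique, Finset.sum_singleton]
        exact CStarRing.norm_star_mul_self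
    rw [← cn_matrix hN]
    rfl
  refine key.trans ?_
  simp
  exact mul_le_mul (h1 a) (h1 b) (norm_nonneg _) (norm_nonneg _)
end os
end P13c
end GT

namespace GT
open Filter Topology

section P14
variable {A : Type*} [NonUnitalCStarAlgebra A]

/-- the form `f (a * star a')` -/
def frow (f : A →ₗ[ℂ] ℂ) : A →ₗ[ℂ] A →ₗ⋆[ℂ] ℂ :=
  LinearMap.mk₂'ₛₗ (RingHom.id ℂ) (starRingEnd ℂ) (fun a b => f (a * star b))
    (fun a b c => by rw [add_mul, map_add]) (fun c a b => by simp [smul_mul_assoc])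
    (fun a b c => by rw [star_add, mul_add, map_add]) (fun c a b => by simp [mul_smul_comm])

/-- the form `f (star a' * a)` -/
def fcol (f : A →ₗ[ℂ] ℂ) : A →ₗ[ℂ] A →ₗ⋆[ℂ] ℂ :=
  LinearMap.mk₂'ₛₗ (RingHom.id ℂ) (starRingEnd ℂ) (fun a b => f (star b * a))
    (fun a b c => by rw [mul_add, map_add]) (fun c a b => by simp [mul_smul_comm])
    (fun a b c => by rw [star_add, add_mul, map_add]) (fun c a b => by simp [smul_mul_assoc])

lemma frow_apply (f : A →ₗ[ℂ] ℂ) (a b : A) : frow f a b = f (a * star b) := rfl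
lemma fcol_apply (f : A →ₗ[ℂ] ℂ) (a b : A) : fcol f a b = f (star b * a) := rfl

lemma frow_psd {f : A →ₗ[ℂ] ℂ} (h : PosF f) : PSD (frow f) := by
  refine ⟨fun x => ?_, fun x => ?_⟩ <;> rw [frow_apply] <;> have := h (star x) <;>
    rw [star_star] at this
  exacts [this.1, this.2]

lemma fcol_psd {f : A →ₗ[ℂ] ℂ} (h : PosF f) : PSD (fcol f) := ⟨fun x => (h x).1, fun x => (h x).2⟩

/-- bounded positive functionals vanishing on `J` -/
def PV (J : Submodule ℂ A) (f : A →ₗ[ℂ] ℂ) : Prop :=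
  (∃ C, 0 ≤ C ∧ ∀ x, ‖f x‖ ≤ C * ‖x‖) ∧ PosF f ∧ ∀ x ∈ J, f x = 0

lemma Good.pv {J : Submodule ℂ A} {f : A →ₗ[ℂ] ℂ} (h : Good f J) : PV J f :=
  ⟨⟨80000, by norm_num, h.1⟩, h.2.1, h.2.2⟩

def conjf (f : A →ₗ[ℂ] ℂ) (z : ℂ) (e : A) : A →ₗ[ℂ] ℂ where
  toFun a := f a + z * f (e * a) + star z * f (a * star e) + f (e * a * star e)
  map_add' a b := by simp only [mul_add, add_mul, map_add]; ring
  map_smul' c a := by simp only [smul_mul_assoc, mul_smul_comm, map_smul, smul_eq_mul, RingHom.id_apply]; ring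

lemma conjf_apply (f : A →ₗ[ℂ] ℂ) (z : ℂ) (e a : A) : conjf f z e a =
  f a + z * f (e * a) + star z * f (a * star e) + f (e * a * star e) := rfl

lemma conjf_pv {J : Submodule ℂ A} (hJ : IsSI J) {f : A →ₗ[ℂ] ℂ} (h : PV J f) {z : ℂ} (hz : ‖z‖ = 1)
    (e : A) : PV J (conjf f z e) := by
  obtain ⟨⟨C, hC, hf⟩, pf, vf⟩ := h
  refine ⟨⟨C * (1 + ‖e‖ + ‖e‖ + ‖e‖ * ‖e‖), by positivity, fun x => ?_⟩, fun x => ?_, fun x hx => ?_⟩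
  · rw [conjf_apply]
    have h1 := hf x
    have h2 : ‖z * f (e * x)‖ ≤ C * (‖e‖ * ‖x‖) := by
      rw [norm_mul, hz, one_mul]
      exact (hf _).trans (by gcongr; exact norm_mul_le _ _)
    have h3 : ‖star z * f (x * star e)‖ ≤ C * (‖x‖ * ‖e‖) := by
      rw [norm_mul, norm_star, hz, one_mul]
      exact (hf _).trans (by gcongr; exact (norm_mul_le _ _).trans (by rw [norm_star]))
    have h4 : ‖f (e * x * star e)‖ ≤ C * (‖e‖ * ‖x‖ * ‖e‖) := by
      refine (hf _).trans ?_
      gcongr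
      refine (norm_mul_le _ _).trans ?_
      rw [norm_star]
      gcongr
      exact norm_mul_le _ _
    calc _ ≤ _ := norm_add_le _ _
      _ ≤ C * ‖x‖ + C * (‖e‖ * ‖x‖) + C * (‖x‖ * ‖e‖) + C * (‖e‖ * ‖x‖ * ‖e‖) := by
        gcongr
        refine (norm_add_le _ _).trans ?_
        gcongr
        refine (norm_add_le _ _).trans ?_
        gcongr
      _ = _ := by ring
  · have : conjf f z e (star x * x) = f (star (x + star z • (x * star e)) * (x + star z • (x * star e))) := by
      rw [conjf_apply]
      have hzz : z * star z = 1 := by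
        rw [Complex.star_def, Complex.mul_conj, Complex.normSq_eq_norm_sq, hz]; norm_num
      simp only [star_add, star_smul, star_mul, star_star, add_mul, mul_add, map_add, smul_mul_assoc,
        mul_smul_comm, map_smul, smul_eq_mul, mul_assoc]
      linear_combination (-hzz) * f (e * (star x * (x * star e)))
    rw [this]
    exact pf _
  · rw [conjf_apply, vf _ hx, vf _ (hJ.mul_left e x hx), vf _ (hJ.mul_right _ x hx),
      vf _ (hJ.mul_right _ _ (hJ.mul_left e x hx))]
    simp

lemma polar_row {J : Submodule ℂ A} (hJ : IsSI J) {f : A →ₗ[ℂ] ℂ} (h : PV J f) (e : A) :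
    ∃ (c : Fin 4 → ℂ) (F : Fin 4 → A →ₗ[ℂ] ℂ), (∀ k, PV J (F k)) ∧
      ∀ a, f (a * star e) = ∑ k, c k * F k a := by
  refine ⟨![1/4, Complex.I/4, -1/4, -Complex.I/4], ![conjf f 1 e, conjf f Complex.I e, conjf f (-1) e,
    conjf f (-Complex.I) e], fun k => ?_, fun a => ?_⟩
  · fin_cases k
    · exact conjf_pv hJ h (by simp) e
    · exact conjf_pv hJ h (by simp) e
    · exact conjf_pv hJ h (by simp) e
    · exact conjf_pv hJ h (by simp) e
  · simp [Fin.sum_univ_four, conjf_apply]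
    ring_nf
    simp
    ring

lemma polar_col {J : Submodule ℂ A} (hJ : IsSI J) {f : A →ₗ[ℂ] ℂ} (h : PV J f) (e : A) :
    ∃ (c : Fin 4 → ℂ) (F : Fin 4 → A →ₗ[ℂ] ℂ), (∀ k, PV J (F k)) ∧
      ∀ a, f (star e * a) = ∑ k, c k * F k a := by
  refine ⟨![1/4, -Complex.I/4, -1/4, Complex.I/4], ![conjf f 1 (star e), conjf f Complex.I (star e),
    conjf f (-1) (star e), conjf f (-Complex.I) (star e)], fun k => ?_, fun a => ?_⟩
  · fin_cases k
    · exact conjf_pv hJ h (by simp) _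
    · exact conjf_pv hJ h (by simp) _
    · exact conjf_pv hJ h (by simp) _
    · exact conjf_pv hJ h (by simp) _
  · simp [Fin.sum_univ_four, conjf_apply]
    ring_nf
    simp
    ring

lemma pos_cs_row [PartialOrder A] [StarOrderedRing A] {f : A →ₗ[ℂ] ℂ} {C : ℝ} (hC : 0 ≤ C)
    (hf : ∀ x, ‖f x‖ ≤ C * ‖x‖) (pf : PosF f) (a : A) : ‖f a‖ ^ 2 ≤ C * (f (a * star a)).re := by
  have hc : Continuous f := (f.mkContinuous C hf).continuous
  have au := CStarAlgebra.increasingApproximateUnit A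
  have h1 : Tendsto (fun e => ‖f (a * e)‖ ^ 2) (CStarAlgebra.approximateUnit A) (𝓝 (‖f a‖ ^ 2)) :=
    ((hc.norm.pow 2).tendsto a).comp (au.tendsto_mul_left a)
  have := au.neBot
  refine le_of_tendsto h1 ?_
  filter_upwards [au.eventually_norm] with e he
  have h2 := (frow_psd pf).cs a (star e)
  simp only [frow_apply, star_star] at h2
  rw [mul_comm]
  refine h2.trans ?_
  gcongr
  · have := (pf (star a)).1; rwa [star_star] at this
  · refine (Complex.re_le_norm _).trans ((hf _).trans ?_)
    have : ‖star e * e‖ ≤ 1 := by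
      rw [CStarRing.norm_star_mul_self]; nlinarith [norm_nonneg e]
    nlinarith

lemma posF_star [PartialOrder A] [StarOrderedRing A] {f : A →ₗ[ℂ] ℂ} {C : ℝ} 
    (hf : ∀ x, ‖f x‖ ≤ C * ‖x‖) (pf : PosF f) (a : A) : f (star a) = star (f a) := by
  have hc : Continuous f := (f.mkContinuous C hf).continuous
  have au := CStarAlgebra.increasingApproximateUnit A
  have := au.neBot
  have h1 : Tendsto (fun e => star (f (a * star e))) (CStarAlgebra.approximateUnit A) (𝓝 (star (f a))) := by
    have := (hc.star.tendsto a).comp (au.tendsto_mul_left a)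
    refine this.congr' ?_
    filter_upwards [au.eventually_star_eq] with e he
    simp [he]
  have h2 : Tendsto (fun e => (f (e * star a))) (CStarAlgebra.approximateUnit A) (𝓝 (f (star a))) :=
    (hc.tendsto _).comp (au.tendsto_mul_right (star a))
  refine tendsto_nhds_unique h2 (h1.congr fun e => ?_)
  have := (frow_psd pf).herm a e
  simpa [frow_apply] using this

lemma pos_cs_col [PartialOrder A] [StarOrderedRing A] {f : A →ₗ[ℂ] ℂ} {C : ℝ} (hC : 0 ≤ C)
    (hf : ∀ x, ‖f x‖ ≤ C * ‖x‖) (pf : PosF f) (a : A) : ‖f a‖ ^ 2 ≤ C * (f (star a * a)).re := by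
  have := pos_cs_row hC hf pf (star a)
  rwa [posF_star hf pf, norm_star, star_star] at this

end P14
end GT

namespace GT
open Filter Topology

section P15
set_option linter.unusedSectionVars false
variable {A B : Type u} [NonUnitalCStarAlgebra A] [PartialOrder A] [StarOrderedRing A]
 [NonUnitalCStarAlgebra B] [PartialOrder B] [StarOrderedRing B]
 {X : Type u} [NormedAddCommGroup X] [NormedSpace ℂ X]
 {NA : ∀ p : ℕ, Matrix (Fin p) (Fin p) A → ℝ} {NB : ∀ q : ℕ, Matrix (Fin q) (Fin q) B → ℝ}
 {ι : A ⊗[ℂ] B →ₗ[ℂ] X}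

lemma ext_exists (hn : ∀ t, ‖ι t‖ = osProjNorm NA NB t) (hd : DenseRange ι)
    {T : A →ₗ[ℂ] B →ₗ[ℂ] ℂ} {C : ℝ}
    (hT : ∀ t, ‖TensorProduct.lift T t‖ ≤ C * osProjNorm NA NB t) :
    ∃ L : X →L[ℂ] ℂ, (∀ t, L (ι t) = TensorProduct.lift T t) ∧ ∀ x, ‖L x‖ ≤ C * ‖x‖ := by
  have h : ∀ t, ‖TensorProduct.lift T t‖ ≤ C * ‖ι t‖ := fun t => by rw [hn]; exact hT t
  exact ⟨(TensorProduct.lift T).extendOfNorm ι, LinearMap.extendOfNorm_eq hd ⟨C, h⟩,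
    LinearMap.norm_extendOfNorm_apply_le hd C h⟩

def pf (φ : A →ₗ[ℂ] ℂ) (ψ : B →ₗ[ℂ] ℂ) : A →ₗ[ℂ] B →ₗ[ℂ] ℂ := (LinearMap.mul ℂ ℂ).compl₁₂ φ ψ

lemma pf_apply (φ : A →ₗ[ℂ] ℂ) (ψ : B →ₗ[ℂ] ℂ) (a : A) (b : B) : pf φ ψ a b = φ a * ψ b := rfl

lemma prod_ext (hNA : ∀ p, IsCStarNorm (NA p)) (hNB : ∀ q, IsCStarNorm (NB q))
    (hn : ∀ t, ‖ι t‖ = osProjNorm NA NB t) (hd : DenseRange ι)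
    {J : Submodule ℂ A} {J' : Submodule ℂ B}
    {φ : A →ₗ[ℂ] ℂ} {ψ : B →ₗ[ℂ] ℂ} (hφ : PV J φ) (hψ : PV J' ψ) :
    ∃ L : X →L[ℂ] ℂ, ∀ a b, L (ι (a ⊗ₜ[ℂ] b)) = φ a * ψ b := by
  obtain ⟨⟨C, hC, hf⟩, pφ, -⟩ := hφ
  obtain ⟨⟨D, hD, hg⟩, pψ, -⟩ := hψ
  have hC0 : 0 ≤ C ^ 2 * D ^ 2 := by positivity
  have hE : 0 ≤ (1 + C ^ 2) * (1 + D ^ 2) := by positivity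
  have h1 : ∀ x, ‖(((C : ℝ) : ℂ) • φ) x‖ ≤ (1 + C ^ 2) * (1 + D ^ 2) * ‖x‖ := by
    intro x
    rw [LinearMap.smul_apply, norm_smul, Complex.norm_real, Real.norm_of_nonneg hC]
    calc _ ≤ C * (C * ‖x‖) := by gcongr; exact hf x
      _ = C ^ 2 * 1 * ‖x‖ := by ring
      _ ≤ _ := by gcongr <;> nlinarith [sq_nonneg D]
  have h2 : ∀ x, ‖(((D : ℝ) : ℂ) • ψ) x‖ ≤ (1 + C ^ 2) * (1 + D ^ 2) * ‖x‖ := by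
    intro x
    rw [LinearMap.smul_apply, norm_smul, Complex.norm_real, Real.norm_of_nonneg hD]
    calc _ ≤ D * (D * ‖x‖) := by gcongr; exact hg x
      _ = 1 * D ^ 2 * ‖x‖ := by ring
      _ ≤ _ := by gcongr <;> nlinarith [sq_nonneg C]
  have h3 : PosF (((C : ℝ) : ℂ) • φ) := by
    intro x
    have := pφ x
    simp only [LinearMap.smul_apply, smul_eq_mul, Complex.re_ofReal_mul, Complex.im_ofReal_mul, this.2]
    exact ⟨mul_nonneg hC this.1, by simp⟩
  have h4 : PosF (((D : ℝ) : ℂ) • ψ) := by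
    intro x
    have := pψ x
    simp only [LinearMap.smul_apply, smul_eq_mul, Complex.re_ofReal_mul, Complex.im_ofReal_mul, this.2]
    exact ⟨mul_nonneg hD this.1, by simp⟩
  have h5 : ∀ a b, ‖pf φ ψ a b‖ ^ 2 ≤ ((((C : ℝ) : ℂ) • φ) (a * star a)).re * ((((D : ℝ) : ℂ) • ψ) (star b * b)).re := by
    intro a b
    simp only [LinearMap.smul_apply, smul_eq_mul, Complex.re_ofReal_mul, pf_apply, norm_mul, mul_pow]
    exact mul_le_mul (pos_cs_row hC hf pφ a) (pos_cs_col hD hg pψ b) (by positivity)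
      ((by positivity : (0:ℝ) ≤ ‖φ a‖ ^ 2).trans (pos_cs_row hC hf pφ a))
  have key := ext_exists (T := pf φ ψ) hn hd (os_le hNA hNB (pf φ ψ) (C := (1 + C ^ 2) * (1 + D ^ 2)) hE
    (fun p q α v w β => rc_bound (f := ((C : ℝ) : ℂ) • φ) (g := ((D : ℝ) : ℂ) • ψ) hE h1 h2 h3 h4
      (pf φ ψ) h5 α v w β))
  obtain ⟨L, h1, -⟩ := key
  exact ⟨L, fun a b => by rw [h1]; simp [pf_apply]⟩

lemma ext_unique (hd : DenseRange ι) {L L' : X →L[ℂ] ℂ}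
    (h : ∀ a b, L (ι (a ⊗ₜ[ℂ] b)) = L' (ι (a ⊗ₜ[ℂ] b))) : L = L' := by
  have h1 : L.toLinearMap ∘ₗ ι = L'.toLinearMap ∘ₗ ι := by
    apply TensorProduct.ext'
    exact h
  ext x
  refine congrFun (hd.equalizer L.continuous L'.continuous ?_) x
  ext t
  exact LinearMap.congr_fun h1 t

/-- `x` is killed by all products of positive functionals. -/
def Killed (ι : A ⊗[ℂ] B →ₗ[ℂ] X) (J : Submodule ℂ A) (J' : Submodule ℂ B) (x : X) : Prop :=
  ∀ φ ψ, PV J φ → PV J' ψ → ∀ L : X →L[ℂ] ℂ, (∀ a b, L (ι (a ⊗ₜ[ℂ] b)) = φ a * ψ b) → L x = 0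

lemma killed_sum (hNA : ∀ p, IsCStarNorm (NA p)) (hNB : ∀ q, IsCStarNorm (NB q))
    (hn : ∀ t, ‖ι t‖ = osProjNorm NA NB t) (hd : DenseRange ι)
    {J : Submodule ℂ A} {J' : Submodule ℂ B} {x : X} (hx : Killed ι J J' x)
    {I : Type*} [Fintype I] (c : I → ℂ) (F : I → A →ₗ[ℂ] ℂ) (G : I → B →ₗ[ℂ] ℂ)
    (hF : ∀ i, PV J (F i)) (hG : ∀ i, PV J' (G i)) (L : X →L[ℂ] ℂ)
    (hL : ∀ a b, L (ι (a ⊗ₜ[ℂ] b)) = ∑ i, c i * (F i a * G i b)) : L x = 0 := by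
  choose M hM using fun i => prod_ext hNA hNB hn hd (hF i) (hG i)
  have : L = ∑ i, c i • M i := by
    refine ext_unique hd fun a b => ?_
    simp [hL, hM]
  rw [this]
  simp only [FunLike.coe_sum, Finset.sum_apply, FunLike.coe_smul, Pi.smul_apply]
  exact Finset.sum_eq_zero fun i _ => by rw [hx _ _ (hF i) (hG i) _ (hM i), smul_zero]

lemma killed_TT (hNA : ∀ p, IsCStarNorm (NA p)) (hNB : ∀ q, IsCStarNorm (NB q))
    (hn : ∀ t, ‖ι t‖ = osProjNorm NA NB t) (hd : DenseRange ι)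
    {J : Submodule ℂ A} {J' : Submodule ℂ B} {x : X} (hx : Killed ι J J' x)
    {S : A →ₗ[ℂ] A →ₗ⋆[ℂ] ℂ} {R : B →ₗ[ℂ] B →ₗ⋆[ℂ] ℂ}
    (hS : ∀ e, ∃ (c : Fin 4 → ℂ) (F : Fin 4 → A →ₗ[ℂ] ℂ), (∀ k, PV J (F k)) ∧
      ∀ a, S a e = ∑ k, c k * F k a)
    (hR : ∀ e, ∃ (c : Fin 4 → ℂ) (F : Fin 4 → B →ₗ[ℂ] ℂ), (∀ k, PV J' (F k)) ∧
      ∀ a, R a e = ∑ k, c k * F k a)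
    {I : Type*} [Fintype I] (e : I → A) (w : I → B) (ρ : I → ℝ) (L : X →L[ℂ] ℂ)
    (hL : ∀ t, L (ι t) = TensorProduct.lift (TT S R e w ρ) t) : L x = 0 := by
  choose c F hF hc using hS
  choose d G hG hd' using hR
  refine killed_sum hNA hNB hn hd hx (I := I × Fin 4 × Fin 4)
    (fun z => ρ z.1 * (c (e z.1) z.2.1 * d (w z.1) z.2.2))
    (fun z => F (e z.1) z.2.1) (fun z => G (w z.1) z.2.2) (fun z => hF _ _) (fun z => hG _ _) L ?_
  intro a b
  rw [hL, TensorProduct.lift.tmul, TT_apply]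
  simp only [Fintype.sum_prod_type]
  refine Finset.sum_congr rfl fun i _ => ?_
  rw [hc, hd', Finset.sum_mul_sum, Finset.mul_sum]
  refine Finset.sum_congr rfl fun k _ => ?_
  rw [Finset.mul_sum]
  refine Finset.sum_congr rfl fun l _ => ?_
  ring

lemma u_osgt (hNA : ∀ p, IsCStarNorm (NA p)) (hNB : ∀ q, IsCStarNorm (NB q))
    (hn : ∀ t, ‖ι t‖ = osProjNorm NA NB t) {u : X →L[ℂ] ℂ} (hu : ‖u‖ ≤ 1)
    (N : ℕ) (s : Fin N → ℝ) (hs : ∑ i, s i ^ 2 ≤ 1)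
      (P : CStarMatrix (Fin N) (Fin N) A) (Y : CStarMatrix (Fin N) (Fin N) B) :
      ‖∑ y, ∑ x, ((s y * s x : ℝ) : ℂ) * u (ι (P y x ⊗ₜ[ℂ] Y y x))‖ ≤ ‖P‖ * ‖Y‖ := by
  have e : ∑ y, ∑ x, ((s y * s x : ℝ) : ℂ) * u (ι (P y x ⊗ₜ[ℂ] Y y x)) =
      u (ι (∑ y, ∑ x, ((s y * s x : ℝ) : ℂ) • (P y x ⊗ₜ[ℂ] Y y x))) := by
    simp
  have e2 : ∑ y, ∑ x, ((s y * s x : ℝ) : ℂ) • (P y x ⊗ₜ[ℂ] Y y x) =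
      ∑ ik : Fin N × Fin N, ∑ jl : Fin N × Fin N,
        ((if ik.1 = ik.2 then (s ik.1 : ℂ) else 0) * (if jl.1 = jl.2 then (s jl.1 : ℂ) else 0)) •
          (P ik.1 jl.1 ⊗ₜ[ℂ] Y ik.2 jl.2) := by
    simp only [Fintype.sum_prod_type]
    refine Finset.sum_congr rfl fun i _ => ?_
    refine Eq.trans ?_ (Finset.sum_eq_single i (fun k _ hk => ?_) (by simp)).symm
    · refine Finset.sum_congr rfl fun j _ => ?_
      refine Eq.trans ?_ (Finset.sum_eq_single j (fun k _ hk => ?_) (by simp)).symm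
      · simp
      · simp [hk.symm]
    · simp [hk.symm]
  have e3 : ∑ ik : Fin N × Fin N, ‖(if ik.1 = ik.2 then (s ik.1 : ℂ) else 0)‖ ^ 2 = ∑ i, s i ^ 2 := by
    simp only [Fintype.sum_prod_type]
    refine Finset.sum_congr rfl fun i _ => ?_
    rw [Finset.sum_eq_single i (fun k _ hk => ?_) (by simp)]
    · simp
    · simp [hk.symm]
  have h1 := le_os hNA hNB _ _ P Y _ e2
  rw [e3] at h1
  have h2 : √(∑ i, s i ^ 2) ≤ 1 := Real.sqrt_le_one.2 hs
  have h3 := Real.sqrt_nonneg (∑ i, s i ^ 2)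
  rw [e]
  calc _ ≤ 1 * ‖ι (∑ y, ∑ x, ((s y * s x : ℝ) : ℂ) • (P y x ⊗ₜ[ℂ] Y y x))‖ := u.le_of_opNorm_le hu _
    _ ≤ √(∑ i, s i ^ 2) * ‖P‖ * ‖Y‖ * √(∑ i, s i ^ 2) := by rw [one_mul, hn]; exact h1
    _ ≤ 1 * ‖P‖ * ‖Y‖ * 1 := by gcongr
    _ = _ := by ring

lemma propG (hNA : ∀ p, IsCStarNorm (NA p)) (hNB : ∀ q, IsCStarNorm (NB q))
    (hn : ∀ t, ‖ι t‖ = osProjNorm NA NB t) (hd : DenseRange ι)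
    {J : Submodule ℂ A} {J' : Submodule ℂ B} (hJ : IsSI J) (hJ' : IsSI J')
    {x : X} (hx : Killed ι J J' x) {u : X →L[ℂ] ℂ} (hu : ‖u‖ ≤ 1)
    (uJ : ∀ a ∈ J, ∀ b, u (ι (a ⊗ₜ[ℂ] b)) = 0) (uJ' : ∀ a, ∀ b ∈ J', u (ι (a ⊗ₜ[ℂ] b)) = 0) :
    u x = 0 := by
  set U : A →ₗ[ℂ] B →ₗ[ℂ] ℂ := TensorProduct.curry (u.toLinearMap ∘ₗ ι) with hU
  have Uap : ∀ a b, U a b = u (ι (a ⊗ₜ[ℂ] b)) := fun a b => rfl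
  have Ul : ∀ t, TensorProduct.lift U t = u (ι t) := fun t => by
    have : TensorProduct.lift U = u.toLinearMap ∘ₗ ι := TensorProduct.ext' fun a b => rfl
    rw [this]; rfl
  obtain ⟨f₁, f₂, g₁, g₂, F1, F2, G1, G2, h⟩ := osgt (u := U)
    (fun N s _ hs P Y => u_osgt hNA hNB hn hu N s hs P Y) hJ hJ' uJ uJ'
  have est : ∀ t : A ⊗[ℂ] B, ‖u (ι t)‖ ≤ 8 * (4 * (80000 * ‖ι t - x‖)) := by
    intro t
    refine le_of_forall_pos_le_add fun ε hε => ?_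
    obtain ⟨I, _, e, w, ρ, hT, K, _, a, b, ht, ha, hb⟩ :=
      lemD (frow_psd F1.2.1) (fcol_psd G2.2.1) t (ε := ε / 32) (by positivity)
    obtain ⟨I', _, e', w', ρ', hT', K', _, c, d, ht', hc, hd'⟩ :=
      lemD (fcol_psd F2.2.1) (frow_psd G1.2.1) t (ε := ε / 32) (by positivity)
    have main := stepS (S₁ := frow f₁) (S₂ := fcol f₂) (fcol_psd G2.2.1) (frow_psd G1.2.1) U h a b c d t ht ht'
    rw [Ul] at main
    have b1 : (TensorProduct.lift (TT (frow f₁) (fcol g₂) e w ρ) t).re ≤ 80000 * ‖ι t - x‖ := by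
      obtain ⟨L, hL, hLb⟩ := ext_exists hn hd (os_le hNA hNB _ (by norm_num) (fun p q α v w β =>
        rc_bound (by norm_num) F1.1 G2.1 F1.2.1 G2.2.1 _ hT α v w β))
      have := killed_TT hNA hNB hn hd hx (fun e => polar_row hJ F1.pv e)
        (fun e => polar_col hJ' G2.pv e) e w ρ L hL
      rw [← hL, ← sub_zero (L (ι t)), ← this, ← map_sub]
      exact (Complex.re_le_norm _).trans (hLb _)
    have b2 : (TensorProduct.lift (TT (fcol f₂) (frow g₁) e' w' ρ') t).re ≤ 80000 * ‖ι t - x‖ := by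
      obtain ⟨L, hL, hLb⟩ := ext_exists hn hd (os_le hNA hNB _ (by norm_num) (fun p q α v w β =>
        cr_bound (by norm_num) F2.1 G1.1 F2.2.1 G1.2.1 _ hT' α v w β))
      have := killed_TT hNA hNB hn hd hx (fun e => polar_col hJ F2.pv e)
        (fun e => polar_row hJ' G1.pv e) e' w' ρ' L hL
      rw [← hL, ← sub_zero (L (ι t)), ← this, ← map_sub]
      exact (Complex.re_le_norm _).trans (hLb _)
    linarith
  have hcl : ∀ y : X, ‖u y‖ ≤ 8 * (4 * (80000 * ‖y - x‖)) := by
    intro y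
    refine hd.induction_on (p := fun y => ‖u y‖ ≤ 8 * (4 * (80000 * ‖y - x‖))) y ?_ est
    exact isClosed_le (by fun_prop) (by fun_prop)
  have := hcl x
  simpa using this

end P15
end GT

namespace GT
open Filter Topology

section P16
set_option linter.unusedSectionVars false

lemma sublin_diff {I : Type} [Fintype I] [DecidableEq I] (M : (I → ℝ) → ℝ) {C : ℝ} (hC : 0 ≤ C)
    (hadd : ∀ x y, M (x + y) ≤ M x + M y) (hb : ∀ x, M x ≤ C * ‖x‖)
    (hhom : ∀ (t : ℝ) x, 0 < t → M (t • x) = t * M x)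
    (l : I → ℝ) {κ η : ℝ} (hκ : 0 < κ) (hη : 0 < η) (hl : κ ≤ M l) :
    ∃ (ε lam : I → ℝ) (ζ : ℝ), 0 < ζ ∧ ζ * η / 2 < M ε ∧ κ - η ≤ ∑ i, l i * lam i ∧
      ∀ i, M (ε + ζ • Pi.single i 1) ≤ M ε + ζ * lam i + ζ * η / 2 ∧
        M (ε - ζ • Pi.single i 1) ≤ M ε - ζ * lam i + ζ * η / 2 := by
  have hsub : ∀ x y, M x - M y ≤ C * ‖x - y‖ := by
    intro x y
    have := hadd (x - y) y
    rw [sub_add_cancel] at this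
    linarith [hb (x - y)]
  have hlip : LipschitzWith ⟨C, hC⟩ M := by
    apply LipschitzWith.of_dist_le_mul
    intro x y
    rw [Real.dist_eq, dist_eq_norm, abs_le]
    have h1 := hsub x y
    have h2 := hsub y x
    rw [norm_sub_rev] at h2
    change _ ≤ _ ∧ _ ≤ C * _
    change -(C * _) ≤ _ ∧ _
    constructor <;> linarith
  have hd := MeasureTheory.Measure.dense_of_ae
    (hlip.ae_differentiableAt (μ := MeasureTheory.volume))
  obtain ⟨r, hr, hrC⟩ : ∃ r : ℝ, 0 < r ∧ 2 * (C * r) < min η κ := by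
    have hm : 0 < min η κ := lt_min hη hκ
    refine ⟨min η κ / (2 * (C + 1)), by positivity, ?_⟩
    rw [← mul_assoc, ← mul_div_assoc, div_lt_iff₀ (by positivity)]
    nlinarith
  obtain ⟨ε, hε, hdist⟩ := hd.exists_dist_lt l hr
  rw [dist_eq_norm] at hdist
  have hε : DifferentiableAt ℝ M ε := hε
  set D := fderiv ℝ M ε with hD
  have hDf : HasFDerivAt M D ε := hε.hasFDerivAt
  have hDn : ‖D‖ ≤ C := norm_fderiv_le_of_lipschitz ℝ hlip
  have hCr : C * ‖l - ε‖ ≤ C * r := mul_le_mul_of_nonneg_left hdist.le hC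
  have hDl : ∀ v : I → ℝ, D v = ∑ i, v i * D (Pi.single i 1) := by
    intro v
    conv_lhs => rw [← Finset.univ_sum_single v]
    rw [map_sum]
    refine Finset.sum_congr rfl fun i _ => ?_
    rw [← smul_eq_mul, ← map_smul]
    congr 1
    rw [← Pi.single_smul]; simp
  have hEuler : D ε = M ε := by
    have h1 : HasDerivAt (fun t : ℝ => M (t • ε)) (D ε) 1 := by
      have hs : HasDerivAt (fun t : ℝ => t • ε) ((1:ℝ) • ε) 1 :=
        (hasDerivAt_id (1:ℝ)).smul_const ε
      have h := HasFDerivAt.comp_hasDerivAt (1:ℝ) (f := fun t : ℝ => t • ε) (l := M) (l' := D)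
        (by simpa using hDf) hs
      rw [one_smul] at h
      exact h
    have h2 : HasDerivAt (fun t : ℝ => t * M ε) (M ε) 1 := by
      simpa using (hasDerivAt_id (1:ℝ)).mul_const (M ε)
    have h3 : (fun t : ℝ => M (t • ε)) =ᶠ[𝓝 1] (fun t : ℝ => t * M ε) := by
      filter_upwards [lt_mem_nhds (zero_lt_one (α := ℝ))] with t ht
      exact hhom t ε ht
    exact (h2.congr_of_eventuallyEq h3).unique h1 |>.symm
  have hMl := hsub l ε
  have hMε : κ - C * r ≤ M ε := by linarith
  have hmin1 := min_le_left η κ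
  have hmin2 := min_le_right η κ
  have hMpos : 0 < M ε := by
    have : 0 ≤ C * r := by positivity
    linarith
  have hlo := hDf.isLittleO.def (show (0:ℝ) < η / 2 by linarith)
  rw [Metric.eventually_nhds_iff] at hlo
  obtain ⟨ρ, hρ, hball⟩ := hlo
  obtain ⟨ζ, hζ, hζρ, hζM⟩ : ∃ ζ : ℝ, 0 < ζ ∧ ζ < ρ ∧ ζ * η / 2 < M ε := by
    refine ⟨min (ρ / 2) (M ε / η), by positivity, ?_, ?_⟩
    · exact (min_le_left _ _).trans_lt (by linarith)
    · have := min_le_right (ρ / 2) (M ε / η)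
      have h2 : min (ρ / 2) (M ε / η) * η ≤ M ε := by
        rwa [← le_div_iff₀ hη]
      linarith
  refine ⟨ε, fun i => D (Pi.single i 1), ζ, hζ, hζM, ?_, fun i => ?_⟩
  · rw [← hDl]
    have h1 : D l = M ε + D (l - ε) := by rw [map_sub, hEuler]; ring
    have h2 : |D (l - ε)| ≤ C * ‖l - ε‖ :=
      (D.le_opNorm _).trans (mul_le_mul_of_nonneg_right hDn (norm_nonneg _))
    have := (abs_le.1 h2).1
    linarith
  · have hn : ‖(Pi.single i (1:ℝ) : I → ℝ)‖ = 1 := by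
      rw [Pi.norm_single]; simp
    have key : ∀ s : ℝ, |s| = ζ → M (ε + s • Pi.single i 1) ≤ M ε + s * D (Pi.single i 1) + ζ * η / 2 := by
      intro s hs
      have := hball (y := ε + s • Pi.single i 1) (by
        rw [dist_eq_norm, add_sub_cancel_left, norm_smul, hn, Real.norm_eq_abs, hs, mul_one]
        exact hζρ)
      rw [add_sub_cancel_left, norm_smul, hn, Real.norm_eq_abs, Real.norm_eq_abs, hs, mul_one, map_smul,
        smul_eq_mul] at this
      have := (abs_le.1 this).2
      linarith
    constructor
    · exact key ζ (abs_of_pos hζ)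
    · have := key (-ζ) (by rw [abs_neg, abs_of_pos hζ])
      rw [neg_smul, ← sub_eq_add_neg] at this
      linarith


section
variable {U : Type u} [CStarAlgebra U] [PartialOrder U] [StarOrderedRing U]

def upr (y : U) : ℝ := sInf {r : ℝ | 0 ≤ r ∧ y ≤ algebraMap ℝ U r}

lemma upr_bdd (y : U) : BddBelow {r : ℝ | 0 ≤ r ∧ y ≤ algebraMap ℝ U r} := ⟨0, fun _ h => h.1⟩

lemma upr_ne {y : U} (hy : IsSelfAdjoint y) : {r : ℝ | 0 ≤ r ∧ y ≤ algebraMap ℝ U r}.Nonempty :=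
  ⟨‖y‖, norm_nonneg _, hy.le_algebraMap_norm_self⟩

lemma upr_le {y : U} {r : ℝ} (hr : 0 ≤ r) (h : y ≤ algebraMap ℝ U r) : upr y ≤ r :=
  csInf_le (upr_bdd y) ⟨hr, h⟩

lemma upr_nonneg (y : U) : 0 ≤ upr y := Real.sInf_nonneg fun _ h => h.1

lemma le_upr {y : U} (hy : IsSelfAdjoint y) : y ≤ algebraMap ℝ U (upr y) := by
  refine le_algebraMap_of_spectrum_le (fun t ht => ?_) hy
  refine le_csInf (upr_ne hy) fun r hr => ?_
  exact (le_algebraMap_iff_spectrum_le hy).1 hr.2 t ht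

lemma upr_add {x y : U} (hx : IsSelfAdjoint x) (hy : IsSelfAdjoint y) :
    upr (x + y) ≤ upr x + upr y := by
  refine upr_le (add_nonneg (upr_nonneg _) (upr_nonneg _)) ?_
  rw [map_add]
  exact add_le_add (le_upr hx) (le_upr hy)

lemma upr_le_norm {y : U} (hy : IsSelfAdjoint y) : upr y ≤ ‖y‖ :=
  upr_le (norm_nonneg _) hy.le_algebraMap_norm_self

lemma upr_smul_le {y : U} (hy : IsSelfAdjoint y) {t : ℝ} (ht : 0 ≤ t) :
    upr (t • y) ≤ t * upr y := by
  refine upr_le (mul_nonneg ht (upr_nonneg _)) ?_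
  rw [map_mul, ← Algebra.smul_def]
  exact smul_le_smul_of_nonneg_left (le_upr hy) ht

lemma upr_smul {y : U} (hy : IsSelfAdjoint y) {t : ℝ} (ht : 0 < t) :
    upr (t • y) = t * upr y := by
  refine le_antisymm (upr_smul_le hy ht.le) ?_
  have h := upr_smul_le ((IsSelfAdjoint.all t).smul hy) (inv_nonneg.2 ht.le)
  rw [inv_smul_smul₀ ht.ne'] at h
  calc t * upr y ≤ t * (t⁻¹ * upr (t • y)) := mul_le_mul_of_nonneg_left h ht.le
    _ = _ := by rw [mul_inv_cancel_left₀ ht.ne']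

/-- spectral localisation near the top -/
lemma top_local {k : U} (hk : IsSelfAdjoint k) {δ : ℝ} (hδ : 0 < δ) (hm : δ < upr k) :
    ∃ f g : ℝ → ℝ, Continuous f ∧ Continuous g ∧ f 0 = 0 ∧ g 0 = 0 ∧ (∀ t, g t * f t = g t) ∧
      (∀ t, 0 ≤ f t ∧ f t ≤ 1) ∧ cfc g k ≠ 0 ∧
      (upr k - δ) • (cfc f k * cfc f k) ≤ cfc f k * k * cfc f k := by
  set m := upr k with hmdef
  let f : ℝ → ℝ := fun t => max 0 (min 1 ((t - (m - δ)) / (δ / 2)))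
  let g : ℝ → ℝ := fun t => max 0 (t - (m - δ / 2))
  have hf : Continuous f := by fun_prop
  have hg : Continuous g := by fun_prop
  have hfz : ∀ t, t ≤ m - δ → f t = 0 := by
    intro t ht
    apply max_eq_left
    refine (min_le_right _ _).trans ?_
    exact div_nonpos_of_nonpos_of_nonneg (by linarith) (by linarith)
  have hf0 : f 0 = 0 := hfz 0 (by linarith)
  have hg0 : g 0 = 0 := max_eq_left (by linarith)
  have hfp : ∀ t, 0 ≤ f t ∧ f t ≤ 1 := fun t =>
    ⟨le_max_left _ _, max_le zero_le_one (min_le_left _ _)⟩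
  refine ⟨f, g, hf, hg, hf0, hg0, ?_, hfp, ?_, ?_⟩
  · intro t
    rcases le_or_gt t (m - δ / 2) with h | h
    · have : g t = 0 := max_eq_left (by linarith)
      rw [this, zero_mul]
    · have : f t = 1 := by
        have h1 : min 1 ((t - (m - δ)) / (δ / 2)) = 1 := by
          apply min_eq_left
          rw [le_div_iff₀ (by linarith)]
          linarith
        change max 0 (min 1 ((t - (m - δ)) / (δ / 2))) = 1
        rw [h1]; exact max_eq_right zero_le_one
      rw [this, mul_one]
  · intro h0
    have h1 : (spectrum ℝ k).EqOn g 0 := by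
      rw [← cfc_zero ℝ k] at h0
      exact (cfc_eq_cfc_iff_eqOn hk hg.continuousOn continuousOn_const).1 h0
    have h2 : k ≤ algebraMap ℝ U (m - δ / 2) := by
      refine le_algebraMap_of_spectrum_le (fun t ht => ?_) hk
      have := h1 ht
      have h3 : t - (m - δ / 2) ≤ g t := le_max_right _ _
      rw [this] at h3
      simp only [Pi.zero_apply] at h3
      linarith
    have := upr_le (by linarith) h2
    linarith
  · have e1 : cfc f k * k * cfc f k = cfc (fun t => f t * t * f t) k := by
      conv_lhs => rw [← cfc_id' ℝ k hk, cfc_id' ℝ k hk]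
      have : cfc (fun t : ℝ => t) k = k := cfc_id' ℝ k hk
      rw [cfc_mul (fun t => f t * t) f k (hf.mul continuous_id).continuousOn hf.continuousOn,
        cfc_mul f (fun t => t) k hf.continuousOn continuous_id.continuousOn, this]
    have e2 : (m - δ) • (cfc f k * cfc f k) = cfc (fun t => (m - δ) • (f t * f t)) k := by
      rw [cfc_smul (m - δ) (fun t => f t * f t) k (hf.mul hf).continuousOn,
        cfc_mul f f k hf.continuousOn hf.continuousOn]
    rw [e1, e2]
    refine cfc_mono (fun t _ => ?_) (by fun_prop) (by fun_prop)
    simp only [smul_eq_mul]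
    rcases le_or_gt t (m - δ) with h | h
    · rw [hfz t h]; simp
    · have := mul_nonneg (sub_nonneg.2 h.le) (mul_self_nonneg (f t))
      linarith

lemma norm_le_of_sandwich {y c : U} {η : ℝ} (hη : 0 ≤ η) (hy : IsSelfAdjoint y)
    (hc : c ≤ algebraMap ℝ U 1)
    (h1 : y ≤ η • c) (h2 : -(η • c) ≤ y) : ‖y‖ ≤ η := by
  have h3 : y ≤ algebraMap ℝ U η := h1.trans (by
    have := smul_le_smul_of_nonneg_left hc hη
    rwa [Algebra.algebraMap_eq_smul_one, one_smul, ← Algebra.algebraMap_eq_smul_one] at this)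
  have h4 : algebraMap ℝ U (-η) ≤ y := le_trans (by
    have := smul_le_smul_of_nonneg_left hc hη
    rw [Algebra.algebraMap_eq_smul_one, one_smul, ← Algebra.algebraMap_eq_smul_one] at this
    rw [map_neg]
    exact neg_le_neg this) h2
  rcases subsingleton_or_nontrivial U with hU | hU
  · rw [Subsingleton.elim y 0, norm_zero]; exact hη
  have := cfc_id' ℝ y hy
  rw [← this]
  refine norm_cfc_le hη fun t ht => ?_
  rw [Real.norm_eq_abs, abs_le]
  exact ⟨(algebraMap_le_iff_le_spectrum hy).1 h4 t ht, (le_algebraMap_iff_spectrum_le hy).1 h3 t ht⟩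

end

end P16
end GT

namespace GT
open Filter Topology

section P17
set_option linter.unusedSectionVars false

lemma sa_csmul {Q : Type u} [NonUnitalCStarAlgebra Q] {x : Q} (hx : IsSelfAdjoint x) (r : ℝ) :
    IsSelfAdjoint ((r : ℂ) • x) := by
  change star _ = _
  rw [star_smul, hx.star_eq]
  congr 1
  exact Complex.conj_ofReal r

lemma rsmul_eq {U : Type u} [CStarAlgebra U] (r : ℝ) (x : U) : (r : ℂ) • x = r • x :=
  (RCLike.real_smul_eq_coe_smul (K := ℂ) r x).symm

lemma le_upr_of_state {Q : Type u} [NonUnitalCStarAlgebra Q] [PartialOrder (Unitization ℂ Q)]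
    [StarOrderedRing (Unitization ℂ Q)] {φ : Q →ₗ[ℂ] ℂ} (hφ : ∀ y, ‖φ y‖ ≤ ‖y‖) (pf : PosF φ)
    {x : Q} (hx : IsSelfAdjoint x) : (φ x).re ≤ upr (x : Unitization ℂ Q) := by
  let _ := CStarAlgebra.spectralOrder Q
  have _ := CStarAlgebra.spectralOrderedRing Q
  have hsa : IsSelfAdjoint (x : Unitization ℂ Q) := Unitization.isSelfAdjoint_inr.2 hx
  have h1 : ‖x⁺‖ ≤ upr (x : Unitization ℂ Q) := by
    rw [CFC.posPart_def]
    refine norm_cfcₙ_le fun t ht => ?_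
    rw [Unitization.quasispectrum_eq_spectrum_inr' ℝ ℂ] at ht
    have := (le_algebraMap_iff_spectrum_le hsa).1 (le_upr hsa) t ht
    rw [Real.norm_eq_abs, abs_of_nonneg (posPart_nonneg t)]
    exact sup_le this (upr_nonneg _)
  have h2 : x = x⁺ - x⁻ := (CFC.posPart_sub_negPart x hx).symm
  obtain ⟨w, hw⟩ := CStarAlgebra.nonneg_iff_eq_star_mul_self.1 (CFC.negPart_nonneg x)
  have h3 := (pf w).1
  rw [← hw] at h3
  have h4 : (φ x).re = (φ x⁺).re - (φ x⁻).re := by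
    conv_lhs => rw [h2]
    rw [map_sub, Complex.sub_re]
  have h5 := (Complex.re_le_norm (φ x⁺)).trans (hφ _)
  linarith

lemma excision {Q : Type u} [NonUnitalCStarAlgebra Q] {I : Type} [Fintype I]
    (x : I → Q) (hx : ∀ i, IsSelfAdjoint (x i)) (φ : Q →ₗ[ℂ] ℂ) (hφ : ∀ y, ‖φ y‖ ≤ ‖y‖)
    (pf : PosF φ) (l : I → ℝ) {κ η : ℝ} (hκ : 0 < κ) (hη : 0 < η)
    (hl : κ ≤ ∑ i, l i * (φ (x i)).re) :
    ∃ (b c : Q) (lam : I → ℝ), IsSelfAdjoint b ∧ ‖b‖ ≤ 1 ∧ c ≠ 0 ∧ c * b = c ∧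
      (∀ i, ‖b * x i * b - (lam i : ℂ) • (b * b)‖ ≤ η) ∧ κ - η ≤ ∑ i, l i * lam i := by
  classical
  let _ := CStarAlgebra.spectralOrder (Unitization ℂ Q)
  have _ := CStarAlgebra.spectralOrderedRing (Unitization ℂ Q)
  let S : (I → ℝ) → Q := fun ε => ∑ i, (ε i : ℂ) • x i
  have hS : ∀ ε, IsSelfAdjoint (S ε) := fun ε => isSelfAdjoint_sum _ fun i _ => sa_csmul (hx i) _
  have hSU : ∀ ε, IsSelfAdjoint (S ε : Unitization ℂ Q) := fun ε => Unitization.isSelfAdjoint_inr.2 (hS ε)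
  have hSadd : ∀ a b, S (a + b) = S a + S b := by
    intro a b
    simp only [S, Pi.add_apply, Complex.ofReal_add, add_smul, Finset.sum_add_distrib]
  have hSsmul : ∀ (t : ℝ) a, S (t • a) = (t : ℂ) • S a := by
    intro t a
    simp only [S, Finset.smul_sum, Pi.smul_apply, smul_eq_mul, Complex.ofReal_mul, mul_smul]
  have hSsingle : ∀ i, S (Pi.single i 1) = x i := by
    intro i
    refine (Finset.sum_eq_single i ?_ ?_).trans ?_
    · intro j _ hj; rw [Pi.single_eq_of_ne hj]; simp
    · simp
    · simp
  let M : (I → ℝ) → ℝ := fun ε => upr (S ε : Unitization ℂ Q)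
  obtain ⟨ε, lam, ζ, hζ, hζM, hlam, hdiff⟩ := sublin_diff M (C := ∑ i, ‖x i‖)
    (Finset.sum_nonneg fun i _ => norm_nonneg _)
    (by
      intro a b
      change upr _ ≤ upr _ + upr _
      rw [hSadd, Unitization.inr_add]
      exact upr_add (hSU _) (hSU _))
    (by
      intro a
      refine (upr_le_norm (hSU a)).trans ?_
      rw [Unitization.norm_inr, Finset.sum_mul]
      refine norm_sum_le_of_le _ fun i _ => ?_
      rw [norm_smul, mul_comm]
      refine mul_le_mul_of_nonneg_left ?_ (norm_nonneg _)
      rw [Complex.norm_real]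
      exact norm_le_pi_norm a i)
    (by
      intro t a ht
      change upr _ = t * upr _
      rw [hSsmul, Unitization.inr_smul, rsmul_eq]
      exact upr_smul (hSU a) ht)
    l hκ hη (by
      refine hl.trans (le_trans (le_of_eq ?_) (le_upr_of_state hφ pf (hS l)))
      rw [map_sum, Complex.re_sum]
      refine Finset.sum_congr rfl fun i _ => ?_
      rw [map_smul, smul_eq_mul, Complex.re_ofReal_mul])
  have hδ : 0 < ζ * η / 2 := by positivity
  set k : Unitization ℂ Q := (S ε : Unitization ℂ Q) with hkdef
  have hk : IsSelfAdjoint k := hSU ε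
  obtain ⟨f, g, hf, hg, hf0, hg0, hgf, hf1, hgne, hlow⟩ := top_local hk hδ hζM
  have hfe : ((cfcₙ f (S ε) : Q) : Unitization ℂ Q) = cfc f k := Unitization.real_cfcₙ_eq_cfc_inr _ f hf0
  have hge : ((cfcₙ g (S ε) : Q) : Unitization ℂ Q) = cfc g k := Unitization.real_cfcₙ_eq_cfc_inr _ g hg0
  have hbsa : IsSelfAdjoint (cfc f k) := cfc_predicate f k
  have hbb : cfc f k * cfc f k ≤ algebraMap ℝ _ 1 := by
    rw [← cfc_mul f f k hf.continuousOn hf.continuousOn, map_one, ← cfc_one ℝ k hk]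
    refine cfc_mono (fun t _ => ?_) (by fun_prop) (by fun_prop)
    have := hf1 t
    simp only [Pi.one_apply]
    nlinarith
  refine ⟨cfcₙ f (S ε), cfcₙ g (S ε), lam, cfcₙ_predicate f _, ?_, ?_, ?_, ?_, hlam⟩
  · refine norm_cfcₙ_le fun t _ => ?_
    rw [Real.norm_eq_abs, abs_of_nonneg (hf1 t).1]; exact (hf1 t).2
  · intro h0
    rw [h0] at hge
    exact hgne (by rw [← hge]; simp)
  · rw [← cfcₙ_mul g f (S ε) hg.continuousOn hg0 hf.continuousOn hf0]
    congr 1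
    funext t
    exact hgf t
  · intro i
    rw [← Unitization.norm_inr (𝕜 := ℂ), Unitization.inr_sub, Unitization.inr_smul, Unitization.inr_mul,
      Unitization.inr_mul, Unitization.inr_mul, hfe, rsmul_eq]
    set b := cfc f k with hb
    set y : Unitization ℂ Q := (x i : Unitization ℂ Q) with hy
    have hysa : IsSelfAdjoint y := Unitization.isSelfAdjoint_inr.2 (hx i)
    obtain ⟨d1, d2⟩ := hdiff i
    have e1 : ((S (ε + ζ • Pi.single i 1) : Q) : Unitization ℂ Q) = k + ζ • y := by
      rw [hSadd, hSsmul, hSsingle, Unitization.inr_add, Unitization.inr_smul, rsmul_eq]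
    have e2 : ((S (ε - ζ • Pi.single i 1) : Q) : Unitization ℂ Q) = k - ζ • y := by
      rw [sub_eq_add_neg, ← neg_smul, hSadd, hSsmul, hSsingle, Unitization.inr_add, Unitization.inr_smul,
        rsmul_eq, neg_smul, ← sub_eq_add_neg]
    have up : ∀ (z : Unitization ℂ Q) (r : ℝ), IsSelfAdjoint z → upr z ≤ r → b * z * b ≤ r • (b * b) := by
      intro z r hz hr
      have h1 := hbsa.conjugate_le_conjugate (le_upr hz)
      have h2 : b * algebraMap ℝ _ (upr z) * b = upr z • (b * b) := by
        rw [Algebra.algebraMap_eq_smul_one, mul_smul_comm, mul_one, smul_mul_assoc]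
      rw [h2] at h1
      refine h1.trans (smul_le_smul_of_nonneg_right hr ?_)
      have := star_mul_self_nonneg b
      rwa [hbsa.star_eq] at this
    have u1 := up (k + ζ • y) (upr k + ζ * lam i + ζ * η / 2) (hk.add ((IsSelfAdjoint.all ζ).smul hysa)) (by rw [← e1]; exact d1)
    have u2 := up (k - ζ • y) (upr k - ζ * lam i + ζ * η / 2) (hk.sub ((IsSelfAdjoint.all ζ).smul hysa)) (by rw [← e2]; exact d2)
    have hbyb : IsSelfAdjoint (b * y * b - lam i • (b * b)) := by
      refine IsSelfAdjoint.sub ?_ ((IsSelfAdjoint.all _).smul ?_)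
      · have := hysa.conjugate b; rwa [hbsa.star_eq] at this
      · have := IsSelfAdjoint.star_mul_self b; rwa [hbsa.star_eq] at this
    have w1 : ζ • (b * y * b - lam i • (b * b)) ≤ ζ • (η • (b * b)) := by
      have := sub_le_sub u1 hlow
      have l1 : b * (k + ζ • y) * b - b * k * b = ζ • (b * y * b) := by
        rw [mul_add, add_mul, add_sub_cancel_left, mul_smul_comm, smul_mul_assoc]
      rw [l1, ← sub_smul] at this
      rw [smul_sub, sub_le_iff_le_add, smul_smul, smul_smul, ← add_smul]
      refine this.trans (le_of_eq ?_)
      congr 1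
      ring
    have w2 : ζ • (-(b * y * b - lam i • (b * b))) ≤ ζ • (η • (b * b)) := by
      have := sub_le_sub u2 hlow
      have l1 : b * (k - ζ • y) * b - b * k * b = -(ζ • (b * y * b)) := by
        rw [mul_sub, sub_mul, sub_sub_cancel_left, mul_smul_comm, smul_mul_assoc]
      rw [l1, ← sub_smul] at this
      rw [smul_neg, smul_sub, neg_sub, sub_eq_add_neg, add_comm, ← le_sub_iff_add_le, smul_smul, smul_smul, ← sub_smul]
      refine this.trans (le_of_eq ?_)
      congr 1
      ring
    have w1' := (smul_le_smul_iff_of_pos_left hζ).1 w1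
    have w2' := (smul_le_smul_iff_of_pos_left hζ).1 w2
    exact norm_le_of_sandwich hη.le hbyb hbb w1' (neg_le.1 w2')

end P17
end GT

namespace GT
open Filter Topology

section P18
set_option linter.unusedSectionVars false
variable {A : Type u} [NonUnitalCStarAlgebra A]

/-- local approximate units inside the ideal generated by `y` -/
lemma au1 (y : A) {δ : ℝ} (hδ : 0 < δ) : ∃ e h : A, e = y * star y * h ∧ IsSelfAdjoint e ∧ ‖e‖ ≤ 1 ∧
    ‖(1 : Unitization ℂ A) - (e : Unitization ℂ A)‖ ≤ 1 ∧ ‖y - e * y‖ ≤ δ := by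
  let _ := CStarAlgebra.spectralOrder (Unitization ℂ A)
  have _ := CStarAlgebra.spectralOrderedRing (Unitization ℂ A)
  let _ := CStarAlgebra.spectralOrder A
  have _ := CStarAlgebra.spectralOrderedRing A
  set a := y * star y with ha
  have hasa : IsSelfAdjoint a := IsSelfAdjoint.mul_star_self y
  set D := δ ^ 4 with hD
  have hDp : 0 < D := by positivity
  have hden : ∀ s : ℝ, 0 < D + s ^ 2 := fun s => by positivity
  let f : ℝ → ℝ := fun s => s * (s / (D + s ^ 2))
  let g : ℝ → ℝ := fun s => s / (D + s ^ 2)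
  have hg : Continuous g := continuous_id.div (by fun_prop) fun s => (hden s).ne'
  have hf : Continuous f := continuous_id.mul hg
  have hf0 : f 0 = 0 := by simp [f]
  have hg0 : g 0 = 0 := by simp [g]
  have hf1 : ∀ s, f s = 1 - D / (D + s ^ 2) := by
    intro s
    have := (hden s).ne'
    simp only [f]; field_simp; ring
  have hq : ∀ s : ℝ, 0 ≤ D / (D + s ^ 2) ∧ D / (D + s ^ 2) ≤ 1 := fun s =>
    ⟨by have := hden s; positivity, (div_le_one (hden s)).2 (by nlinarith [sq_nonneg s])⟩
  have hfe : ((cfcₙ f a : A) : Unitization ℂ A) = cfc f (a : Unitization ℂ A) :=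
    Unitization.real_cfcₙ_eq_cfc_inr _ f hf0
  have hsaU : IsSelfAdjoint (a : Unitization ℂ A) := Unitization.isSelfAdjoint_inr.2 hasa
  have h1e : (1 : Unitization ℂ A) - ((cfcₙ f a : A) : Unitization ℂ A)
      = cfc (fun s => 1 - f s) (a : Unitization ℂ A) := by
    rw [hfe, cfc_sub (fun _ => (1:ℝ)) f _ continuousOn_const hf.continuousOn]
    congr 1
    exact (cfc_const_one ℝ _ hsaU).symm
  have h1sa : IsSelfAdjoint ((1 : Unitization ℂ A) - ((cfcₙ f a : A) : Unitization ℂ A)) := by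
    rw [h1e]; exact cfc_predicate _ _
  refine ⟨cfcₙ f a, cfcₙ g a, ?_, cfcₙ_predicate f _, ?_, ?_, ?_⟩
  · rw [cfcₙ_mul (fun s => s) g a continuous_id.continuousOn rfl hg.continuousOn hg0, cfcₙ_id' ℝ a hasa]
  · refine norm_cfcₙ_le fun s _ => ?_
    rw [hf1, Real.norm_eq_abs, abs_le]
    have := hq s
    constructor <;> linarith
  · rw [h1e]
    refine norm_cfc_le zero_le_one fun s _ => ?_
    rw [hf1, Real.norm_eq_abs, abs_le]
    have := hq s
    constructor <;> linarith
  · set v := (1 : Unitization ℂ A) - ((cfcₙ f a : A) : Unitization ℂ A) with hv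
    have e1 : ((y - cfcₙ f a * y : A) : Unitization ℂ A) = v * (y : Unitization ℂ A) := by
      rw [Unitization.inr_sub, Unitization.inr_mul, hv, sub_mul, one_mul]
    have e2 : v * (y : Unitization ℂ A) * star (v * (y : Unitization ℂ A)) =
        cfc (fun s => (1 - f s) * s * (1 - f s)) (a : Unitization ℂ A) := by
      rw [cfc_mul (fun s => (1 - f s) * s) (fun s => 1 - f s) _ (by fun_prop) (by fun_prop),
        cfc_mul (fun s => (1 - f s)) (fun s => s) _ (by fun_prop) (by fun_prop), cfc_id' ℝ _ hsaU, ← h1e,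
        star_mul, h1sa.star_eq, ha, Unitization.inr_mul, Unitization.inr_star]
      simp only [mul_assoc]
    have e3 : ‖y - cfcₙ f a * y‖ * ‖y - cfcₙ f a * y‖ ≤ δ * δ := by
      rw [← Unitization.norm_inr (𝕜 := ℂ), e1, ← CStarRing.norm_self_mul_star, e2]
      refine norm_cfc_le (by positivity) fun s hs => ?_
      have hs0 : 0 ≤ s := by
        have : (0 : Unitization ℂ A) ≤ (a : Unitization ℂ A) := by
          rw [ha, Unitization.inr_mul, Unitization.inr_star]
          exact mul_star_self_nonneg _
        exact spectrum_nonneg_of_nonneg this hs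
      have q := hq s
      have q2 : s * (D / (D + s ^ 2)) ≤ δ * δ := by
        rw [← mul_div_assoc, div_le_iff₀ (hden s), hD]
        nlinarith [mul_nonneg (sq_nonneg δ) (sq_nonneg (δ ^ 2 - s)), mul_nonneg hs0 hDp.le]
      rw [hf1, sub_sub_cancel, Real.norm_eq_abs, abs_of_nonneg (by
        exact mul_nonneg (mul_nonneg q.1 hs0) q.1)]
      calc _ = (s * (D / (D + s ^ 2))) * (D / (D + s ^ 2)) := by ring
        _ ≤ (s * (D / (D + s ^ 2))) * 1 := mul_le_mul_of_nonneg_left q.2 (mul_nonneg hs0 q.1)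
        _ ≤ δ * δ := by linarith
    exact abs_le_of_sq_le_sq' (by nlinarith) hδ.le |>.2

lemma norm_sub_mul_le {e : A} (he : ‖(1 : Unitization ℂ A) - (e : Unitization ℂ A)‖ ≤ 1) (a : A) :
    ‖a - e * a‖ ≤ ‖a‖ ∧ ‖a - a * e‖ ≤ ‖a‖ := by
  constructor
  · rw [← Unitization.norm_inr (𝕜 := ℂ), Unitization.inr_sub, Unitization.inr_mul]
    have : (a : Unitization ℂ A) - e * a = (1 - e) * a := by rw [sub_mul, one_mul]
    rw [this]
    refine (norm_mul_le _ _).trans ?_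
    rw [Unitization.norm_inr]
    exact mul_le_of_le_one_left (norm_nonneg _) he
  · rw [← Unitization.norm_inr (𝕜 := ℂ), Unitization.inr_sub, Unitization.inr_mul]
    have : (a : Unitization ℂ A) - a * e = a * (1 - e) := by rw [mul_sub, mul_one]
    rw [this]
    refine (norm_mul_le _ _).trans ?_
    rw [Unitization.norm_inr]
    exact mul_le_of_le_one_right (norm_nonneg _) he

lemma mem_of_approx {V : Type*} [NormedAddCommGroup V] {S : Set V} (hS : IsClosed S) {x : V}
    (h : ∀ δ > 0, ∃ y ∈ S, ‖x - y‖ ≤ δ) : x ∈ S := by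
  rw [← hS.closure_eq, Metric.mem_closure_iff]
  intro ε hε
  obtain ⟨y, hy, hxy⟩ := h (ε / 2) (by linarith)
  exact ⟨y, hy, by rw [dist_eq_norm]; linarith⟩

lemma ideal_smul {E : TwoSidedIdeal A} (hE : IsClosed (E : Set A)) (c : ℂ) {y : A} (hy : y ∈ E) : c • y ∈ E := by
  refine mem_of_approx hE fun δ hδ => ?_
  obtain ⟨e, h, he, -, -, -, hey⟩ := au1 y (δ := δ / (‖c‖ + 1)) (by positivity)
  refine ⟨c • (e * y), ?_, ?_⟩
  · have : c • (e * y) = y * (c • (star y * h * y)) := by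
      rw [he, mul_smul_comm]; simp only [mul_assoc]
    rw [this]
    exact E.mul_mem_right _ _ hy
  · rw [← smul_sub, norm_smul]
    calc ‖c‖ * ‖y - e * y‖ ≤ (‖c‖ + 1) * (δ / (‖c‖ + 1)) := by gcongr; linarith
      _ = δ := by field_simp

lemma ideal_star {E : TwoSidedIdeal A} (hE : IsClosed (E : Set A)) {y : A} (hy : y ∈ E) : star y ∈ E := by
  refine mem_of_approx hE fun δ hδ => ?_
  obtain ⟨e, h, he, hsa, -, -, hey⟩ := au1 y (δ := δ) hδ
  refine ⟨star y * e, ?_, ?_⟩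
  · rw [he, mul_assoc]
    exact E.mul_mem_left _ _ (E.mul_mem_right _ _ hy)
  · rw [← norm_star, star_sub, star_star, star_mul, star_star, hsa.star_eq]
    exact hey

/-- closed ideals as submodules -/
def idS (E : TwoSidedIdeal A) (hE : IsClosed (E : Set A)) : Submodule ℂ A where
  carrier := (E : Set A)
  add_mem' := fun ha hb => E.add_mem ha hb
  zero_mem' := E.zero_mem
  smul_mem' := fun c _ hx => ideal_smul hE c hx

lemma mem_idS {E : TwoSidedIdeal A} {hE : IsClosed (E : Set A)} {x : A} : x ∈ idS E hE ↔ x ∈ E := Iff.rfl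

lemma idS_si (E : TwoSidedIdeal A) (hE : IsClosed (E : Set A)) : IsSI (idS E hE) where
  mul_left := fun m x hx => E.mul_mem_left m x hx
  mul_right := fun m x hx => E.mul_mem_right x m hx
  star := fun x hx => ideal_star hE hx

end P18
end GT

namespace GT
open Filter Topology

section P19
set_option linter.unusedSectionVars false
variable {A : Type u} [NonUnitalCStarAlgebra A]

def qmul {S : Submodule ℂ A} (hS : IsSI S) : A ⧸ S →ₗ[ℂ] A ⧸ S →ₗ[ℂ] A ⧸ S :=
  S.liftQ (LinearMap.flip (S.liftQ (LinearMap.flip ((LinearMap.mul ℂ A).compr₂ S.mkQ)) (by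
    intro x hx
    rw [LinearMap.mem_ker]
    ext a
    simp only [LinearMap.flip_apply, LinearMap.compr₂_apply, LinearMap.mul_apply', Submodule.mkQ_apply,
      LinearMap.zero_apply]
    exact (Submodule.Quotient.mk_eq_zero S).2 (hS.mul_left _ _ hx)))) (by
    intro x hx
    rw [LinearMap.mem_ker]
    ext a
    simp only [LinearMap.flip_apply, LinearMap.compr₂_apply, LinearMap.mul_apply', Submodule.mkQ_apply,
      LinearMap.zero_apply, LinearMap.comp_apply, Submodule.liftQ_apply]
    exact (Submodule.Quotient.mk_eq_zero S).2 (hS.mul_right _ _ hx))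

lemma qmul_mk {S : Submodule ℂ A} (hS : IsSI S) (a b : A) :
    qmul hS (Submodule.Quotient.mk a) (Submodule.Quotient.mk b) = Submodule.Quotient.mk (a * b) := rfl

def qstar {S : Submodule ℂ A} (hS : IsSI S) : A ⧸ S → A ⧸ S :=
  fun q => Quotient.liftOn' q (fun a => (Submodule.Quotient.mk (star a) : A ⧸ S)) (by
    intro a b hab
    rw [Submodule.Quotient.eq, ← star_sub]
    exact hS.star _ ((Submodule.quotientRel_def S).1 hab))

lemma qstar_mk {S : Submodule ℂ A} (hS : IsSI S) (a : A) :
    qstar hS (Submodule.Quotient.mk a) = Submodule.Quotient.mk (star a) := rfl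

@[reducible] def qring {S : Submodule ℂ A} (hS : IsSI S) (hc : IsClosed (S : Set A)) : NonUnitalNormedRing (A ⧸ S) :=
  { @Submodule.Quotient.normedAddCommGroup A _ ℂ _ _ S hc with
    mul := fun a b => qmul hS a b
    left_distrib := fun a b c => map_add (qmul hS a) b c
    right_distrib := fun a b c => LinearMap.map_add₂ (qmul hS) a b c
    zero_mul := fun a => LinearMap.map_zero₂ (qmul hS) a
    mul_zero := fun a => map_zero (qmul hS a)
    mul_assoc := by
      intro a b c
      induction a using Submodule.Quotient.induction_on
      induction b using Submodule.Quotient.induction_on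
      induction c using Submodule.Quotient.induction_on
      change qmul hS (qmul hS _ _) _ = qmul hS _ (qmul hS _ _)
      simp only [qmul_mk, mul_assoc]
    norm_mul_le := by
      intro a b
      change ‖qmul hS a b‖ ≤ _
      have key : ∀ ε > 0, ‖qmul hS a b‖ ≤ (‖a‖ + ε) * (‖b‖ + ε) := by
        intro ε hε
        obtain ⟨m, rfl, hm⟩ := Submodule.Quotient.norm_mk_lt a hε
        obtain ⟨n, rfl, hn⟩ := Submodule.Quotient.norm_mk_lt b hε
        rw [qmul_mk]
        refine (Submodule.Quotient.norm_mk_le S _).trans ((norm_mul_le _ _).trans ?_)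
        exact mul_le_mul hm.le hn.le (norm_nonneg _) ((norm_nonneg _).trans hm.le)
      have ht : Tendsto (fun ε : ℝ => (‖a‖ + ε) * (‖b‖ + ε)) (𝓝[>] 0) (𝓝 (‖a‖ * ‖b‖)) := by
        have : Continuous (fun ε : ℝ => (‖a‖ + ε) * (‖b‖ + ε)) := by fun_prop
        have h := this.tendsto 0
        simp only [add_zero] at h
        exact h.mono_left nhdsWithin_le_nhds
      exact ge_of_tendsto ht (eventually_nhdsWithin_of_forall fun ε hε => key ε hε) }

@[reducible] def qstarRing {S : Submodule ℂ A} (hS : IsSI S) (hc : IsClosed (S : Set A)) :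
    letI := qring hS hc
    StarRing (A ⧸ S) :=
  letI := qring hS hc
  { star := qstar hS
    star_involutive := by
      intro a
      induction a using Submodule.Quotient.induction_on
      change qstar hS (qstar hS _) = _
      simp only [qstar_mk, star_star]
    star_mul := by
      intro a b
      induction a using Submodule.Quotient.induction_on
      induction b using Submodule.Quotient.induction_on
      change qstar hS (qmul hS _ _) = qmul hS (qstar hS _) (qstar hS _)
      simp only [qstar_mk, qmul_mk, star_mul]
    star_add := by
      intro a b
      induction a using Submodule.Quotient.induction_on
      induction b using Submodule.Quotient.induction_on
      change qstar hS (Submodule.Quotient.mk (_ + _)) = qstar hS _ + qstar hS _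
      rw [qstar_mk, qstar_mk, qstar_mk, star_add]
      rfl }

lemma q_cstar {E : TwoSidedIdeal A} (hE : IsClosed (E : Set A)) (a : A) :
    ‖(Submodule.Quotient.mk a : A ⧸ idS E hE)‖ * ‖(Submodule.Quotient.mk a : A ⧸ idS E hE)‖ ≤
      ‖(Submodule.Quotient.mk (star a * a) : A ⧸ idS E hE)‖ := by
  refine le_of_forall_pos_le_add fun ε hε => ?_
  obtain ⟨m, hm, hmn⟩ := Submodule.Quotient.norm_mk_lt (S := idS E hE)
    (Submodule.Quotient.mk (star a * a)) (half_pos hε)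
  set y := m - star a * a with hy
  have hyE : y ∈ E := (Submodule.Quotient.eq (idS E hE)).1 hm
  obtain ⟨e, h, he, hsa, -, h1, hey⟩ := au1 y (half_pos hε)
  have heE : e ∈ E := by rw [he]; exact E.mul_mem_right _ _ (E.mul_mem_right _ _ hyE)
  have h2 : (Submodule.Quotient.mk a : A ⧸ idS E hE) = Submodule.Quotient.mk (a - a * e) := by
    rw [Submodule.Quotient.eq, sub_sub_cancel]
    exact E.mul_mem_left _ _ heE
  have h3 : ‖(Submodule.Quotient.mk a : A ⧸ idS E hE)‖ ≤ ‖a - a * e‖ := by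
    rw [h2]; exact Submodule.Quotient.norm_mk_le _ _
  have h4 : ‖a - a * e‖ * ‖a - a * e‖ ≤ ‖m‖ + ‖y - e * y‖ := by
    rw [← CStarRing.norm_star_mul_self]
    have e1 : star (a - a * e) * (a - a * e) =
        (m - e * m - (m - e * m) * e) - ((y - e * y) - (y - e * y) * e) := by
      rw [hy, star_sub, star_mul, hsa.star_eq]
      noncomm_ring
    rw [e1]
    refine (norm_sub_le _ _).trans (add_le_add ?_ ?_)
    · exact ((norm_sub_mul_le h1 _).2).trans (norm_sub_mul_le h1 _).1
    · exact (norm_sub_mul_le h1 _).2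
  calc _ ≤ ‖a - a * e‖ * ‖a - a * e‖ := mul_self_le_mul_self (norm_nonneg _) h3
    _ ≤ _ := by linarith

@[reducible] def qcstar {E : TwoSidedIdeal A} (hE : IsClosed (E : Set A)) : NonUnitalCStarAlgebra (A ⧸ idS E hE) :=
  letI i1 := qring (idS_si E hE) hE
  letI i2 := qstarRing (idS_si E hE) hE
  letI i3 : CompleteSpace (A ⧸ idS E hE) := Submodule.Quotient.completeSpace (idS E hE)
  letI i4 : CStarRing (A ⧸ idS E hE) := ⟨by
    intro a
    induction a using Submodule.Quotient.induction_on
    exact q_cstar hE _⟩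
  letI i5 : NormedSpace ℂ (A ⧸ idS E hE) :=
    { (inferInstance : Module ℂ (A ⧸ idS E hE)) with
      norm_smul_le := (Submodule.Quotient.normedSpace (idS E hE) ℂ).norm_smul_le }
  letI i6 : IsScalarTower ℂ (A ⧸ idS E hE) (A ⧸ idS E hE) := ⟨fun c x y =>
    LinearMap.map_smul₂ (qmul (idS_si E hE)) c x y⟩
  letI i7 : SMulCommClass ℂ (A ⧸ idS E hE) (A ⧸ idS E hE) := ⟨fun c x y =>
    (map_smul (qmul (idS_si E hE) x) c y).symm⟩
  letI i8 : StarModule ℂ (A ⧸ idS E hE) := ⟨by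
    intro c a
    induction a using Submodule.Quotient.induction_on
    change qstar (idS_si E hE) (Submodule.Quotient.mk (c • _)) = star c • qstar (idS_si E hE) _
    rw [qstar_mk, qstar_mk, star_smul]
    rfl⟩
  @NonUnitalCStarAlgebra.mk (A ⧸ idS E hE) i1 i2 i3 i4 i5 i6 i7 i8

theorem exists_quot (E : TwoSidedIdeal A) (hE : IsClosed (E : Set A)) :
    ∃ (Q : Type u) (_ : NonUnitalCStarAlgebra Q) (π : A →ₗ[ℂ] Q),
      (∀ a b, π (a * b) = π a * π b) ∧ (∀ a, π (star a) = star (π a)) ∧ (∀ a, π a = 0 ↔ a ∈ E) ∧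
      (∀ a, ‖π a‖ ≤ ‖a‖) ∧ (∀ q r, ‖q‖ < r → ∃ a, π a = q ∧ ‖a‖ < r) := by
  refine ⟨A ⧸ idS E hE, qcstar hE, 
    { toFun := Submodule.Quotient.mk, map_add' := fun a b => rfl, map_smul' := fun c a => rfl },
    fun a b => rfl, fun a => rfl, fun a => ?_, fun a => ?_, fun q r h => ?_⟩
  · exact Submodule.Quotient.mk_eq_zero (idS E hE)
  · exact Submodule.Quotient.norm_mk_le (idS E hE) a
  · obtain ⟨m, h1, h2⟩ := Submodule.Quotient.norm_mk_lt (S := idS E hE) q (sub_pos.2 h)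
    refine ⟨m, h1, h2.trans_le (le_of_eq ?_)⟩
    change ‖q‖ + (r - ‖q‖) = r
    ring

end P19
end GT

namespace GT
open Filter Topology

section P20
set_option linter.unusedSectionVars false
variable {A B : Type u} [NonUnitalCStarAlgebra A] [NonUnitalCStarAlgebra B]

lemma au_list (E : TwoSidedIdeal A) (L : List A) (hL : ∀ y ∈ L, y ∈ E) {δ : ℝ} (hδ : 0 < δ) :
    ∃ e ∈ E, ‖(1 : Unitization ℂ A) - (e : Unitization ℂ A)‖ ≤ 1 ∧ ∀ y ∈ L, ‖y - e * y‖ ≤ δ := by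
  induction L with
  | nil => exact ⟨0, E.zero_mem, by simp, by simp⟩
  | cons y L ih =>
    obtain ⟨e, he, h1, h2⟩ := ih fun z hz => hL z (List.mem_cons_of_mem _ hz)
    have hy : y ∈ E := hL y List.mem_cons_self
    set y' := y - e * y with hy'
    obtain ⟨e', h, he', -, -, h1', hey⟩ := au1 y' hδ
    have hyE : y' ∈ E := E.sub_mem hy (E.mul_mem_left _ _ hy)
    have heE : e' ∈ E := by rw [he']; exact E.mul_mem_right _ _ (E.mul_mem_right _ _ hyE)
    refine ⟨e + e' - e' * e, E.sub_mem (E.add_mem he heE) (E.mul_mem_left _ _ he), ?_, ?_⟩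
    · have : (1 : Unitization ℂ A) - ((e + e' - e' * e : A) : Unitization ℂ A) = (1 - e') * (1 - e) := by
        rw [Unitization.inr_sub, Unitization.inr_add, Unitization.inr_mul]
        noncomm_ring
      rw [this]
      exact (norm_mul_le _ _).trans (mul_le_one₀ h1' (norm_nonneg _) h1)
    · have key : ∀ z : A, z - (e + e' - e' * e) * z = (z - e * z) - e' * (z - e * z) := by
        intro z; noncomm_ring
      intro z hz
      rw [key]
      rcases List.mem_cons.1 hz with rfl | hz
      · exact hey
      · exact (norm_sub_mul_le h1' _).1.trans (h2 z hz)

lemma norm_le_two {e : A} (h : ‖(1 : Unitization ℂ A) - (e : Unitization ℂ A)‖ ≤ 1) : ‖e‖ ≤ 2 := by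
  rw [← Unitization.norm_inr (𝕜 := ℂ)]
  have : (e : Unitization ℂ A) = 1 - (1 - e) := by rw [sub_sub_cancel]
  rw [this]
  refine (norm_sub_le _ _).trans ?_
  rw [norm_one]; linarith

variable {X : Type u} [NonUnitalNormedRing X] [NormedSpace ℂ X] 

structure TC (ι : A ⊗[ℂ] B →ₗ[ℂ] X) : Prop where
  bd : ∀ a b, ‖ι (a ⊗ₜ b)‖ ≤ ‖a‖ * ‖b‖
  dense : DenseRange ι
  mul : ∀ a b c d, ι (a ⊗ₜ b) * ι (c ⊗ₜ d) = ι ((a * c) ⊗ₜ (b * d))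

def tsub (ι : A ⊗[ℂ] B →ₗ[ℂ] X) (S : Set A) (T : Set B) : Submodule ℂ X :=
  ((Submodule.span ℂ (Set.image2 (fun a b => a ⊗ₜ[ℂ] b) S T)).map ι).topologicalClosure

lemma tsub_closed (ι : A ⊗[ℂ] B →ₗ[ℂ] X) (S : Set A) (T : Set B) : IsClosed (tsub ι S T : Set X) :=
  Submodule.isClosed_topologicalClosure _

lemma tmul_mem {ι : A ⊗[ℂ] B →ₗ[ℂ] X} {S : Set A} {T : Set B} {a : A} {b : B} (ha : a ∈ S) (hb : b ∈ T) :
    ι (a ⊗ₜ b) ∈ tsub ι S T :=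
  Submodule.le_topologicalClosure _ (Submodule.mem_map_of_mem (Submodule.subset_span ⟨a, ha, b, hb, rfl⟩))

/-- minimality of `tsub` -/
lemma tsub_le {ι : A ⊗[ℂ] B →ₗ[ℂ] X} {S : Set A} {T : Set B} {W : Submodule ℂ X} (hW : IsClosed (W : Set X))
    (h : ∀ a ∈ S, ∀ b ∈ T, ι (a ⊗ₜ b) ∈ W) : tsub ι S T ≤ W := by
  refine Submodule.topologicalClosure_minimal _ ?_ hW
  rw [Submodule.map_le_iff_le_comap, Submodule.span_le]
  rintro _ ⟨a, ha, b, hb, rfl⟩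
  exact h a ha b hb

lemma tsub_univ {ι : A ⊗[ℂ] B →ₗ[ℂ] X} (h : TC ι) (x : X) : x ∈ tsub ι Set.univ Set.univ := by
  have h1 : Set.range ι ⊆ (tsub ι Set.univ Set.univ : Set X) := by
    rintro _ ⟨t, rfl⟩
    refine Submodule.le_topologicalClosure _ (Submodule.mem_map_of_mem ?_)
    have := TensorProduct.span_tmul_eq_top ℂ A B
    have h2 : Set.image2 (fun a b => a ⊗ₜ[ℂ] b) (Set.univ : Set A) (Set.univ : Set B) =
      {t | ∃ a b, a ⊗ₜ[ℂ] b = t} := by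
      ext t; simp [Set.mem_image2]
    rw [h2, this]; trivial
  have h3 := closure_minimal h1 (tsub_closed _ _ _)
  exact h3 (h.dense x)

/-- induction principle on `X` -/
lemma X_ind {ι : A ⊗[ℂ] B →ₗ[ℂ] X} (h : TC ι) {W : Submodule ℂ X} (hW : IsClosed (W : Set X))
    (h1 : ∀ a b, ι (a ⊗ₜ b) ∈ W) (x : X) : x ∈ W :=
  tsub_le hW (fun a _ b _ => h1 a b) (tsub_univ h x)

section
variable [IsScalarTower ℂ X X] [SMulCommClass ℂ X X]

def lmulX (x : X) : X →L[ℂ] X :=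
  LinearMap.mkContinuous { toFun := fun y => x * y, map_add' := mul_add x, map_smul' := fun c y => mul_smul_comm c x y }
    ‖x‖ fun y => norm_mul_le x y

def rmulX (x : X) : X →L[ℂ] X :=
  LinearMap.mkContinuous { toFun := fun y => y * x, map_add' := fun a b => add_mul a b x, map_smul' := fun c y => smul_mul_assoc c y x }
    ‖x‖ fun y => (norm_mul_le y x).trans (mul_comm _ _).le

@[simp] lemma lmulX_apply (x y : X) : lmulX x y = x * y := rfl
@[simp] lemma rmulX_apply (x y : X) : rmulX x y = y * x := rfl

lemma tsub_mul {ι : A ⊗[ℂ] B →ₗ[ℂ] X} (h : TC ι) {S : Set A} {T : Set B}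
    (hS : ∀ c, ∀ a ∈ S, c * a ∈ S) (hT : ∀ d, ∀ b ∈ T, d * b ∈ T) (x z : X) (hz : z ∈ tsub ι S T) :
    x * z ∈ tsub ι S T := by
  have h1 : ∀ a ∈ S, ∀ b ∈ T, ∀ x, x * ι (a ⊗ₜ b) ∈ tsub ι S T := by
    intro a ha b hb x
    refine X_ind h (W := (tsub ι S T).comap (rmulX (ι (a ⊗ₜ b))).toLinearMap)
      ((tsub_closed ι S T).preimage (rmulX _).continuous) ?_ x
    intro c d
    change ι (c ⊗ₜ d) * ι (a ⊗ₜ b) ∈ tsub ι S T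
    rw [h.mul]
    exact tmul_mem (hS _ _ ha) (hT _ _ hb)
  exact tsub_le (W := (tsub ι S T).comap (lmulX x).toLinearMap)
    ((tsub_closed ι S T).preimage (lmulX x).continuous) (fun a ha b hb => h1 a ha b hb x) hz

lemma tsub_mul' {ι : A ⊗[ℂ] B →ₗ[ℂ] X} (h : TC ι) {S : Set A} {T : Set B}
    (hS : ∀ c, ∀ a ∈ S, a * c ∈ S) (hT : ∀ d, ∀ b ∈ T, b * d ∈ T) (x z : X) (hz : z ∈ tsub ι S T) :
    z * x ∈ tsub ι S T := by
  have h1 : ∀ a ∈ S, ∀ b ∈ T, ∀ x, ι (a ⊗ₜ b) * x ∈ tsub ι S T := by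
    intro a ha b hb x
    refine X_ind h (W := (tsub ι S T).comap (lmulX (ι (a ⊗ₜ b))).toLinearMap)
      ((tsub_closed ι S T).preimage (lmulX _).continuous) ?_ x
    intro c d
    change ι (a ⊗ₜ b) * ι (c ⊗ₜ d) ∈ tsub ι S T
    rw [h.mul]
    exact tmul_mem (hS _ _ ha) (hT _ _ hb)
  exact tsub_le (W := (tsub ι S T).comap (rmulX x).toLinearMap)
    ((tsub_closed ι S T).preimage (rmulX x).continuous) (fun a ha b hb => h1 a ha b hb x) hz

end

lemma span_list {S : Submodule ℂ A} {T : Set B} {t : A ⊗[ℂ] B}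
    (ht : t ∈ Submodule.span ℂ (Set.image2 (fun a b => a ⊗ₜ[ℂ] b) (S : Set A) T)) :
    ∃ L : List (A × B), (∀ p ∈ L, p.1 ∈ S ∧ p.2 ∈ T) ∧ t = (L.map fun p => p.1 ⊗ₜ[ℂ] p.2).sum := by
  induction ht using Submodule.span_induction with
  | mem x hx =>
    obtain ⟨a, ha, b, hb, rfl⟩ := hx
    exact ⟨[(a, b)], by simpa using ⟨ha, hb⟩, by simp⟩
  | zero => exact ⟨[], by simp, by simp⟩
  | add x y _ _ hx hy =>
    obtain ⟨L, h1, rfl⟩ := hx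
    obtain ⟨L', h2, rfl⟩ := hy
    refine ⟨L ++ L', ?_, by simp⟩
    intro p hp
    rcases List.mem_append.1 hp with hp | hp
    · exact h1 p hp
    · exact h2 p hp
  | smul c x _ hx =>
    obtain ⟨L, h1, rfl⟩ := hx
    refine ⟨L.map fun p => (c • p.1, p.2), ?_, ?_⟩
    · intro p hp
      obtain ⟨q, hq, rfl⟩ := List.mem_map.1 hp
      exact ⟨S.smul_mem c (h1 q hq).1, (h1 q hq).2⟩
    · rw [List.map_map, List.smul_sum, List.map_map]
      rfl

lemma approxX {ι : A ⊗[ℂ] B →ₗ[ℂ] X} (h : TC ι) {E : TwoSidedIdeal A} {F : TwoSidedIdeal B}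
    (hE : IsClosed (E : Set A)) {z : X} (hz : z ∈ tsub ι (E : Set A) (F : Set B))
    {δ : ℝ} (hδ : 0 < δ) : ∃ e ∈ E, ∃ f ∈ F, ‖e‖ ≤ 2 ∧ ‖f‖ ≤ 2 ∧ ‖z - ι (e ⊗ₜ f) * z‖ ≤ δ := by
  have hz' : z ∈ closure ((((Submodule.span ℂ (Set.image2 (fun a b => a ⊗ₜ[ℂ] b) (E : Set A) (F : Set B))).map ι) :
      Submodule ℂ X) : Set X) := hz
  obtain ⟨_, ⟨t, ht, rfl⟩, hd⟩ := Metric.mem_closure_iff.1 hz' (δ / 10) (by positivity)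
  rw [dist_eq_norm] at hd
  obtain ⟨L, hL, hLt⟩ := span_list (S := idS E hE) ht
  set R := (L.map fun p => ‖p.2‖ + 2 * ‖p.1‖).sum with hR
  have hR0 : 0 ≤ R := List.sum_nonneg (by
    intro r hr
    obtain ⟨p, _, rfl⟩ := List.mem_map.1 hr
    positivity)
  set η := δ / (2 * (R + 1)) with hη
  have hηp : 0 < η := by positivity
  obtain ⟨e, heE, he1, he⟩ := au_list E (L.map Prod.fst) (by
    intro y hy
    obtain ⟨p, hp, rfl⟩ := List.mem_map.1 hy
    exact (hL p hp).1) hηp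
  obtain ⟨f, hfF, hf1, hf⟩ := au_list F (L.map Prod.snd) (by
    intro y hy
    obtain ⟨p, hp, rfl⟩ := List.mem_map.1 hy
    exact (hL p hp).2) hηp
  have he2 := norm_le_two he1
  have hf2 := norm_le_two hf1
  have hw : ‖ι (e ⊗ₜ f)‖ ≤ 4 := (h.bd e f).trans (by nlinarith [norm_nonneg e, norm_nonneg f])
  refine ⟨e, heE, f, hfF, he2, hf2, ?_⟩
  have key : ∀ L' : List (A × B), (∀ p ∈ L', ‖p.1 - e * p.1‖ ≤ η ∧ ‖p.2 - f * p.2‖ ≤ η) →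
      ‖ι ((L'.map fun p => p.1 ⊗ₜ[ℂ] p.2).sum) - ι (e ⊗ₜ f) * ι ((L'.map fun p => p.1 ⊗ₜ[ℂ] p.2).sum)‖ ≤
        η * (L'.map fun p => ‖p.2‖ + 2 * ‖p.1‖).sum := by
    intro L'
    induction L' with
    | nil => simp
    | cons p L' ih =>
      intro hp
      have i1 := ih fun q hq => hp q (List.mem_cons_of_mem _ hq)
      obtain ⟨p1, p2⟩ := hp p List.mem_cons_self
      simp only [List.map_cons, List.sum_cons, map_add, mul_add]
      have e1 : ι (p.1 ⊗ₜ p.2) - ι (e ⊗ₜ f) * ι (p.1 ⊗ₜ p.2) =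
          ι ((p.1 - e * p.1) ⊗ₜ p.2) + ι ((e * p.1) ⊗ₜ (p.2 - f * p.2)) := by
        rw [h.mul, ← map_sub, ← map_add, TensorProduct.sub_tmul, TensorProduct.tmul_sub]
        congr 1; abel
      have e2 : ‖ι (p.1 ⊗ₜ p.2) - ι (e ⊗ₜ f) * ι (p.1 ⊗ₜ p.2)‖ ≤ η * (‖p.2‖ + 2 * ‖p.1‖) := by
        rw [e1]
        have b1 : ‖ι ((p.1 - e * p.1) ⊗ₜ p.2)‖ ≤ η * ‖p.2‖ :=
          (h.bd _ _).trans (mul_le_mul_of_nonneg_right p1 (norm_nonneg _))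
        have b2 : ‖ι ((e * p.1) ⊗ₜ (p.2 - f * p.2))‖ ≤ (2 * ‖p.1‖) * η :=
          (h.bd _ _).trans (mul_le_mul ((norm_mul_le _ _).trans
            (mul_le_mul_of_nonneg_right he2 (norm_nonneg _))) p2 (norm_nonneg _) (by positivity))
        refine (norm_add_le _ _).trans ?_
        linarith
      rw [add_sub_add_comm]
      refine (norm_add_le _ _).trans ?_
      rw [mul_add] at e2
      exact add_le_add e2 i1
  have k1 := key L fun p hp => ⟨he _ (List.mem_map_of_mem hp), hf _ (List.mem_map_of_mem hp)⟩
  rw [← hLt, ← hR] at k1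
  have k2 : η * R ≤ δ / 2 := by
    rw [hη, div_mul_eq_mul_div, div_le_div_iff₀ (by positivity) (by positivity)]
    nlinarith
  have k3 : z - ι (e ⊗ₜ f) * z = (ι t - ι (e ⊗ₜ f) * ι t) + ((z - ι t) - ι (e ⊗ₜ f) * (z - ι t)) := by
    rw [mul_sub]; abel
  rw [k3]
  have k4 : ‖ι (e ⊗ₜ f) * (z - ι t)‖ ≤ 4 * ‖z - ι t‖ :=
    (norm_mul_le _ _).trans (mul_le_mul_of_nonneg_right hw (norm_nonneg _))
  have k5 := norm_add_le (ι t - ι (e ⊗ₜ f) * ι t) ((z - ι t) - ι (e ⊗ₜ f) * (z - ι t))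
  have k6 := norm_sub_le (z - ι t) (ι (e ⊗ₜ f) * (z - ι t))
  linarith

end P20
end GT

namespace GT
open Filter Topology

section P21
set_option linter.unusedSectionVars false
variable {A B : Type u} [NonUnitalCStarAlgebra A] [NonUnitalCStarAlgebra B]
  {X : Type u} [NonUnitalNormedRing X] [NormedSpace ℂ X] [IsScalarTower ℂ X X] [SMulCommClass ℂ X X]

lemma idealX_smul {ι : A ⊗[ℂ] B →ₗ[ℂ] X} (h : TC ι) {I : TwoSidedIdeal X} (hI : IsClosed (I : Set X))
    (c : ℂ) {z : X} (hz : z ∈ I) : c • z ∈ I := by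
  refine mem_of_approx hI fun δ hδ => ?_
  have hzt : z ∈ tsub ι ((⊤ : TwoSidedIdeal A) : Set A) ((⊤ : TwoSidedIdeal B) : Set B) := by
    rw [TwoSidedIdeal.coe_top, TwoSidedIdeal.coe_top]; exact tsub_univ h z
  obtain ⟨e, -, f, -, -, -, hz1⟩ := approxX h (by rw [TwoSidedIdeal.coe_top]; exact isClosed_univ) hzt
    (δ := δ / (‖c‖ + 1)) (by positivity)
  refine ⟨c • (ι (e ⊗ₜ f) * z), ?_, ?_⟩
  · rw [← smul_mul_assoc]
    exact I.mul_mem_left _ _ hz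
  · rw [← smul_sub, norm_smul]
    calc ‖c‖ * ‖z - ι (e ⊗ₜ f) * z‖ ≤ (‖c‖ + 1) * (δ / (‖c‖ + 1)) := by gcongr; linarith
      _ = δ := by field_simp

def idX {ι : A ⊗[ℂ] B →ₗ[ℂ] X} (h : TC ι) (I : TwoSidedIdeal X) (hI : IsClosed (I : Set X)) : Submodule ℂ X where
  carrier := (I : Set X)
  add_mem' := fun ha hb => I.add_mem ha hb
  zero_mem' := I.zero_mem
  smul_mem' := fun c _ hx => idealX_smul h hI c hx

lemma sum_closed [CompleteSpace X] {P R : Submodule ℂ X} (hP : IsClosed (P : Set X)) (hR : IsClosed (R : Set X))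
    (hPm : ∀ w ∈ P, ∀ x, w * x ∈ P) (hRm : ∀ w, ∀ x ∈ R, w * x ∈ R) {C : ℝ} (hC : 0 ≤ C)
    (hau : ∀ p ∈ P, ∀ δ > 0, ∃ w ∈ P, ‖w‖ ≤ C ∧ ‖p - w * p‖ ≤ δ) : IsClosed ((P ⊔ R : Submodule ℂ X) : Set X) := by
  have _ : CompleteSpace P := hP.completeSpace_coe
  have _ : CompleteSpace R := hR.completeSpace_coe
  let g : (P × R) →L[ℂ] X := P.subtypeL.coprod R.subtypeL
  let f : NormedAddGroupHom (P × R) X :=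
    { toFun := g, map_add' := map_add g, bound' := ⟨‖g‖, g.le_opNorm⟩ }
  have hf : ∀ p, f p = (p.1 : X) + (p.2 : X) := fun p => rfl
  have hs : f.SurjectiveOnWith (P ⊔ R).toAddSubgroup (C + 2) := by
    intro u hu
    obtain ⟨p, hp, r, hr, rfl⟩ := Submodule.mem_sup.1 hu
    rcases eq_or_ne (p + r) 0 with h0 | h0
    · exact ⟨0, by rw [map_zero, h0], by simp [h0]⟩
    obtain ⟨w, hw, hwC, hwp⟩ := hau p hp ‖p + r‖ (norm_pos_iff.2 h0)
    have hp' : w * (p + r) + (p - w * p) ∈ P := P.add_mem (hPm w hw _) (P.sub_mem hp (hPm w hw _))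
    have hr' : r - w * r ∈ R := R.sub_mem hr (hRm w r hr)
    refine ⟨(⟨_, hp'⟩, ⟨_, hr'⟩), ?_, ?_⟩
    · rw [hf]
      change w * (p + r) + (p - w * p) + (r - w * r) = p + r
      rw [mul_add]; abel
    · have n1 : ‖w * (p + r) + (p - w * p)‖ ≤ (C + 1) * ‖p + r‖ := by
        refine (norm_add_le _ _).trans ?_
        have := (norm_mul_le w (p + r)).trans (mul_le_mul_of_nonneg_right hwC (norm_nonneg _))
        linarith
      have n2 : ‖r - w * r‖ ≤ (C + 2) * ‖p + r‖ := by
        have : r - w * r = (p + r) - (w * (p + r) + (p - w * p)) := by rw [mul_add]; abel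
        rw [this]
        refine (norm_sub_le _ _).trans ?_
        linarith
      refine max_le (n1.trans ?_) n2
      have := norm_nonneg (p + r)
      nlinarith
  have hcl := controlled_closure_of_complete (by linarith) one_pos hs
  refine isClosed_of_closure_subset fun x hx => ?_
  obtain ⟨y, hy, -⟩ := hcl x hx
  rw [← hy, hf]
  exact Submodule.add_mem_sup y.1.2 y.2.2

lemma K0_closed [CompleteSpace X] {ι : A ⊗[ℂ] B →ₗ[ℂ] X} (h : TC ι) (E : TwoSidedIdeal A) (F : TwoSidedIdeal B)
    (hE : IsClosed (E : Set A)) :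
    IsClosed ((tsub ι (E : Set A) Set.univ ⊔ tsub ι Set.univ (F : Set B) : Submodule ℂ X) : Set X) := by
  refine sum_closed (tsub_closed _ _ _) (tsub_closed _ _ _) ?_ ?_ (C := 4) (by norm_num) ?_
  · intro w hw x
    exact tsub_mul' h (S := (E : Set A)) (T := Set.univ) (fun c a ha => E.mul_mem_right _ _ ha) (fun _ _ _ => trivial) x w hw
  · intro w x hx
    exact tsub_mul h (S := Set.univ) (T := (F : Set B)) (fun _ _ _ => trivial) (fun c a ha => F.mul_mem_left _ _ ha) w x hx
  · intro p hp δ hδ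
    have hp' : p ∈ tsub ι (E : Set A) ((⊤ : TwoSidedIdeal B) : Set B) := by
      rw [TwoSidedIdeal.coe_top]; exact hp
    obtain ⟨e, he, f, -, h2, h3, h4⟩ := approxX h hE hp' hδ
    refine ⟨ι (e ⊗ₜ f), tmul_mem he trivial, ?_, h4⟩
    exact (h.bd e f).trans (by nlinarith [norm_nonneg e, norm_nonneg f])

end P21
end GT

namespace GT
open Filter Topology

section P22
set_option linter.unusedSectionVars false
variable {A B : Type u} [NonUnitalCStarAlgebra A] [NonUnitalCStarAlgebra B]
  {X : Type u} [NonUnitalNormedRing X] [NormedSpace ℂ X] [IsScalarTower ℂ X X] [SMulCommClass ℂ X X]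

lemma exc_lift {E : TwoSidedIdeal A} (hE : IsClosed (E : Set A)) {I : Type} [Fintype I]
    (h : I → A) (hh : ∀ i, IsSelfAdjoint (h i)) (φ : A →ₗ[ℂ] ℂ) (hφ : ∀ y, ‖φ y‖ ≤ ‖y‖)
    (pf : PosF φ) (φE : ∀ y ∈ E, φ y = 0) (l : I → ℝ) {κ η : ℝ} (hκ : 0 < κ) (hη : 0 < η)
    (hl : κ ≤ ∑ i, l i * (φ (h i)).re) :
    ∃ (b c : A) (lam : I → ℝ) (r : I → A), ‖b‖ ≤ 2 ∧ c ∉ E ∧ c * (b * b) - c ∈ E ∧ (∀ i, ‖r i‖ ≤ 2 * η) ∧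
      (∀ i, b * h i * b - ((lam i : ℂ) • (b * b) + r i) ∈ E) ∧ κ - η ≤ ∑ i, l i * lam i := by
  obtain ⟨Q, _, π, πmul, πstar, πker, πn, πlift⟩ := exists_quot E hE
  have πsurj : ∀ q, ∃ a, π a = q := fun q => by
    obtain ⟨a, ha, -⟩ := πlift q (‖q‖ + 1) (by linarith)
    exact ⟨a, ha⟩
  choose s hs using πsurj
  have φeq : ∀ a b, π a = π b → φ a = φ b := by
    intro a b hab
    have : a - b ∈ E := (πker _).1 (by rw [map_sub, hab, sub_self])
    have := φE _ this
    rwa [map_sub, sub_eq_zero] at this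
  let φ' : Q →ₗ[ℂ] ℂ :=
    { toFun := fun q => φ (s q)
      map_add' := fun p q => by
        rw [← map_add]; apply φeq; rw [hs, map_add, hs, hs]
      map_smul' := fun c q => by
        rw [RingHom.id_apply, ← map_smul]; apply φeq; rw [hs, map_smul, hs] }
  have φ'π : ∀ a, φ' (π a) = φ a := fun a => φeq _ _ (hs _)
  have hφ' : ∀ q, ‖φ' q‖ ≤ ‖q‖ := by
    intro q
    refine le_of_forall_pos_le_add fun ε hε => ?_
    obtain ⟨a, rfl, ha⟩ := πlift q (‖q‖ + ε) (by linarith)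
    rw [φ'π]
    exact (hφ a).trans ha.le
  have pf' : PosF φ' := by
    intro q
    obtain ⟨a, rfl⟩ : ∃ a, π a = q := ⟨s q, hs q⟩
    rw [← πstar, ← πmul, φ'π]
    exact pf a
  obtain ⟨b, c, lam, hb, hb1, hc, hcb, hx, hlam⟩ := excision (fun i => π (h i))
    (fun i => by
      change star _ = _
      rw [← πstar, (hh i).star_eq]) φ' hφ' pf' l hκ hη (by simpa only [φ'π] using hl)
  obtain ⟨b₀, hb₀, hb₀n⟩ := πlift b 2 (by linarith)
  obtain ⟨c₀, hc₀, -⟩ := πlift c (‖c‖ + 1) (by linarith)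
  have hr : ∀ i, ∃ a, π a = b * π (h i) * b - (lam i : ℂ) • (b * b) ∧ ‖a‖ < 2 * η := fun i =>
    πlift _ _ ((hx i).trans_lt (by linarith))
  choose r hr1 hr2 using hr
  refine ⟨b₀, c₀, lam, r, hb₀n.le, ?_, ?_, fun i => (hr2 i).le, fun i => ?_, hlam⟩
  · intro hcE
    exact hc (by rw [← hc₀]; exact (πker _).2 hcE)
  · apply (πker _).1
    rw [map_sub, πmul, πmul, hb₀, hc₀, ← mul_assoc, hcb, hcb, sub_self]
  · apply (πker _).1
    rw [map_sub, map_add, map_smul, πmul, πmul, πmul, hr1, hb₀]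
    abel

lemma sa_rep (t : A ⊗[ℂ] B) : ∃ (I : Type) (_ : Fintype I) (c : I → ℂ) (h : I → A) (k : I → B),
    (∀ i, IsSelfAdjoint (h i)) ∧ (∀ i, IsSelfAdjoint (k i)) ∧ t = ∑ i, c i • (h i ⊗ₜ[ℂ] k i) := by
  have hadd : ∀ t t' : A ⊗[ℂ] B, (∃ (I : Type) (_ : Fintype I) (c : I → ℂ) (h : I → A) (k : I → B),
    (∀ i, IsSelfAdjoint (h i)) ∧ (∀ i, IsSelfAdjoint (k i)) ∧ t = ∑ i, c i • (h i ⊗ₜ[ℂ] k i)) →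
    (∃ (I : Type) (_ : Fintype I) (c : I → ℂ) (h : I → A) (k : I → B),
    (∀ i, IsSelfAdjoint (h i)) ∧ (∀ i, IsSelfAdjoint (k i)) ∧ t' = ∑ i, c i • (h i ⊗ₜ[ℂ] k i)) →
    (∃ (I : Type) (_ : Fintype I) (c : I → ℂ) (h : I → A) (k : I → B),
    (∀ i, IsSelfAdjoint (h i)) ∧ (∀ i, IsSelfAdjoint (k i)) ∧ t + t' = ∑ i, c i • (h i ⊗ₜ[ℂ] k i)) := by
    rintro t t' ⟨I, _, c, h, k, h1, h2, rfl⟩ ⟨I', _, c', h', k', h1', h2', rfl⟩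
    refine ⟨I ⊕ I', inferInstance, Sum.elim c c', Sum.elim h h', Sum.elim k k', ?_, ?_, ?_⟩
    · rintro (i | i)
      exacts [h1 i, h1' i]
    · rintro (i | i)
      exacts [h2 i, h2' i]
    · rw [Fintype.sum_sum_type]; rfl
  have hone : ∀ (c : ℂ) (h : A) (k : B), IsSelfAdjoint h → IsSelfAdjoint k →
    (∃ (I : Type) (_ : Fintype I) (c' : I → ℂ) (h' : I → A) (k' : I → B),
    (∀ i, IsSelfAdjoint (h' i)) ∧ (∀ i, IsSelfAdjoint (k' i)) ∧ c • (h ⊗ₜ[ℂ] k) = ∑ i, c' i • (h' i ⊗ₜ[ℂ] k' i)) := by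
    intro c h k hh hk
    exact ⟨Unit, inferInstance, fun _ => c, fun _ => h, fun _ => k, fun _ => hh, fun _ => hk, by simp⟩
  induction t using TensorProduct.induction_on with
  | zero => exact ⟨Empty, inferInstance, Empty.elim, Empty.elim, Empty.elim, by simp, by simp, by simp⟩
  | add x y hx hy => exact hadd x y hx hy
  | tmul y w =>
    have hy := realPart_add_I_smul_imaginaryPart y
    have hw := realPart_add_I_smul_imaginaryPart w
    have e : y ⊗ₜ[ℂ] w = ((1:ℂ) • ((realPart y : A) ⊗ₜ[ℂ] (realPart w : B)) +
        Complex.I • ((realPart y : A) ⊗ₜ[ℂ] (imaginaryPart w : B))) +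
        (Complex.I • ((imaginaryPart y : A) ⊗ₜ[ℂ] (realPart w : B)) +
        (Complex.I * Complex.I) • ((imaginaryPart y : A) ⊗ₜ[ℂ] (imaginaryPart w : B))) := by
      conv_lhs => rw [← hy, ← hw]
      rw [TensorProduct.add_tmul, TensorProduct.tmul_add, TensorProduct.tmul_add, one_smul,
        TensorProduct.smul_tmul', TensorProduct.smul_tmul', TensorProduct.tmul_smul, TensorProduct.tmul_smul,
        TensorProduct.smul_tmul', TensorProduct.smul_tmul', smul_smul]
      rw [← TensorProduct.smul_tmul', ← TensorProduct.smul_tmul', ← TensorProduct.smul_tmul']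
    rw [e]
    exact hadd _ _ (hadd _ _ (hone _ _ _ (realPart y).2 (realPart w).2) (hone _ _ _ (realPart y).2 (imaginaryPart w).2))
      (hadd _ _ (hone _ _ _ (imaginaryPart y).2 (realPart w).2) (hone _ _ _ (imaginaryPart y).2 (imaginaryPart w).2))

lemma geom_mem {I : TwoSidedIdeal X} (hI : IsClosed (I : Set X)) {z r : X} (hr : ‖r‖ < 1) (h : z - z * r ∈ I) :
    z ∈ I := by
  let v : ℕ → X := fun n => Nat.rec z (fun _ w => w * r) n
  have v0 : v 0 = z := rfl
  have vs : ∀ n, v (n + 1) = v n * r := fun n => rfl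
  have h1 : ∀ n, v n - v n * r ∈ I := by
    intro n
    induction n with
    | zero => exact h
    | succ n ih =>
      rw [vs, ← sub_mul]
      exact I.mul_mem_right _ _ ih
  have h2 : ∀ n, z - v n ∈ I := by
    intro n
    induction n with
    | zero => rw [v0, sub_self]; exact I.zero_mem
    | succ n ih =>
      have : z - v (n + 1) = (z - v n) + (v n - v n * r) := by rw [vs]; abel
      rw [this]
      exact I.add_mem ih (h1 n)
  have h3 : ∀ n, ‖v n‖ ≤ ‖z‖ * ‖r‖ ^ n := by
    intro n
    induction n with
    | zero => simp [v0]
    | succ n ih =>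
      rw [vs, pow_succ, ← mul_assoc]
      exact (norm_mul_le _ _).trans (mul_le_mul_of_nonneg_right ih (norm_nonneg _))
  have h4 : Tendsto v atTop (𝓝 0) := by
    refine squeeze_zero_norm h3 ?_
    have := (tendsto_pow_atTop_nhds_zero_of_lt_one (norm_nonneg r) hr).const_mul ‖z‖
    rwa [mul_zero] at this
  have h5 : Tendsto (fun n => z - v n) atTop (𝓝 z) := by
    have := (tendsto_const_nhds (x := z)).sub h4
    rwa [sub_zero] at this
  exact hI.mem_of_tendsto h5 (Eventually.of_forall h2)

lemma tmodI {ι : A ⊗[ℂ] B →ₗ[ℂ] X} {E : TwoSidedIdeal A} {F : TwoSidedIdeal B} {I : TwoSidedIdeal X}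
    (hIE : ∀ a ∈ E, ∀ b, ι (a ⊗ₜ b) ∈ I) (hIF : ∀ a, ∀ b ∈ F, ι (a ⊗ₜ b) ∈ I) {a a' : A} {b b' : B}
    (ha : a - a' ∈ E) (hb : b - b' ∈ F) : ι (a ⊗ₜ b) - ι (a' ⊗ₜ b') ∈ I := by
  have : ι (a ⊗ₜ b) - ι (a' ⊗ₜ b') = ι ((a - a') ⊗ₜ b) + ι (a' ⊗ₜ (b - b')) := by
    rw [← map_sub, ← map_add, TensorProduct.sub_tmul, TensorProduct.tmul_sub]
    congr 1; abel
  rw [this]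
  exact I.add_mem (hIE _ ha _) (hIF _ _ hb)

end P22
end GT

namespace GT
open Filter Topology

section P23
set_option linter.unusedSectionVars false
variable {A B : Type u} [NonUnitalCStarAlgebra A] [NonUnitalCStarAlgebra B]
  {X : Type u} [NonUnitalNormedRing X] [NormedSpace ℂ X] [IsScalarTower ℂ X X] [SMulCommClass ℂ X X]

lemma exists_eta {κ S : ℝ} (hκ : 0 < κ) (hS : 0 ≤ S) : ∃ η, 0 < η ∧ η ≤ κ ∧ η * S ≤ κ := by
  refine ⟨κ / (S + 1), by positivity, ?_, ?_⟩
  · rw [div_le_iff₀ (by positivity)]; nlinarith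
  · rw [div_mul_eq_mul_div, div_le_iff₀ (by positivity)]; nlinarith

lemma posF_real {φ : A →ₗ[ℂ] ℂ} (hφ : ∀ y, ‖φ y‖ ≤ ‖y‖) (pf : PosF φ) {a : A} (ha : IsSelfAdjoint a) :
    φ a = ((φ a).re : ℂ) := by
  let _ := CStarAlgebra.spectralOrder A
  have _ := CStarAlgebra.spectralOrderedRing A
  have h := posF_star (C := 1) (fun y => by rw [one_mul]; exact hφ y) pf a
  rw [ha.star_eq] at h
  exact (Complex.conj_eq_iff_re.1 h.symm).symm

set_option maxHeartbeats 1000000 in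
lemma elem0 {ι : A ⊗[ℂ] B →ₗ[ℂ] X} (hT : TC ι) {E : TwoSidedIdeal A} {F : TwoSidedIdeal B}
    (hE : IsClosed (E : Set A)) (hF : IsClosed (F : Set B)) {I : TwoSidedIdeal X} (hI : IsClosed (I : Set X))
    (hIE : ∀ a ∈ E, ∀ b, ι (a ⊗ₜ b) ∈ I) (hIF : ∀ a, ∀ b ∈ F, ι (a ⊗ₜ b) ∈ I)
    {x : X} (hx : x ∈ I) {φ : A →ₗ[ℂ] ℂ} {ψ : B →ₗ[ℂ] ℂ} (hφ : ∀ y, ‖φ y‖ ≤ ‖y‖) (pφ : PosF φ)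
    (φE : ∀ y ∈ E, φ y = 0) (hψ : ∀ y, ‖ψ y‖ ≤ ‖y‖) (pψ : PosF ψ) (ψF : ∀ y ∈ F, ψ y = 0)
    (L : X →L[ℂ] ℂ) (hL : ∀ a b, L (ι (a ⊗ₜ b)) = φ a * ψ b) {κ : ℝ} (hκ : 0 < κ) (hLx : L x = (κ : ℂ)) :
    ∃ c d, c ∉ E ∧ d ∉ F ∧ ι (c ⊗ₜ d) ∈ I := by
  obtain ⟨δ, hδ, hδ1, hδ2⟩ := exists_eta (κ := κ / 256) (S := ‖L‖) (by positivity) (norm_nonneg _)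
  obtain ⟨t, ht⟩ := hT.dense.exists_dist_lt x hδ
  rw [dist_eq_norm] at ht
  obtain ⟨J, _, c, h, k, hh, hk, rfl⟩ := sa_rep t
  have hLt : L (ι (∑ i, c i • (h i ⊗ₜ[ℂ] k i))) = ∑ i, c i * (((φ (h i)).re : ℂ) * ((ψ (k i)).re : ℂ)) := by
    rw [map_sum, map_sum]
    refine Finset.sum_congr rfl fun i _ => ?_
    rw [map_smul, map_smul, hL, ← posF_real hφ pφ (hh i), ← posF_real hψ pψ (hk i), smul_eq_mul]
  have hre : (L (ι (∑ i, c i • (h i ⊗ₜ[ℂ] k i)))).re = ∑ i, (c i).re * (ψ (k i)).re * (φ (h i)).re := by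
    rw [hLt, Complex.re_sum]
    refine Finset.sum_congr rfl fun i _ => ?_
    rw [← Complex.ofReal_mul, Complex.re_mul_ofReal]; ring
  have h1 : 3 * κ / 4 ≤ ∑ i, (c i).re * (ψ (k i)).re * (φ (h i)).re := by
    rw [← hre]
    have e1 : ‖L (x - ι (∑ i, c i • (h i ⊗ₜ[ℂ] k i)))‖ ≤ κ / 256 :=
      (L.le_opNorm _).trans ((mul_le_mul_of_nonneg_left ht.le (norm_nonneg _)).trans (by linarith))
    have e2 := (Complex.abs_re_le_norm _).trans e1
    rw [map_sub, hLx, Complex.sub_re, Complex.ofReal_re, abs_le] at e2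
    linarith [e2.2]
  obtain ⟨η, hη, hη1, hη2⟩ := exists_eta (κ := κ / 256) (S := ∑ i, ‖c i‖ * ‖k i‖) (by positivity)
    (Finset.sum_nonneg fun i _ => by positivity)
  obtain ⟨b, c₁, lam, r, hb, hc₁, hcb, hr, hbr, hlam⟩ := exc_lift hE h hh φ hφ pφ φE
    (fun i => (c i).re * (ψ (k i)).re) (by positivity) hη h1
  obtain ⟨η', hη', hη1', hη2'⟩ := exists_eta (κ := κ / 256) (S := ∑ i, ‖c i‖ * |lam i|) (by positivity)
    (Finset.sum_nonneg fun i _ => by positivity)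
  have h2 : 5 * κ / 8 ≤ ∑ i, (c i).re * lam i * (ψ (k i)).re := by
    have : ∑ i, (c i).re * lam i * (ψ (k i)).re = ∑ i, (c i).re * (ψ (k i)).re * lam i :=
      Finset.sum_congr rfl fun i _ => by ring
    rw [this]; linarith
  obtain ⟨b', c₂, mu, r', hb', hc₂, hcb', hr', hbr', hmu⟩ := exc_lift hF k hk ψ hψ pψ ψF
    (fun i => (c i).re * lam i) (by positivity) hη' h2
  set W := ι ((b * b) ⊗ₜ (b' * b')) with hW
  set Z : ℂ := ∑ i, c i * ((lam i : ℂ) * (mu i : ℂ)) with hZ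
  have hZre : κ / 2 ≤ Z.re := by
    have : Z.re = ∑ i, (c i).re * lam i * mu i := by
      rw [hZ, Complex.re_sum]
      refine Finset.sum_congr rfl fun i _ => ?_
      rw [← Complex.ofReal_mul, Complex.re_mul_ofReal]; ring
    rw [this]; linarith
  have hZn : κ / 2 ≤ ‖Z‖ := hZre.trans ((le_abs_self _).trans (Complex.abs_re_le_norm _))
  let M := idX hT I hI
  let e : J → X := fun i => (lam i : ℂ) • ι ((b * b) ⊗ₜ r' i) + ι (r i ⊗ₜ (b' * k i * b'))
  have he : ∀ i, ‖c i • e i‖ ≤ 8 * η' * (‖c i‖ * |lam i|) + 8 * η * (‖c i‖ * ‖k i‖) := by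
    intro i
    have f1 : ‖ι ((b * b) ⊗ₜ r' i)‖ ≤ 8 * η' := by
      refine (hT.bd _ _).trans ?_
      have : ‖b * b‖ ≤ 4 := (norm_mul_le _ _).trans (by nlinarith [norm_nonneg b])
      nlinarith [hr' i, norm_nonneg (r' i)]
    have f2 : ‖ι (r i ⊗ₜ (b' * k i * b'))‖ ≤ 8 * η * ‖k i‖ := by
      refine (hT.bd _ _).trans ?_
      have g : ‖b' * k i * b'‖ ≤ 4 * ‖k i‖ := by
        refine (norm_mul₃_le).trans ?_
        have : ‖b'‖ * ‖b'‖ ≤ 4 := by nlinarith [norm_nonneg b']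
        nlinarith [norm_nonneg (k i)]
      calc _ ≤ (2 * η) * (4 * ‖k i‖) := mul_le_mul (hr i) g (norm_nonneg _) (by positivity)
        _ = _ := by ring
    have f3 : ‖e i‖ ≤ |lam i| * (8 * η') + 8 * η * ‖k i‖ := by
      refine (norm_add_le _ _).trans (add_le_add ?_ f2)
      rw [norm_smul, Complex.norm_real, Real.norm_eq_abs]
      exact mul_le_mul_of_nonneg_left f1 (abs_nonneg _)
    rw [norm_smul]
    refine (mul_le_mul_of_nonneg_left f3 (norm_nonneg _)).trans (le_of_eq ?_)
    ring
  have heS : ‖∑ i, c i • e i‖ ≤ κ / 16 := by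
    refine (norm_sum_le _ _).trans ((Finset.sum_le_sum fun i _ => he i).trans ?_)
    rw [Finset.sum_add_distrib, ← Finset.mul_sum, ← Finset.mul_sum]
    linarith
  have hm : ∀ i, ι ((b * h i * b) ⊗ₜ (b' * k i * b')) - (((lam i : ℂ) * (mu i : ℂ)) • W + e i) ∈ M := by
    intro i
    have g1 : ι ((b * h i * b) ⊗ₜ (b' * k i * b')) - ι (((lam i : ℂ) • (b * b) + r i) ⊗ₜ (b' * k i * b')) ∈ M :=
      tmodI hIE hIF (hbr i) (by rw [sub_self]; exact F.zero_mem)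
    have g2 : ι ((b * b) ⊗ₜ (b' * k i * b')) - ι ((b * b) ⊗ₜ ((mu i : ℂ) • (b' * b') + r' i)) ∈ M :=
      tmodI hIE hIF (by rw [sub_self]; exact E.zero_mem) (hbr' i)
    have g3 := M.add_mem g1 (M.smul_mem (lam i : ℂ) g2)
    convert g3 using 1
    rw [TensorProduct.add_tmul, ← TensorProduct.smul_tmul', map_add, map_smul, TensorProduct.tmul_add,
      TensorProduct.tmul_smul, map_add, map_smul]
    simp only [e]
    rw [← hW, smul_sub, smul_add, smul_smul]
    abel
  have hsum : ∑ i, c i • ι ((b * h i * b) ⊗ₜ (b' * k i * b')) - (Z • W + ∑ i, c i • e i) ∈ M := by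
    have := M.sum_mem (t := Finset.univ) fun i _ => M.smul_mem (c i) (hm i)
    convert this using 1
    rw [hZ, Finset.sum_smul, ← Finset.sum_add_distrib, ← Finset.sum_sub_distrib]
    refine Finset.sum_congr rfl fun i _ => ?_
    rw [smul_sub (c i), smul_add (c i) _ (e i), smul_smul]
  set T := ι (b ⊗ₜ b') with hTdef
  have hTn : ‖T‖ ≤ 4 := (hT.bd _ _).trans (by nlinarith [norm_nonneg b, norm_nonneg b'])
  have hTt : T * ι (∑ i, c i • (h i ⊗ₜ[ℂ] k i)) * T = ∑ i, c i • ι ((b * h i * b) ⊗ₜ (b' * k i * b')) := by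
    rw [map_sum, Finset.mul_sum, Finset.sum_mul]
    refine Finset.sum_congr rfl fun i _ => ?_
    rw [map_smul, mul_smul_comm, smul_mul_assoc, hTdef, hT.mul, hT.mul]
  have hd : ‖T * (x - ι (∑ i, c i • (h i ⊗ₜ[ℂ] k i))) * T‖ ≤ κ / 16 := by
    refine (norm_mul₃_le).trans ?_
    have : ‖T‖ * ‖T‖ ≤ 16 := by nlinarith [norm_nonneg T]
    nlinarith [norm_nonneg (x - ι (∑ i, c i • (h i ⊗ₜ[ℂ] k i)))]
  set d := T * (x - ι (∑ i, c i • (h i ⊗ₜ[ℂ] k i))) * T with hdd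
  have hTx : T * x * T ∈ M := I.mul_mem_right _ _ (I.mul_mem_left _ _ hx)
  have hM : Z • W + (∑ i, c i • e i + d) ∈ M := by
    have := M.sub_mem hTx hsum
    convert this using 1
    rw [← hTt, hdd, mul_sub, sub_mul]
    abel
  have hZ0 : Z ≠ 0 := by
    intro h0; rw [h0, norm_zero] at hZn; linarith
  set ρ := -(Z⁻¹ • (∑ i, c i • e i + d)) with hρ
  have hM2 : W - ρ ∈ M := by
    have := M.smul_mem Z⁻¹ hM
    rwa [smul_add, smul_smul, inv_mul_cancel₀ hZ0, one_smul, ← sub_neg_eq_add, ← hρ] at this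
  have hρn : ‖ρ‖ < 1 := by
    rw [hρ, norm_neg, norm_smul, norm_inv, inv_mul_lt_iff₀ (by linarith), mul_one]
    refine (norm_add_le _ _).trans_lt ?_
    linarith
  refine ⟨c₁, c₂, hc₁, hc₂, geom_mem hI hρn ?_⟩
  have q1 : ι ((c₁ * (b * b)) ⊗ₜ (c₂ * (b' * b'))) - ι (c₁ ⊗ₜ c₂) ∈ I := tmodI hIE hIF hcb hcb'
  have q2 : ι (c₁ ⊗ₜ c₂) * (W - ρ) ∈ I := I.mul_mem_left _ _ hM2
  have q3 := I.sub_mem q2 q1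
  convert q3 using 1
  rw [mul_sub, hW, hT.mul]
  abel

lemma elem {ι : A ⊗[ℂ] B →ₗ[ℂ] X} (hT : TC ι) {E : TwoSidedIdeal A} {F : TwoSidedIdeal B}
    (hE : IsClosed (E : Set A)) (hF : IsClosed (F : Set B)) {I : TwoSidedIdeal X} (hI : IsClosed (I : Set X))
    (hIE : ∀ a ∈ E, ∀ b, ι (a ⊗ₜ b) ∈ I) (hIF : ∀ a, ∀ b ∈ F, ι (a ⊗ₜ b) ∈ I)
    {x : X} (hx : x ∈ I) {φ : A →ₗ[ℂ] ℂ} {ψ : B →ₗ[ℂ] ℂ} (hφ : PV (idS E hE) φ) (hψ : PV (idS F hF) ψ)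
    (L : X →L[ℂ] ℂ) (hL : ∀ a b, L (ι (a ⊗ₜ b)) = φ a * ψ b) (hLx : L x ≠ 0) :
    ∃ c d, c ∉ E ∧ d ∉ F ∧ ι (c ⊗ₜ d) ∈ I := by
  obtain ⟨⟨C, hC, hφ⟩, pφ, φE⟩ := hφ
  obtain ⟨⟨D, hD, hψ⟩, pψ, ψF⟩ := hψ
  obtain ⟨z, hz, hzL⟩ := exists_phase (L x)
  have hsc : ∀ {V : Type u} [NonUnitalCStarAlgebra V] (f : V →ₗ[ℂ] ℂ) (C : ℝ), 0 ≤ C → (∀ y, ‖f y‖ ≤ C * ‖y‖) →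
      ∀ y, ‖((((C + 1)⁻¹ : ℝ) : ℂ) • f) y‖ ≤ ‖y‖ := by
    intro V _ f C hC hf y
    rw [LinearMap.smul_apply, norm_smul, Complex.norm_real, Real.norm_of_nonneg (by positivity),
      inv_mul_le_iff₀ (by positivity)]
    exact (hf y).trans (by nlinarith [norm_nonneg y])
  refine elem0 hT hE hF hI hIE hIF (idealX_smul hT hI z hx) (φ := (((C + 1)⁻¹ : ℝ) : ℂ) • φ)
    (ψ := (((D + 1)⁻¹ : ℝ) : ℂ) • ψ) (hsc φ C hC hφ) (pφ.smul (by positivity)) (fun y hy => ?_)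
    (hsc ψ D hD hψ) (pψ.smul (by positivity)) (fun y hy => ?_)
    (((((C + 1)⁻¹ : ℝ) : ℂ) * (((D + 1)⁻¹ : ℝ) : ℂ)) • L) (fun a b => ?_)
    (κ := (C + 1)⁻¹ * (D + 1)⁻¹ * ‖L x‖) (by have := norm_pos_iff.2 hLx; positivity) ?_
  · rw [LinearMap.smul_apply, φE y hy, smul_zero]
  · rw [LinearMap.smul_apply, ψF y hy, smul_zero]
  · rw [smul_apply, hL, LinearMap.smul_apply, LinearMap.smul_apply]
    simp only [smul_eq_mul]; ring
  · rw [smul_apply, map_smul, smul_eq_mul, smul_eq_mul, hzL]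
    push_cast; ring

end P23
end GT

namespace GT
open Filter Topology

section P24
set_option linter.unusedSectionVars false

lemma hb_sep {V : Type*} [NormedAddCommGroup V] [NormedSpace ℂ V] (S : Submodule ℂ V) (hS : IsClosed (S : Set V))
    {x : V} (hx : x ∉ S) : ∃ g : V →L[ℂ] ℂ, ‖g‖ ≤ 1 ∧ (∀ s ∈ S, g s = 0) ∧ g x ≠ 0 := by
  have : IsClosed (S : Set V) := hS
  have h0 : S.mkQL x ≠ 0 := fun h => hx ((Submodule.Quotient.mk_eq_zero S).1 h)
  obtain ⟨g, -, hg⟩ := exists_dual_vector ℂ (S.mkQL x) (norm_ne_zero_iff.2 h0)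
  set g' := g.comp S.mkQL with hg'
  have hgx : g' x ≠ 0 := by
    change g (S.mkQL x) ≠ 0
    rw [hg]
    exact RCLike.ofReal_ne_zero.2 (norm_ne_zero_iff.2 h0)
  have hgs : ∀ s ∈ S, g' s = 0 := by
    intro s hs
    change g (S.mkQL s) = 0
    have : S.mkQL s = 0 := (Submodule.Quotient.mk_eq_zero S).2 hs
    rw [this, map_zero]
  refine ⟨(((‖g'‖ + 1)⁻¹ : ℝ) : ℂ) • g', ?_, fun s hs => ?_, ?_⟩
  · rw [norm_smul, Complex.norm_real, Real.norm_of_nonneg (by positivity), inv_mul_le_iff₀ (by positivity)]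
    linarith
  · rw [smul_apply, hgs s hs, smul_zero]
  · rw [smul_apply]
    refine smul_ne_zero ?_ hgx
    have : (‖g'‖ + 1)⁻¹ ≠ 0 := by positivity
    exact_mod_cast this

variable {A B : Type u} [NonUnitalCStarAlgebra A] [NonUnitalCStarAlgebra B]
  {X : Type u} [NonUnitalNormedRing X] [NormedSpace ℂ X] [IsScalarTower ℂ X X] [SMulCommClass ℂ X X]

lemma pv_sep {E : TwoSidedIdeal A} (hE : IsClosed (E : Set A)) {a : A} (ha : a ∉ E) :
    ∃ φ, PV (idS E hE) φ ∧ φ a ≠ 0 := by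
  obtain ⟨g, hg, gS, ga⟩ := hb_sep (idS E hE) hE (x := a) ha
  let w : A →ₗ[ℂ] ℂ →ₗ[ℂ] ℂ := (LinearMap.mul ℂ ℂ).compl₁₂ g.toLinearMap LinearMap.id
  have hw : ∀ x y, w x y = g x * y := fun x y => rfl
  have hbot : IsSI (⊥ : Submodule ℂ ℂ) := by
    refine ⟨fun m x hx => ?_, fun m x hx => ?_, fun x hx => ?_⟩ <;>
      rw [Submodule.mem_bot] at hx ⊢ <;> simp [hx]
  obtain ⟨f₁, f₂, g₁, g₂, F1, F2, -, -, hm⟩ := GT_nonunital (u := w)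
    (fun x y => by
      rw [hw, norm_mul]
      refine mul_le_mul_of_nonneg_right ?_ (norm_nonneg _)
      exact (g.le_opNorm x).trans (mul_le_of_le_one_left (norm_nonneg _) hg))
    (idS_si E hE) hbot (fun x hx y => by rw [hw, gS x hx, zero_mul])
    (fun x y hy => by rw [Submodule.mem_bot] at hy; rw [hw, hy, mul_zero])
  have P1 : PV (idS E hE) f₁ := ⟨⟨80000, by norm_num, F1.1⟩, F1.2.1, F1.2.2⟩
  have P2 : PV (idS E hE) f₂ := ⟨⟨80000, by norm_num, F2.1⟩, F2.2.1, F2.2.2⟩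
  have key : f₁ (a * star a) ≠ 0 ∨ f₂ (star a * a) ≠ 0 := by
    by_contra hcon
    push Not at hcon
    set D := 4 * ((g₁ (1 * star 1)).re + (g₂ (star 1 * 1)).re) with hD
    have h1 : ∀ n : ℕ, (n : ℝ) * ‖g a‖ ≤ D := by
      intro n
      have := hm ((n : ℂ) • a) 1
      rw [hw, mul_one, map_smul, norm_smul, Complex.norm_natCast, star_smul, smul_mul_smul_comm, smul_mul_smul_comm,
        map_smul, map_smul, hcon.1, hcon.2, smul_zero, smul_zero, Complex.zero_re, zero_add, zero_add] at this
      exact this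
    obtain ⟨n, hn⟩ := exists_nat_gt (D / ‖g a‖)
    have h2 := h1 n
    rw [div_lt_iff₀ (norm_pos_iff.2 ga)] at hn
    linarith
  rcases key with hk | hk
  · obtain ⟨c, G, hG, he⟩ := polar_row (idS_si E hE) P1 a
    rw [he] at hk
    obtain ⟨k, -, hk⟩ := Finset.exists_ne_zero_of_sum_ne_zero hk
    exact ⟨G k, hG k, right_ne_zero_of_mul hk⟩
  · obtain ⟨c, G, hG, he⟩ := polar_col (idS_si E hE) P2 a
    rw [he] at hk
    obtain ⟨k, -, hk⟩ := Finset.exists_ne_zero_of_sum_ne_zero hk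
    exact ⟨G k, hG k, right_ne_zero_of_mul hk⟩

lemma au_l (y : A) {δ : ℝ} (hδ : 0 < δ) : ∃ e, ‖y - e * y‖ ≤ δ := by
  obtain ⟨e, -, -, he⟩ := au_list (⊤ : TwoSidedIdeal A) [y] (fun _ _ => TwoSidedIdeal.mem_top _) hδ
  exact ⟨e, he y (by simp)⟩

lemma au_r (y : A) {δ : ℝ} (hδ : 0 < δ) : ∃ e, ‖y - y * e‖ ≤ δ := by
  obtain ⟨e, he⟩ := au_l (star y) hδ
  refine ⟨star e, ?_⟩
  rw [← norm_star, star_sub, star_mul, star_star]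
  exact he

lemma au_X {ι : A ⊗[ℂ] B →ₗ[ℂ] X} (h : TC ι) (z : X) {δ : ℝ} (hδ : 0 < δ) : ∃ e, ‖z - e * z‖ ≤ δ := by
  have hzt : z ∈ tsub ι ((⊤ : TwoSidedIdeal A) : Set A) ((⊤ : TwoSidedIdeal B) : Set B) := by
    rw [TwoSidedIdeal.coe_top, TwoSidedIdeal.coe_top]; exact tsub_univ h z
  obtain ⟨e, -, f, -, -, -, hz1⟩ := approxX h (by rw [TwoSidedIdeal.coe_top]; exact isClosed_univ) hzt hδ
  exact ⟨_, hz1⟩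

/-- ideal of `z` with `z * Y * w ⊆ K` for all `w ∈ S`. -/
def lq {Y : Type*} [NonUnitalRing Y] (K : TwoSidedIdeal Y) (S : Set Y) : TwoSidedIdeal Y :=
  TwoSidedIdeal.mk' {z | ∀ w ∈ S, ∀ x, z * x * w ∈ K}
    (fun w _ x => by rw [zero_mul, zero_mul]; exact K.zero_mem)
    (fun ha hb w hw x => by rw [add_mul, add_mul]; exact K.add_mem (ha w hw x) (hb w hw x))
    (fun ha w hw x => by rw [neg_mul, neg_mul]; exact K.neg_mem (ha w hw x))
    (fun {p q} ha w hw x => by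
      rw [mul_assoc p, mul_assoc p]; exact K.mul_mem_left _ _ (ha w hw x))
    (fun {p q} ha w hw x => by rw [mul_assoc p]; exact ha w hw _)

/-- ideal of `w` with `z * Y * w ⊆ K` for all `z ∈ S`. -/
def rq {Y : Type*} [NonUnitalRing Y] (K : TwoSidedIdeal Y) (S : Set Y) : TwoSidedIdeal Y :=
  TwoSidedIdeal.mk' {w | ∀ z ∈ S, ∀ x, z * x * w ∈ K}
    (fun w _ x => by rw [mul_zero]; exact K.zero_mem)
    (fun ha hb w hw x => by rw [mul_add]; exact K.add_mem (ha w hw x) (hb w hw x))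
    (fun ha w hw x => by rw [mul_neg]; exact K.neg_mem (ha w hw x))
    (fun {p q} ha w hw x => by rw [← mul_assoc, mul_assoc w]; exact ha w hw _)
    (fun {p q} ha w hw x => by rw [← mul_assoc]; exact K.mul_mem_right _ _ (ha w hw x))

lemma mem_lq {Y : Type*} [NonUnitalRing Y] {K : TwoSidedIdeal Y} {S : Set Y} {z : Y} :
    z ∈ lq K S ↔ ∀ w ∈ S, ∀ x, z * x * w ∈ K := TwoSidedIdeal.mem_mk' _ _ _ _ _ _ _

lemma mem_rq {Y : Type*} [NonUnitalRing Y] {K : TwoSidedIdeal Y} {S : Set Y} {w : Y} :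
    w ∈ rq K S ↔ ∀ z ∈ S, ∀ x, z * x * w ∈ K := TwoSidedIdeal.mem_mk' _ _ _ _ _ _ _

lemma lq_closed {Y : Type*} [NonUnitalNormedRing Y] {K : TwoSidedIdeal Y} (hK : IsClosed (K : Set Y)) (S : Set Y) :
    IsClosed (lq K S : Set Y) := by
  have : (lq K S : Set Y) = ⋂ w ∈ S, ⋂ x, (fun z => z * x * w) ⁻¹' (K : Set Y) := by
    ext z
    rw [SetLike.mem_coe, mem_lq]
    simp
  rw [this]
  exact isClosed_biInter fun w _ => isClosed_iInter fun x => hK.preimage (by fun_prop)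

lemma rq_closed {Y : Type*} [NonUnitalNormedRing Y] {K : TwoSidedIdeal Y} (hK : IsClosed (K : Set Y)) (S : Set Y) :
    IsClosed (rq K S : Set Y) := by
  have : (rq K S : Set Y) = ⋂ w ∈ S, ⋂ x, (fun z => w * x * z) ⁻¹' (K : Set Y) := by
    ext z
    rw [SetLike.mem_coe, mem_rq]
    simp
  rw [this]
  exact isClosed_biInter fun w _ => isClosed_iInter fun x => hK.preimage (by fun_prop)

/-- elementwise form of primeness -/
lemma prime_el {Y : Type u} [NonUnitalNormedRing Y] (au : ∀ y : Y, ∀ δ > 0, ∃ e, ‖y - e * y‖ ≤ δ)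
    {K : TwoSidedIdeal Y} (hK : IsClosedPrimeIdeal K) {c c' : Y} (hc : c ∉ K) (hc' : c' ∉ K) :
    ∃ x, c * x * c' ∉ K := by
  by_contra hcon
  push Not at hcon
  have hmul : ∀ a d, (∀ x, a * x * d ∈ K) → a * d ∈ K := by
    intro a d h
    refine mem_of_approx hK.1 fun δ hδ => ?_
    obtain ⟨e, he⟩ := au d (δ / (‖a‖ + 1)) (by positivity)
    refine ⟨_, h e, ?_⟩
    rw [mul_assoc, ← mul_sub]
    refine (norm_mul_le _ _).trans ((mul_le_mul_of_nonneg_left he (norm_nonneg _)).trans ?_)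
    rw [mul_div_assoc', div_le_iff₀ (by positivity)]
    nlinarith [norm_nonneg a]
  rcases hK.2.2 (lq K {c'}) (rq K (lq K {c'} : Set Y)) (lq_closed hK.1 _) (rq_closed hK.1 _)
    (fun x hx y hy => hmul _ _ (mem_rq.1 hy x hx)) with h | h
  · exact hc (h (mem_lq.2 fun w hw x => by rw [Set.mem_singleton_iff.1 hw]; exact hcon x))
  · exact hc' (h (mem_rq.2 fun z hz x => mem_lq.1 hz c' rfl x))

lemma contR {ι : A ⊗[ℂ] B →ₗ[ℂ] X} (h : TC ι) (a : A) : Continuous fun b => ι (a ⊗ₜ[ℂ] b) :=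
  ((ι ∘ₗ TensorProduct.mk ℂ A B a).mkContinuous ‖a‖ (fun b => h.bd a b)).continuous

lemma contL {ι : A ⊗[ℂ] B →ₗ[ℂ] X} (h : TC ι) (b : B) : Continuous fun a => ι (a ⊗ₜ[ℂ] b) :=
  ((ι ∘ₗ (TensorProduct.mk ℂ A B).flip b).mkContinuous ‖b‖ (fun a => by rw [mul_comm]; exact h.bd a b)).continuous

lemma lim_r {ι : A ⊗[ℂ] B →ₗ[ℂ] X} (h : TC ι) {K : TwoSidedIdeal X} (hK : IsClosed (K : Set X)) {a : A} {b : B}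
    (hb : (∀ f, ι (a ⊗ₜ (f * b)) ∈ K) ∨ (∀ f, ι (a ⊗ₜ (b * f)) ∈ K)) : ι (a ⊗ₜ b) ∈ K := by
  refine mem_of_approx (S := (fun b => ι (a ⊗ₜ[ℂ] b)) ⁻¹' (K : Set X)) (hK.preimage (contR h a)) fun δ hδ => ?_
  rcases hb with hb | hb
  · obtain ⟨e, he⟩ := au_l b hδ
    exact ⟨_, hb e, he⟩
  · obtain ⟨e, he⟩ := au_r b hδ
    exact ⟨_, hb e, he⟩

lemma lim_l {ι : A ⊗[ℂ] B →ₗ[ℂ] X} (h : TC ι) {K : TwoSidedIdeal X} (hK : IsClosed (K : Set X)) {a : A} {b : B}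
    (ha : (∀ f, ι ((f * a) ⊗ₜ b) ∈ K) ∨ (∀ f, ι ((a * f) ⊗ₜ b) ∈ K)) : ι (a ⊗ₜ b) ∈ K := by
  refine mem_of_approx (S := (fun a => ι (a ⊗ₜ[ℂ] b)) ⁻¹' (K : Set X)) (hK.preimage (contL h b)) fun δ hδ => ?_
  rcases ha with ha | ha
  · obtain ⟨e, he⟩ := au_l a hδ
    exact ⟨_, ha e, he⟩
  · obtain ⟨e, he⟩ := au_r a hδ
    exact ⟨_, ha e, he⟩

def idE {ι : A ⊗[ℂ] B →ₗ[ℂ] X} (h : TC ι) (K : TwoSidedIdeal X) (hK : IsClosed (K : Set X)) : TwoSidedIdeal A :=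
  TwoSidedIdeal.mk' {a | ∀ b, ι (a ⊗ₜ b) ∈ K}
    (fun b => by rw [TensorProduct.zero_tmul, map_zero]; exact K.zero_mem)
    (fun ha hb b => by rw [TensorProduct.add_tmul, map_add]; exact K.add_mem (ha b) (hb b))
    (fun ha b => by rw [TensorProduct.neg_tmul, map_neg]; exact K.neg_mem (ha b))
    (fun ha b => lim_r h hK (Or.inl fun f => by rw [← h.mul]; exact K.mul_mem_left _ _ (ha b)))
    (fun ha b => lim_r h hK (Or.inr fun f => by rw [← h.mul]; exact K.mul_mem_right _ _ (ha b)))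

def idF {ι : A ⊗[ℂ] B →ₗ[ℂ] X} (h : TC ι) (K : TwoSidedIdeal X) (hK : IsClosed (K : Set X)) : TwoSidedIdeal B :=
  TwoSidedIdeal.mk' {b | ∀ a, ι (a ⊗ₜ b) ∈ K}
    (fun b => by rw [TensorProduct.tmul_zero, map_zero]; exact K.zero_mem)
    (fun ha hb b => by rw [TensorProduct.tmul_add, map_add]; exact K.add_mem (ha b) (hb b))
    (fun ha b => by rw [TensorProduct.tmul_neg, map_neg]; exact K.neg_mem (ha b))
    (fun ha b => lim_l h hK (Or.inl fun f => by rw [← h.mul]; exact K.mul_mem_left _ _ (ha b)))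
    (fun ha b => lim_l h hK (Or.inr fun f => by rw [← h.mul]; exact K.mul_mem_right _ _ (ha b)))

lemma mem_idE {ι : A ⊗[ℂ] B →ₗ[ℂ] X} (h : TC ι) {K : TwoSidedIdeal X} (hK : IsClosed (K : Set X)) {a : A} :
    a ∈ idE h K hK ↔ ∀ b, ι (a ⊗ₜ b) ∈ K := TwoSidedIdeal.mem_mk' _ _ _ _ _ _ _

lemma mem_idF {ι : A ⊗[ℂ] B →ₗ[ℂ] X} (h : TC ι) {K : TwoSidedIdeal X} (hK : IsClosed (K : Set X)) {b : B} :
    b ∈ idF h K hK ↔ ∀ a, ι (a ⊗ₜ b) ∈ K := TwoSidedIdeal.mem_mk' _ _ _ _ _ _ _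

lemma idE_closed {ι : A ⊗[ℂ] B →ₗ[ℂ] X} (h : TC ι) {K : TwoSidedIdeal X} (hK : IsClosed (K : Set X)) :
    IsClosed (idE h K hK : Set A) := by
  have : (idE h K hK : Set A) = ⋂ b, (fun a => ι (a ⊗ₜ[ℂ] b)) ⁻¹' (K : Set X) := by
    ext z
    rw [SetLike.mem_coe, mem_idE]
    simp
  rw [this]
  exact isClosed_iInter fun b => hK.preimage (contL h b)

lemma idF_closed {ι : A ⊗[ℂ] B →ₗ[ℂ] X} (h : TC ι) {K : TwoSidedIdeal X} (hK : IsClosed (K : Set X)) :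
    IsClosed (idF h K hK : Set B) := by
  have : (idF h K hK : Set B) = ⋂ a, (fun b => ι (a ⊗ₜ[ℂ] b)) ⁻¹' (K : Set X) := by
    ext z
    rw [SetLike.mem_coe, mem_idF]
    simp
  rw [this]
  exact isClosed_iInter fun b => hK.preimage (contR h b)

/-- a product `z x w` lies in `K` once it does for elementary `x` -/
lemma mid_ind {ι : A ⊗[ℂ] B →ₗ[ℂ] X} (h : TC ι) {K : TwoSidedIdeal X} (hK : IsClosed (K : Set X)) {z w : X}
    (hzw : ∀ p q, z * ι (p ⊗ₜ q) * w ∈ K) (x : X) : z * x * w ∈ K :=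
  X_ind h (W := (idX h K hK).comap ((rmulX w).comp (lmulX z)).toLinearMap)
    (hK.preimage ((rmulX w).comp (lmulX z)).continuous) (fun p q => hzw p q) x

lemma idE_prime {ι : A ⊗[ℂ] B →ₗ[ℂ] X} (h : TC ι) {K : TwoSidedIdeal X} (hK : IsClosedPrimeIdeal K) :
    IsClosedPrimeIdeal (idE h K hK.1) := by
  refine ⟨idE_closed h hK.1, fun htop => hK.2.1 (Set.eq_univ_of_forall fun x => ?_), fun I J hI hJ hIJ => ?_⟩
  · refine X_ind h (W := idX h K hK.1) hK.1 (fun a b => ?_) x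
    have : a ∈ (idE h K hK.1 : Set A) := by rw [htop]; trivial
    exact (mem_idE h hK.1).1 this b
  · by_contra hcon
    push Not at hcon
    obtain ⟨h1, h2⟩ := hcon
    obtain ⟨a, ha, ha'⟩ := Set.not_subset.1 h1
    obtain ⟨c, hc, hc'⟩ := Set.not_subset.1 h2
    rw [SetLike.mem_coe, mem_idE] at ha' hc'
    push Not at ha' hc'
    obtain ⟨b, hb⟩ := ha'
    obtain ⟨d, hd⟩ := hc'
    obtain ⟨x, hx⟩ := prime_el (fun y δ hδ => au_X h y hδ) hK hb hd
    refine hx (mid_ind h hK.1 (fun p q => ?_) x)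
    rw [h.mul, h.mul]
    exact (mem_idE h hK.1).1 (hIJ _ (I.mul_mem_right _ _ ha) _ hc) _

lemma idF_prime {ι : A ⊗[ℂ] B →ₗ[ℂ] X} (h : TC ι) {K : TwoSidedIdeal X} (hK : IsClosedPrimeIdeal K) :
    IsClosedPrimeIdeal (idF h K hK.1) := by
  refine ⟨idF_closed h hK.1, fun htop => hK.2.1 (Set.eq_univ_of_forall fun x => ?_), fun I J hI hJ hIJ => ?_⟩
  · refine X_ind h (W := idX h K hK.1) hK.1 (fun a b => ?_) x
    have : b ∈ (idF h K hK.1 : Set B) := by rw [htop]; trivial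
    exact (mem_idF h hK.1).1 this a
  · by_contra hcon
    push Not at hcon
    obtain ⟨h1, h2⟩ := hcon
    obtain ⟨a, ha, ha'⟩ := Set.not_subset.1 h1
    obtain ⟨c, hc, hc'⟩ := Set.not_subset.1 h2
    rw [SetLike.mem_coe, mem_idF] at ha' hc'
    push Not at ha' hc'
    obtain ⟨b, hb⟩ := ha'
    obtain ⟨d, hd⟩ := hc'
    obtain ⟨x, hx⟩ := prime_el (fun y δ hδ => au_X h y hδ) hK hb hd
    refine hx (mid_ind h hK.1 (fun p q => ?_) x)
    rw [h.mul, h.mul]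
    exact (mem_idF h hK.1).1 (hIJ _ (I.mul_mem_right _ _ ha) _ hc) _

/-- the sum ideal as a submodule -/
def K0 (ι : A ⊗[ℂ] B →ₗ[ℂ] X) (E : TwoSidedIdeal A) (F : TwoSidedIdeal B) : Submodule ℂ X :=
  tsub ι (E : Set A) Set.univ ⊔ tsub ι Set.univ (F : Set B)

lemma K0_le {ι : A ⊗[ℂ] B →ₗ[ℂ] X} {E : TwoSidedIdeal A} {F : TwoSidedIdeal B} {W : Submodule ℂ X}
    (hW : IsClosed (W : Set X)) (hE : ∀ a ∈ E, ∀ b, ι (a ⊗ₜ b) ∈ W) (hF : ∀ a, ∀ b ∈ F, ι (a ⊗ₜ b) ∈ W) :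
    K0 ι E F ≤ W :=
  sup_le (tsub_le hW fun a ha b _ => hE a ha b) (tsub_le hW fun a _ b hb => hF a b hb)

lemma mem_K0_l {ι : A ⊗[ℂ] B →ₗ[ℂ] X} {E : TwoSidedIdeal A} {F : TwoSidedIdeal B} {a : A} (ha : a ∈ E) (b : B) :
    ι (a ⊗ₜ b) ∈ K0 ι E F :=
  (le_sup_left : tsub ι (E : Set A) Set.univ ≤ K0 ι E F) (tmul_mem ha trivial)

lemma mem_K0_r {ι : A ⊗[ℂ] B →ₗ[ℂ] X} {E : TwoSidedIdeal A} {F : TwoSidedIdeal B} (a : A) {b : B} (hb : b ∈ F) :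
    ι (a ⊗ₜ b) ∈ K0 ι E F :=
  (le_sup_right : tsub ι Set.univ (F : Set B) ≤ K0 ι E F) (tmul_mem trivial hb)

end P24
end GT

namespace GT
open Filter Topology

section P25
set_option linter.unusedSectionVars false

variable {A B : Type u} [NonUnitalCStarAlgebra A] [NonUnitalCStarAlgebra B]
  {X : Type u} [NonUnitalNormedRing X] [StarRing X] [NormedSpace ℂ X] [CompleteSpace X]
  [IsScalarTower ℂ X X] [SMulCommClass ℂ X X]
  {NA : ∀ p : ℕ, Matrix (Fin p) (Fin p) A → ℝ} {NB : ∀ q : ℕ, Matrix (Fin q) (Fin q) B → ℝ}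
  {ι : A ⊗[ℂ] B →ₗ[ℂ] X}

lemma tc_of (hNA : ∀ p, IsCStarNorm (NA p)) (hNB : ∀ q, IsCStarNorm (NB q))
    (hX : IsTensorCompletion (osProjNorm NA NB) X ι) : TC ι := by
  let _ := CStarAlgebra.spectralOrder A
  have _ := CStarAlgebra.spectralOrderedRing A
  let _ := CStarAlgebra.spectralOrder B
  have _ := CStarAlgebra.spectralOrderedRing B
  exact ⟨fun a b => by rw [hX.norm_eq]; exact os_tmul_le hNA hNB a b, hX.dense, fun a b c d => hX.mul_tmul a c b d⟩

lemma coe_K0 (E : TwoSidedIdeal A) (F : TwoSidedIdeal B) : (K0 ι E F : Set X) =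
    tensorIdeal ι (Set.univ : Set A) (F : Set B) + tensorIdeal ι (E : Set A) (Set.univ : Set B) := by
  rw [K0, Submodule.coe_sup, add_comm]
  rfl

/-- ideals not contained in `K0` contain a nontrivial elementary tensor -/
lemma exists_elem (hNA : ∀ p, IsCStarNorm (NA p)) (hNB : ∀ q, IsCStarNorm (NB q))
    (hX : IsTensorCompletion (osProjNorm NA NB) X ι) {E : TwoSidedIdeal A} {F : TwoSidedIdeal B}
    (hE : IsClosed (E : Set A)) (hF : IsClosed (F : Set B)) {I : TwoSidedIdeal X} (hI : IsClosed (I : Set X))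
    (hIE : ∀ a ∈ E, ∀ b, ι (a ⊗ₜ b) ∈ I) (hIF : ∀ a, ∀ b ∈ F, ι (a ⊗ₜ b) ∈ I)
    {x : X} (hx : x ∈ I) (hx0 : x ∉ K0 ι E F) : ∃ c d, c ∉ E ∧ d ∉ F ∧ ι (c ⊗ₜ d) ∈ I := by
  have hT := tc_of hNA hNB hX
  let _ := CStarAlgebra.spectralOrder A
  have _ := CStarAlgebra.spectralOrderedRing A
  let _ := CStarAlgebra.spectralOrder B
  have _ := CStarAlgebra.spectralOrderedRing B
  obtain ⟨g, hg, gS, gx⟩ := hb_sep (K0 ι E F) (K0_closed hT E F hE) hx0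
  have hk : ¬ Killed ι (idS E hE) (idS F hF) x := fun hk =>
    gx (propG hNA hNB hX.norm_eq hX.dense (idS_si E hE) (idS_si F hF) hk hg
      (fun a ha b => gS _ (mem_K0_l ha b)) (fun a b hb => gS _ (mem_K0_r a hb)))
  unfold Killed at hk
  push Not at hk
  obtain ⟨φ, ψ, hφ, hψ, L, hL, hLx⟩ := hk
  exact elem hT hE hF hI hIE hIF hx hφ hψ L hL hLx

lemma elem_not_mem (hNA : ∀ p, IsCStarNorm (NA p)) (hNB : ∀ q, IsCStarNorm (NB q))
    (hX : IsTensorCompletion (osProjNorm NA NB) X ι) {E : TwoSidedIdeal A} {F : TwoSidedIdeal B}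
    (hE : IsClosed (E : Set A)) (hF : IsClosed (F : Set B)) {a : A} {b : B} (ha : a ∉ E) (hb : b ∉ F) :
    ι (a ⊗ₜ b) ∉ K0 ι E F := by
  let _ := CStarAlgebra.spectralOrder A
  have _ := CStarAlgebra.spectralOrderedRing A
  let _ := CStarAlgebra.spectralOrder B
  have _ := CStarAlgebra.spectralOrderedRing B
  obtain ⟨φ, hφ, φa⟩ := pv_sep hE ha
  obtain ⟨ψ, hψ, ψb⟩ := pv_sep hF hb
  obtain ⟨L, hL⟩ := prod_ext hNA hNB hX.norm_eq hX.dense hφ hψ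
  intro hab
  have h0 : K0 ι E F ≤ LinearMap.ker L.toLinearMap := by
    refine K0_le L.isClosed_ker (fun a ha b => ?_) (fun a b hb => ?_)
    · change L _ = 0
      rw [hL, hφ.2.2 a ha, zero_mul]
    · change L _ = 0
      rw [hL, hψ.2.2 b hb, mul_zero]
  have : L (ι (a ⊗ₜ b)) = 0 := h0 hab
  rw [hL] at this
  exact mul_ne_zero φa ψb this

lemma main_mp (hNA : ∀ p, IsCStarNorm (NA p)) (hNB : ∀ q, IsCStarNorm (NB q))
    (hX : IsTensorCompletion (osProjNorm NA NB) X ι) {K : TwoSidedIdeal X} (hK : IsClosedPrimeIdeal K) :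
    ∃ (E : TwoSidedIdeal A) (F : TwoSidedIdeal B), IsClosedPrimeIdeal E ∧ IsClosedPrimeIdeal F ∧
      (K : Set X) = (K0 ι E F : Set X) := by
  have hT := tc_of hNA hNB hX
  refine ⟨idE hT K hK.1, idF hT K hK.1, idE_prime hT hK, idF_prime hT hK, ?_⟩
  have hIE : ∀ a ∈ idE hT K hK.1, ∀ b, ι (a ⊗ₜ b) ∈ K := fun a ha => (mem_idE hT hK.1).1 ha
  have hIF : ∀ a, ∀ b ∈ idF hT K hK.1, ι (a ⊗ₜ b) ∈ K := fun a b hb => (mem_idF hT hK.1).1 hb a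
  refine Set.Subset.antisymm (fun x hx => ?_) (K0_le (W := idX hT K hK.1) hK.1 hIE hIF)
  by_contra hx0
  obtain ⟨c, d, hc, hd, hcd⟩ := exists_elem hNA hNB hX (idE_closed hT hK.1) (idF_closed hT hK.1) hK.1 hIE hIF hx hx0
  rw [mem_idE] at hc
  rw [mem_idF] at hd
  push Not at hc hd
  obtain ⟨b, hb⟩ := hc
  obtain ⟨a, ha⟩ := hd
  obtain ⟨y, hy⟩ := prime_el (fun y δ hδ => au_X hT y hδ) hK hb ha
  refine hy (mid_ind hT hK.1 (fun p q => ?_) y)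
  rw [hT.mul, hT.mul]
  refine lim_l hT hK.1 (Or.inl fun e => lim_r hT hK.1 (Or.inr fun f => ?_))
  have := K.mul_mem_right _ (ι ((p * a) ⊗ₜ f)) (K.mul_mem_left (ι (e ⊗ₜ (b * q))) _ hcd)
  rw [hT.mul, hT.mul] at this
  simpa only [mul_assoc] using this

lemma main_mpr (hNA : ∀ p, IsCStarNorm (NA p)) (hNB : ∀ q, IsCStarNorm (NB q))
    (hX : IsTensorCompletion (osProjNorm NA NB) X ι) {K : TwoSidedIdeal X} (hK : IsClosed (K : Set X))
    {E : TwoSidedIdeal A} {F : TwoSidedIdeal B} (hE : IsClosedPrimeIdeal E) (hF : IsClosedPrimeIdeal F)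
    (hKe : (K : Set X) = (K0 ι E F : Set X)) : IsClosedPrimeIdeal K := by
  have hT := tc_of hNA hNB hX
  have hmem : ∀ x, x ∈ K ↔ x ∈ K0 ι E F := fun x => by
    rw [← SetLike.mem_coe, hKe, SetLike.mem_coe]
  refine ⟨hK, fun htop => ?_, fun I J hI hJ hIJ => ?_⟩
  · obtain ⟨a, ha⟩ := (Set.ne_univ_iff_exists_notMem _).1 hE.2.1
    obtain ⟨b, hb⟩ := (Set.ne_univ_iff_exists_notMem _).1 hF.2.1
    refine elem_not_mem hNA hNB hX hE.1 hF.1 ha hb ((hmem _).1 ?_)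
    rw [← SetLike.mem_coe, htop]
    trivial
  · by_contra hcon
    push Not at hcon
    obtain ⟨h1, h2⟩ := hcon
    obtain ⟨x, hx, hx'⟩ := Set.not_subset.1 h1
    obtain ⟨y, hy, hy'⟩ := Set.not_subset.1 h2
    set I' := lq K (J : Set X) with hI'
    set J' := rq K (I' : Set X) with hJ'
    have hKI : ∀ z ∈ K, z ∈ I' := fun z hz => mem_lq.2 fun w _ x => K.mul_mem_right _ _ (K.mul_mem_right _ _ hz)
    have hKJ : ∀ z ∈ K, z ∈ J' := fun z hz => mem_rq.2 fun w _ x => K.mul_mem_left _ _ hz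
    have hxI : x ∈ I' := mem_lq.2 fun w hw p => hIJ _ (I.mul_mem_right _ _ hx) _ hw
    have hyJ : y ∈ J' := mem_rq.2 fun z hz p => mem_lq.1 hz y hy p
    obtain ⟨c, d, hc, hd, hcd⟩ := exists_elem hNA hNB hX hE.1 hF.1 (lq_closed hK (J : Set X))
      (fun a ha b => hKI _ ((hmem _).2 (mem_K0_l ha b))) (fun a b hb => hKI _ ((hmem _).2 (mem_K0_r a hb)))
      hxI (fun hx0 => hx' ((hmem _).2 hx0))
    obtain ⟨c', d', hc', hd', hcd'⟩ := exists_elem hNA hNB hX hE.1 hF.1 (rq_closed hK (I' : Set X))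
      (fun a ha b => hKJ _ ((hmem _).2 (mem_K0_l ha b))) (fun a b hb => hKJ _ ((hmem _).2 (mem_K0_r a hb)))
      hyJ (fun hx0 => hy' ((hmem _).2 hx0))
    obtain ⟨p, hp⟩ := prime_el (fun y δ hδ => au_l y hδ) hE hc hc'
    obtain ⟨q, hq⟩ := prime_el (fun y δ hδ => au_l y hδ) hF hd hd'
    have := mem_rq.1 hcd' _ hcd (ι (p ⊗ₜ q))
    rw [hT.mul, hT.mul] at this
    exact elem_not_mem hNA hNB hX hE.1 hF.1 hp hq ((hmem _).1 this)

end P25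
end GT

/-- A closed two-sided ideal `K` of `A ⊗̂ B` is prime if and only if
`K = A ⊗̂ F + E ⊗̂ B` for some prime closed ideals `E` of `A` and `F` of `B`. -/
theorem closed_prime_ideal_iff {A B X : Type u} [NonUnitalCStarAlgebra A] [NonUnitalCStarAlgebra B]
    [NonUnitalNormedRing X] [StarRing X] [NormedSpace ℂ X] [CompleteSpace X]
    [IsScalarTower ℂ X X] [SMulCommClass ℂ X X]
    (NA : ∀ p : ℕ, Matrix (Fin p) (Fin p) A → ℝ)
    (NB : ∀ q : ℕ, Matrix (Fin q) (Fin q) B → ℝ)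
    (hNA : ∀ p, IsCStarNorm (NA p)) (hNB : ∀ q, IsCStarNorm (NB q))
    (ι : A ⊗[ℂ] B →ₗ[ℂ] X) (hX : IsTensorCompletion (osProjNorm NA NB) X ι)
    (K : TwoSidedIdeal X) (hK : IsClosed (K : Set X)) :
    IsClosedPrimeIdeal K ↔
      ∃ (E : TwoSidedIdeal A) (F : TwoSidedIdeal B),
        IsClosedPrimeIdeal E ∧ IsClosedPrimeIdeal F ∧
        (K : Set X) =
          tensorIdeal ι (Set.univ : Set A) (F : Set B) +
            tensorIdeal ι (E : Set A) (Set.univ : Set B) := by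
  simp only [← GT.coe_K0]
  constructor
  · exact fun h => GT.main_mp hNA hNB hX h
  · rintro ⟨E, F, hE, hF, hKe⟩
    exact GT.main_mpr hNA hNB hX hK hE hF hKe

end
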